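/- arXiv:0706.1725 — 2 statements merged into one kernel-verified Lean document; each statement's English description precedes it below -/
import Mathlib

section
/- Let k ≥ 2 be an integer and let d be a real number with (2k−1)·log k ≤ d < 2k·log k. Then the probability that the chromatic number of the Erdős–Rényi random graph G(n, d/n) equals k+1 tends to 1 as n → ∞. -/
open Finset Filter
open scoped Classical

/-- The probability that the Erdős–Rényi random graph `G(n,p)` (each of the
`n(n-1)/2` possible edges present independently with probability `p`) satisfies
the property `P`. -/
noncomputable def erdosRenyiProb (n : ℕ) (p : ℝ) (P : SimpleGraph (Fin n) → Prop) : ℝ :=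
  ∑ G : SimpleGraph (Fin n),
    if P G then p ^ G.edgeFinset.card * (1 - p) ^ (n.choose 2 - G.edgeFinset.card) else 0

/-- The probability weight of `T` when each `e` is selected independently with probability `p e`. -/
noncomputable def selectionWeight {ε : Type*} [Fintype ε] [DecidableEq ε] (p : ε → ℝ)
    (T : Finset ε) : ℝ :=
  (∏ e ∈ T, p e) * ∏ e ∈ univ \ T, (1 - p e)

/-- The expectation of `F` at a random set containing each `e` independently with
probability `p e`. -/
noncomputable def selectionExp {ε : Type*} [Fintype ε] [DecidableEq ε] (p : ε → ℝ)
    (F : Finset ε → ℝ) : ℝ :=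
  ∑ T, selectionWeight p T * F T

section Selection

variable {ε : Type*} [Fintype ε] [DecidableEq ε]

/-- All probabilities lie in the unit interval. -/
def IsProbVec (p : ε → ℝ) : Prop := ∀ e, 0 ≤ p e ∧ p e ≤ 1

lemma selectionWeight_nonneg {p : ε → ℝ} (hp : IsProbVec p) (T : Finset ε) :
    0 ≤ selectionWeight p T :=
  mul_nonneg (prod_nonneg fun e _ => (hp e).1) (prod_nonneg fun e _ => by linarith [(hp e).2])

lemma selectionExp_prod (p f g : ε → ℝ) :
    selectionExp p (fun T => ∏ e, if e ∈ T then f e else g e) =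
      ∏ e, (p e * f e + (1 - p e) * g e) := by
  rw [prod_add, powerset_univ]
  refine sum_congr rfl fun T _ => ?_
  have h : (∏ e, if e ∈ T then f e else g e) = (∏ e ∈ T, f e) * ∏ e ∈ univ \ T, g e := by
    rw [prod_ite]
    congr 1
    · congr 1; ext; simp
    · congr 1; ext; simp
  simp only [h]
  rw [selectionWeight, prod_mul_distrib, prod_mul_distrib]
  ring

lemma selectionExp_one (p : ε → ℝ) : selectionExp p (fun _ => 1) = 1 := by
  have h := selectionExp_prod p (fun _ => 1) (fun _ => 1)
  simpa using h

lemma selectionExp_add (p : ε → ℝ) (F G : Finset ε → ℝ) :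
    selectionExp p (fun T => F T + G T) = selectionExp p F + selectionExp p G := by
  simp [selectionExp, mul_add, sum_add_distrib]

lemma selectionExp_sub (p : ε → ℝ) (F G : Finset ε → ℝ) :
    selectionExp p (fun T => F T - G T) = selectionExp p F - selectionExp p G := by
  simp [selectionExp, mul_sub, sum_sub_distrib]

lemma selectionExp_const_mul (p : ε → ℝ) (c : ℝ) (F : Finset ε → ℝ) :
    selectionExp p (fun T => c * F T) = c * selectionExp p F := by
  simp only [selectionExp, mul_sum]
  exact sum_congr rfl fun _ _ => by ring

lemma selectionExp_const (p : ε → ℝ) (c : ℝ) : selectionExp p (fun _ => c) = c := by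
  have h := selectionExp_const_mul p c (fun _ => 1)
  rw [selectionExp_one] at h
  simpa using h

lemma selectionExp_sum {ι : Type*} (p : ε → ℝ) (s : Finset ι) (F : ι → Finset ε → ℝ) :
    selectionExp p (fun T => ∑ i ∈ s, F i T) = ∑ i ∈ s, selectionExp p (F i) := by
  simp only [selectionExp, mul_sum]
  exact sum_comm

lemma selectionExp_mono {p : ε → ℝ} (hp : IsProbVec p) {F G : Finset ε → ℝ}
    (h : ∀ T, F T ≤ G T) : selectionExp p F ≤ selectionExp p G :=
  sum_le_sum fun T _ => mul_le_mul_of_nonneg_left (h T) (selectionWeight_nonneg hp T)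

lemma selectionExp_nonneg {p : ε → ℝ} (hp : IsProbVec p) {F : Finset ε → ℝ}
    (h : ∀ T, 0 ≤ F T) : 0 ≤ selectionExp p F :=
  sum_nonneg fun T _ => mul_nonneg (selectionWeight_nonneg hp T) (h T)

lemma selectionExp_le_one {p : ε → ℝ} (hp : IsProbVec p) {F : Finset ε → ℝ}
    (h : ∀ T, F T ≤ 1) : selectionExp p F ≤ 1 := by
  rw [← selectionExp_one p]
  exact selectionExp_mono hp h

lemma selectionExp_le_const {p : ε → ℝ} (hp : IsProbVec p) {F : Finset ε → ℝ} {c : ℝ}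
    (h : ∀ T, F T ≤ c) : selectionExp p F ≤ c := by
  rw [← selectionExp_const p c]
  exact selectionExp_mono hp h

lemma abs_selectionExp_le {p : ε → ℝ} (hp : IsProbVec p) (F : Finset ε → ℝ) :
    |selectionExp p F| ≤ selectionExp p (fun T => |F T|) := by
  refine (abs_sum_le_sum_abs _ _).trans (le_of_eq ?_)
  exact sum_congr rfl fun T _ => by rw [abs_mul, abs_of_nonneg (selectionWeight_nonneg hp T)]

lemma selectionWeight_eq_zero {p : ε → ℝ} {T : Finset ε} {e : ε} (he : e ∈ T) (h : p e = 0) :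
    selectionWeight p T = 0 := by
  rw [selectionWeight, prod_eq_zero he h, zero_mul]

lemma selectionExp_mono_support {p : ε → ℝ} (hp : IsProbVec p) {F G : Finset ε → ℝ}
    (h : ∀ T, (∀ e ∈ T, p e ≠ 0) → F T ≤ G T) : selectionExp p F ≤ selectionExp p G := by
  refine sum_le_sum fun T _ => ?_
  by_cases hT : ∀ e ∈ T, p e ≠ 0
  · exact mul_le_mul_of_nonneg_left (h T hT) (selectionWeight_nonneg hp T)
  · push Not at hT
    obtain ⟨e, he, h0⟩ := hT
    simp [selectionWeight_eq_zero he h0]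

lemma selectionExp_congr_support {p : ε → ℝ} {F G : Finset ε → ℝ}
    (h : ∀ T, (∀ e ∈ T, p e ≠ 0) → F T = G T) : selectionExp p F = selectionExp p G := by
  refine sum_congr rfl fun T _ => ?_
  by_cases hT : ∀ e ∈ T, p e ≠ 0
  · rw [h T hT]
  · push Not at hT
    obtain ⟨e, he, h0⟩ := hT
    simp [selectionWeight_eq_zero he h0]

/-- The inclusion probabilities of the union of two independent random sets. -/
def probUnion (p p' : ε → ℝ) : ε → ℝ := fun e => p e + p' e - p e * p' e

lemma selectionWeight_eq_prod (p : ε → ℝ) (R : Finset ε) :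
    selectionWeight p R = ∏ e, if e ∈ R then p e else 1 - p e := by
  rw [selectionWeight, prod_ite]
  congr 1
  · congr 1; ext; simp
  · congr 1; ext; simp

lemma ite_eq_prod_ite (T R : Finset ε) :
    (if T = R then (1 : ℝ) else 0) = ∏ e, if (e ∈ T ↔ e ∈ R) then 1 else 0 := by
  by_cases h : T = R
  · subst h; simp
  · rw [if_neg h]
    have : ∃ e, ¬ (e ∈ T ↔ e ∈ R) := by
      by_contra hc
      push Not at hc
      exact h (ext hc)
    obtain ⟨e, he⟩ := this
    exact (prod_eq_zero (mem_univ e) (by rw [if_neg he])).symm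

lemma selectionExp_union_ite (p p' : ε → ℝ) (R : Finset ε) :
    selectionExp p (fun T => selectionExp p' (fun T' => if T ∪ T' = R then 1 else 0)) =
      selectionWeight (probUnion p p') R := by
  have h1 : ∀ T, selectionExp p' (fun T' => if T ∪ T' = R then 1 else 0) =
      ∏ e, if e ∈ T then (if e ∈ R then 1 else 0)
        else (if e ∈ R then p' e else 1 - p' e) := by
    intro T
    have h2 : (fun T' => if T ∪ T' = R then (1 : ℝ) else 0) =
        fun T' => ∏ e, if e ∈ T' then (if e ∈ R then 1 else 0)
          else (if (e ∈ T ↔ e ∈ R) then 1 else 0) := by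
      funext T'
      rw [ite_eq_prod_ite]
      refine prod_congr rfl fun e _ => ?_
      by_cases ha : e ∈ T <;> by_cases hb : e ∈ T' <;> by_cases hc : e ∈ R <;> simp [ha, hb, hc]
    rw [h2, selectionExp_prod]
    refine prod_congr rfl fun e _ => ?_
    by_cases ha : e ∈ T <;> by_cases hc : e ∈ R <;> simp [ha, hc]
  simp only [h1]
  rw [selectionExp_prod, selectionWeight_eq_prod]
  refine prod_congr rfl fun e _ => ?_
  by_cases hc : e ∈ R <;> simp [hc, probUnion] <;> ring

lemma selectionExp_union (p p' : ε → ℝ) (F : Finset ε → ℝ) :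
    selectionExp p (fun T => selectionExp p' (fun T' => F (T ∪ T'))) =
      selectionExp (probUnion p p') F := by
  have h : ∀ T T', F (T ∪ T') = ∑ R, F R * (if T ∪ T' = R then 1 else 0) := by
    intro T T'; simp
  simp only [h]
  simp only [selectionExp_sum, selectionExp_const_mul, selectionExp_union_ite]
  exact sum_congr rfl fun _ _ => mul_comm _ _

/-- The vector equal to `p` on `U` and `0` elsewhere. -/
noncomputable def probOn (U : Finset ε) (p : ℝ) : ε → ℝ := fun e => if e ∈ U then p else 0

lemma isProbVec_probOn {ι : Type*} [DecidableEq ι] (U : Finset ι) {p : ℝ} (h0 : 0 ≤ p)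
    (h1 : p ≤ 1) :
    IsProbVec (probOn U p) := by
  intro e
  by_cases h : e ∈ U <;> simp [probOn, h, h0, h1]

lemma probUnion_probOn_disjoint {ι : Type*} [DecidableEq ι] {U U' : Finset ι}
    (h : Disjoint U U') (p : ℝ) :
    probUnion (probOn U p) (probOn U' p) = probOn (U ∪ U') p := by
  funext e
  by_cases h1 : e ∈ U
  · have h2 : e ∉ U' := disjoint_left.mp h h1
    simp [probUnion, probOn, h1, h2]
  · by_cases h2 : e ∈ U' <;> simp [probUnion, probOn, h1, h2]

lemma probUnion_probOn_same {ι : Type*} [DecidableEq ι] (U : Finset ι) (p p' : ℝ) :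
    probUnion (probOn U p) (probOn U p') = probOn U (p + p' - p * p') := by
  funext e
  by_cases h1 : e ∈ U <;> simp [probUnion, probOn, h1]

lemma mem_of_probOn_ne_zero {ι : Type*} [DecidableEq ι] {U T : Finset ι} {p : ℝ}
    (h : ∀ e ∈ T, probOn U p e ≠ 0) : T ⊆ U := by
  intro e he
  by_contra hU
  exact h e he (by simp [probOn, hU])

lemma selectionExp_disjoint (P : Finset ε) (p : ε → ℝ) :
    selectionExp p (fun T => if Disjoint T P then 1 else 0) = ∏ e ∈ P, (1 - p e) := by
  have h : (fun T : Finset ε => if Disjoint T P then (1 : ℝ) else 0) =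
      fun T => ∏ e, if e ∈ T then (if e ∈ P then 0 else 1) else 1 := by
    funext T
    by_cases hd : Disjoint T P
    · rw [if_pos hd]
      refine (prod_eq_one fun e _ => ?_).symm
      by_cases he : e ∈ T
      · simp [he, disjoint_left.mp hd he]
      · simp [he]
    · rw [if_neg hd]
      obtain ⟨e, he, he'⟩ := not_disjoint_iff.mp hd
      exact (prod_eq_zero (mem_univ e) (by simp [he, he'])).symm
  rw [h, selectionExp_prod, ← prod_subset (subset_univ P)]
  · exact prod_congr rfl fun e he => by simp [he]
  · intro e _ he; simp [he]

lemma selectionExp_disjoint_le {P : Finset ε} {p : ε → ℝ} (hp : IsProbVec p) :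
    selectionExp p (fun T => if Disjoint T P then 1 else 0) ≤ Real.exp (-∑ e ∈ P, p e) := by
  rw [selectionExp_disjoint, ← sum_neg_distrib, Real.exp_sum]
  refine prod_le_prod (fun e _ => by linarith [(hp e).2]) fun e _ => ?_
  linarith [Real.add_one_le_exp (-p e)]

lemma one_sub_sum_le_selectionExp_disjoint {P : Finset ε} {p : ε → ℝ} (hp : IsProbVec p) :
    1 - ∑ e ∈ P, p e ≤ selectionExp p (fun T => if Disjoint T P then 1 else 0) := by
  rw [selectionExp_disjoint]
  induction P using Finset.induction_on with
  | empty => simp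
  | insert a s ha ih =>
    rw [sum_insert ha, prod_insert ha]
    have h1 : ∏ e ∈ s, (1 - p e) ≤ 1 :=
      prod_le_one (fun e _ => by linarith [(hp e).2]) fun e _ => by linarith [(hp e).1]
    nlinarith [(hp a).1]

lemma selectionExp_pow_card (U : Finset ε) (p z : ℝ) :
    selectionExp (probOn U p) (fun T => z ^ T.card) = (1 - p + p * z) ^ U.card := by
  have h : (fun T : Finset ε => z ^ T.card) = fun T => ∏ e, if e ∈ T then z else 1 := by
    funext T
    rw [← prod_const, prod_ite_mem, univ_inter]
  rw [h, selectionExp_prod, ← prod_const, ← prod_subset (subset_univ U)]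
  · exact prod_congr rfl fun e he => by simp [probOn, he]; ring
  · intro e _ he; simp [probOn, he]

/-- Monotone functions have larger expectation at larger probabilities. -/
lemma selectionExp_mono_prob (U : Finset ε) {p p' : ℝ} (h0 : 0 ≤ p) (h : p ≤ p') (h1 : p' ≤ 1)
    {F : Finset ε → ℝ} (hF : Monotone F) :
    selectionExp (probOn U p) F ≤ selectionExp (probOn U p') F := by
  rcases eq_or_lt_of_le (h.trans h1) with hp | hp
  · rw [show p' = p by linarith]
  · set s : ℝ := (p' - p) / (1 - p) with hs
    have hs0 : 0 ≤ s := div_nonneg (by linarith) (by linarith)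
    have hs1 : s ≤ 1 := by rw [hs, div_le_one (by linarith)]; linarith
    have hps : p' = p + s - p * s := by rw [hs]; field_simp [show (1 - p) ≠ 0 by linarith]; ring
    rw [hps, ← probUnion_probOn_same, ← selectionExp_union]
    refine selectionExp_mono (isProbVec_probOn _ h0 hp.le) fun T => ?_
    rw [← selectionExp_const (probOn U s) (F T)]
    exact selectionExp_mono (isProbVec_probOn _ hs0 hs1) fun T' => hF subset_union_left

end Selection

/-- The pairs `(u, v)` with `u < v`, representing the possible edges. -/
def pairSet (n : ℕ) : Finset (Fin n × Fin n) := univ.filter fun e => e.1 < e.2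

/-- The possible edges with no endpoint in `W`. -/
def pairsOff {n : ℕ} (W : Finset (Fin n)) : Finset (Fin n × Fin n) :=
  (pairSet n).filter fun e => e.1 ∉ W ∧ e.2 ∉ W

/-- `σ` is a proper coloring of the graph with edge set `T`. -/
def IsProper {n q : ℕ} (σ : Fin n → Fin q) (T : Finset (Fin n × Fin n)) : Prop :=
  ∀ e ∈ T, σ e.1 ≠ σ e.2

/-- The graph with edge set `T` is `q`-colorable. -/
def PairColorable {n : ℕ} (q : ℕ) (T : Finset (Fin n × Fin n)) : Prop :=
  ∃ σ : Fin n → Fin q, IsProper σ T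

/-- No proper coloring of `T` avoids the color `c s` at `y s` for all `s`. -/
def Blocks {n q r : ℕ} (T : Finset (Fin n × Fin n)) (c : Fin r → Fin q) (y : Fin r → Fin n) :
    Prop :=
  ¬ ∃ σ : Fin n → Fin q, IsProper σ T ∧ ∀ s, σ (y s) ≠ c s

/-- The proportion of tuples of vertices at which forbidding the colors `c` destroys
colorability. -/
noncomputable def blockDensity {n q r : ℕ} (T : Finset (Fin n × Fin n)) (c : Fin r → Fin q) : ℝ :=
  (∑ y : Fin r → Fin n, if Blocks T c y then (1 : ℝ) else 0) / (n : ℝ) ^ r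

section Sprinkling

variable {n q r : ℕ}

lemma IsProper.mono {σ : Fin n → Fin q} {T T' : Finset (Fin n × Fin n)} (h : T ⊆ T')
    (hσ : IsProper σ T') : IsProper σ T := fun e he => hσ e (h he)

lemma PairColorable.mono {T T' : Finset (Fin n × Fin n)} (h : T ⊆ T')
    (hT : PairColorable q T') : PairColorable q T := hT.imp fun _ hσ => hσ.mono h

lemma isProper_insert_swap {σ : Fin n → Fin q} {T : Finset (Fin n × Fin n)} (e : Fin n × Fin n) :
    IsProper σ (insert e.swap T) ↔ IsProper σ (insert e T) := by
  simp only [IsProper, forall_mem_insert, Prod.fst_swap, Prod.snd_swap]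
  rw [ne_comm]

lemma blockDensity_insert_swap (T : Finset (Fin n × Fin n)) (c : Fin r → Fin q)
    (e : Fin n × Fin n) :
    blockDensity (insert e.swap T) c = blockDensity (insert e T) c := by
  have h : ∀ y, Blocks (insert e.swap T) c y ↔ Blocks (insert e T) c y := fun y => by
    simp only [Blocks, isProper_insert_swap]
  unfold blockDensity
  exact congrArg (· / _) (sum_congr rfl fun y _ => if_congr (h y) rfl rfl)

lemma blockDensity_le_one (T : Finset (Fin n × Fin n)) (c : Fin r → Fin q) :
    blockDensity T c ≤ 1 := by
  refine div_le_one_of_le₀ ?_ (by positivity)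
  refine (sum_le_card_nsmul _ _ 1 fun _ _ => by split_ifs <;> norm_num).trans ?_
  simp

lemma blockDensity_mono {T T' : Finset (Fin n × Fin n)} (h : T ⊆ T') (c : Fin r → Fin q) :
    blockDensity T c ≤ blockDensity T' c := by
  refine div_le_div_of_nonneg_right (sum_le_sum fun y _ => ?_) (by positivity)
  by_cases hb : Blocks T c y
  · have : Blocks T' c y := fun ⟨σ, h1, h2⟩ => hb ⟨σ, h1.mono h, h2⟩
    simp [hb, this]
  · simp only [hb, if_false]; split_ifs <;> norm_num

/-- If two vertices both block in the first slot, then an edge between them makes the first slot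
redundant. -/
lemma Blocks.insert_pair {T : Finset (Fin n × Fin n)} {c : Fin (r + 1) → Fin q} {x x' : Fin n}
    {y : Fin r → Fin n} (h : Blocks T c (Fin.cons x y)) (h' : Blocks T c (Fin.cons x' y)) :
    Blocks (insert (x, x') T) (Fin.tail c) y := by
  rintro ⟨σ, h1, h2⟩
  have hT : IsProper σ T := h1.mono (subset_insert _ _)
  have hx : σ x ≠ σ x' := h1 (x, x') (mem_insert_self _ _)
  by_cases hc : σ x = c 0
  · refine h' ⟨σ, hT, fun s => ?_⟩
    refine Fin.cases ?_ (fun i => ?_) s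
    · simp only [Fin.cons_zero]; rw [← hc]; exact hx.symm
    · simpa [Fin.tail] using h2 i
  · refine h ⟨σ, hT, fun s => ?_⟩
    refine Fin.cases ?_ (fun i => ?_) s
    · simpa using hc
    · simpa [Fin.tail] using h2 i

lemma sum_blockDensity_insert (hn : 0 < n) (T : Finset (Fin n × Fin n))
    (c : Fin (r + 1) → Fin q) :
    blockDensity T c ^ 2 * (n : ℝ) ^ 2 ≤
      ∑ e : Fin n × Fin n, blockDensity (insert e T) (Fin.tail c) := by
  have hn' : (0 : ℝ) < n := by exact_mod_cast hn
  set g : Fin n → (Fin r → Fin n) → ℝ := fun x y => if Blocks T c (Fin.cons x y) then 1 else 0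
    with hg
  have h1 : ∑ y : Fin (r + 1) → Fin n, (if Blocks T c y then (1 : ℝ) else 0) =
      ∑ y : Fin r → Fin n, ∑ x, g x y := by
    rw [sum_comm, ← Fintype.sum_prod_type']
    exact (Fintype.sum_equiv (Fin.consEquiv fun _ => Fin n) _ _ fun _ => rfl).symm
  have h2 : (∑ y : Fin r → Fin n, ∑ x, g x y) ^ 2 ≤
      (n : ℝ) ^ r * ∑ y : Fin r → Fin n, (∑ x, g x y) ^ 2 := by
    have := sq_sum_le_card_mul_sum_sq (s := (univ : Finset (Fin r → Fin n)))
      (f := fun y => ∑ x, g x y)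
    simpa using this
  have h3 : ∑ y : Fin r → Fin n, (∑ x, g x y) ^ 2 ≤
      (n : ℝ) ^ r * ∑ e : Fin n × Fin n, blockDensity (insert e T) (Fin.tail c) := by
    rw [mul_sum]
    have : ∀ y : Fin r → Fin n, (∑ x, g x y) ^ 2 = ∑ e : Fin n × Fin n, g e.1 y * g e.2 y := by
      intro y
      rw [sq, sum_mul_sum, Fintype.sum_prod_type]
    simp only [this]
    rw [sum_comm]
    refine sum_le_sum fun e _ => ?_
    rw [blockDensity, mul_div_cancel₀ _ (by positivity)]
    refine sum_le_sum fun y _ => ?_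
    simp only [hg]
    by_cases ha : Blocks T c (Fin.cons e.1 y)
    · by_cases hb : Blocks T c (Fin.cons e.2 y)
      · simp [ha, hb, ha.insert_pair hb]
      · simp only [hb, if_false, mul_zero]; split_ifs <;> norm_num
    · simp only [ha, if_false, zero_mul]; split_ifs <;> norm_num
  rw [blockDensity, h1, div_pow, ← pow_mul, div_mul_eq_mul_div, div_le_iff₀ (by positivity)]
  calc _ ≤ ((n : ℝ) ^ r * ((n : ℝ) ^ r *
        ∑ e : Fin n × Fin n, blockDensity (insert e T) (Fin.tail c))) * (n : ℝ) ^ 2 := by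
        refine mul_le_mul_of_nonneg_right (h2.trans ?_) (by positivity)
        exact mul_le_mul_of_nonneg_left h3 (by positivity)
    _ = _ := by ring

/-- The possible edges off `W` whose insertion leaves block density at least `t`. -/
noncomputable def richPairs (W : Finset (Fin n)) (T : Finset (Fin n × Fin n)) (c : Fin r → Fin q)
    (t : ℝ) : Finset (Fin n × Fin n) :=
  (pairsOff W).filter fun e => t ≤ blockDensity (insert e T) c

lemma card_richPairs (hn : 0 < n) (W : Finset (Fin n)) (T : Finset (Fin n × Fin n))
    (c : Fin (r + 1) → Fin q) {δ : ℝ} (hδ : 0 ≤ δ) (h : δ ≤ blockDensity T c) :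
    δ ^ 2 / 2 * (n : ℝ) ^ 2 ≤
      2 * (richPairs W T (Fin.tail c) (δ ^ 2 / 2)).card + (1 + 2 * W.card) * n := by
  set P := richPairs W T (Fin.tail c) (δ ^ 2 / 2) with hP
  set Q : Finset (Fin n × Fin n) := univ.filter
    fun e => δ ^ 2 / 2 ≤ blockDensity (insert e T) (Fin.tail c) with hQ
  have h1 : δ ^ 2 * (n : ℝ) ^ 2 ≤ Q.card + δ ^ 2 / 2 * (n : ℝ) ^ 2 := by
    calc δ ^ 2 * (n : ℝ) ^ 2 ≤ blockDensity T c ^ 2 * (n : ℝ) ^ 2 := by gcongr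
      _ ≤ _ := sum_blockDensity_insert hn T c
      _ ≤ ∑ e : Fin n × Fin n, ((if e ∈ Q then 1 else 0) + δ ^ 2 / 2) := by
        refine sum_le_sum fun e _ => ?_
        by_cases he : e ∈ Q
        · simp only [he, if_true]
          have := blockDensity_le_one (insert e T) (Fin.tail c)
          nlinarith [sq_nonneg δ]
        · have : ¬ δ ^ 2 / 2 ≤ blockDensity (insert e T) (Fin.tail c) := by
            simpa [hQ] using he
          simp only [he, if_false]; linarith
      _ = _ := by
        rw [sum_add_distrib]
        simp
        ring
  have h2 : Q ⊆ P ∪ P.image Prod.swap ∪ univ.image (fun x : Fin n => (x, x)) ∪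
      (W ×ˢ univ) ∪ (univ ×ˢ W) := by
    intro e he
    have he' : δ ^ 2 / 2 ≤ blockDensity (insert e T) (Fin.tail c) := by simpa [hQ] using he
    by_cases hw1 : e.1 ∈ W
    · simp [hw1]
    by_cases hw2 : e.2 ∈ W
    · simp [hw2]
    rcases lt_trichotomy e.1 e.2 with hlt | heq | hgt
    · have : e ∈ P := by simp [hP, richPairs, pairsOff, pairSet, hlt, hw1, hw2, he']
      simp [this]
    · have : e ∈ univ.image (fun x : Fin n => (x, x)) :=
        mem_image.mpr ⟨e.1, mem_univ _, Prod.ext rfl heq⟩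
      simp only [mem_union, this, true_or, or_true]
    · have : e.swap ∈ P := mem_filter.mpr ⟨mem_filter.mpr ⟨by simp [pairSet, hgt], hw2, hw1⟩,
        by rw [blockDensity_insert_swap]; exact he'⟩
      have : e ∈ P.image Prod.swap := mem_image.mpr ⟨e.swap, this, Prod.swap_swap e⟩
      simp only [mem_union, this, true_or, or_true]
  have h3 : Q.card ≤ P.card + P.card + n + W.card * n + n * W.card := by
    refine (card_le_card h2).trans ?_
    refine (card_union_le _ _).trans (add_le_add ?_ (by simp))
    refine (card_union_le _ _).trans (add_le_add ?_ (by simp))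
    refine (card_union_le _ _).trans (add_le_add ?_ (card_image_le.trans (by simp)))
    exact (card_union_le _ _).trans (add_le_add le_rfl card_image_le)
  have h4 : (Q.card : ℝ) ≤ P.card + P.card + n + W.card * n + n * W.card := by exact_mod_cast h3
  linarith

/-- Sprinkling a linear number of random edges destroys colorability with high probability as
soon as the block density is bounded below. -/
lemma sprinkle_blocks (q K : ℕ) {s : ℝ} (hs : 0 < s) (r : ℕ) :
    ∀ δ > 0, ∀ γ > 0, ∃ N : ℕ, ∀ n ≥ N, ∀ W : Finset (Fin n), W.card ≤ K →
      ∀ (T : Finset (Fin n × Fin n)) (c : Fin r → Fin q), δ ≤ blockDensity T c →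
      selectionExp (probOn (pairsOff W) (1 - (1 - s / n) ^ r))
        (fun T' => if PairColorable q (T ∪ T') then 1 else 0) ≤ γ := by
  induction r with
  | zero =>
    intro δ hδ γ hγ
    refine ⟨0, fun n _ W _ T c hc => ?_⟩
    have hT : ¬ PairColorable q T := by
      intro hcol
      have : ∀ y : Fin 0 → Fin n, ¬ Blocks T c y := by
        intro y hb
        obtain ⟨σ, hσ⟩ := hcol
        exact hb ⟨σ, hσ, fun s => s.elim0⟩
      simp [blockDensity, this] at hc
      linarith
    refine selectionExp_le_const (isProbVec_probOn _ (by simp) (by simp)) fun T' => ?_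
    rw [if_neg fun h => hT (h.mono subset_union_left)]
    exact hγ.le
  | succ r ih =>
    intro δ hδ γ hγ
    obtain ⟨N₁, hN₁⟩ := ih (δ ^ 2 / 2) (by positivity) (γ / 2) (by positivity)
    have hlim : Tendsto (fun n : ℕ => Real.exp (-((s * δ ^ 2 / 8) * n))) atTop (nhds 0) := by
      refine Real.tendsto_exp_neg_atTop_nhds_zero.comp ?_
      exact tendsto_natCast_atTop_atTop.const_mul_atTop (by positivity)
    obtain ⟨N₂, hN₂⟩ := (hlim.eventually (gt_mem_nhds (half_pos hγ))).exists_forall_of_atTop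
    obtain ⟨N₃, hN₃⟩ := exists_nat_ge ((1 + 2 * K) / (δ ^ 2 / 4))
    obtain ⟨N₄, hN₄⟩ := exists_nat_ge s
    refine ⟨max (max N₁ N₂) (max (max N₃ N₄) 1), fun n hn W hW T c hc => ?_⟩
    simp only [ge_iff_le, max_le_iff] at hn
    obtain ⟨⟨hn1, hn2⟩, ⟨hn3, hn4⟩, hn5⟩ := hn
    have hn0 : (0 : ℝ) < n := by exact_mod_cast hn5
    have hsn0 : 0 ≤ s / n := by positivity
    have hsn1 : s / n ≤ 1 := by
      rw [div_le_one hn0]; exact hN₄.trans (by exact_mod_cast hn4)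
    have hr0 : 0 ≤ 1 - (1 - s / n) ^ r := by
      have := pow_le_one₀ (n := r) (show 0 ≤ 1 - s / n by linarith) (by linarith)
      linarith
    have hr1 : 1 - (1 - s / n) ^ r ≤ 1 := by
      have := pow_nonneg (show 0 ≤ 1 - s / n by linarith) r
      linarith
    have hpv := isProbVec_probOn (pairsOff W) hsn0 hsn1
    have hpv' := isProbVec_probOn (pairsOff W) hr0 hr1
    rw [show 1 - (1 - s / n) ^ (r + 1) = s / n + (1 - (1 - s / n) ^ r) -
      s / n * (1 - (1 - s / n) ^ r) by ring, ← probUnion_probOn_same, ← selectionExp_union]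
    set P := richPairs W T (Fin.tail c) (δ ^ 2 / 2) with hP
    have hPcard : δ ^ 2 / 8 * (n : ℝ) ^ 2 ≤ P.card := by
      have h1 := card_richPairs hn5 W T c hδ.le hc
      have h2 : (1 + 2 * (W.card : ℝ)) * n ≤ δ ^ 2 / 4 * (n : ℝ) ^ 2 := by
        have h3 : (1 + 2 * (W.card : ℝ)) ≤ δ ^ 2 / 4 * n := by
          have h4 : (1 + 2 * (K : ℝ)) ≤ δ ^ 2 / 4 * n := by
            have := hN₃.trans (show (N₃ : ℝ) ≤ n by exact_mod_cast hn3)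
            rw [div_le_iff₀ (by positivity)] at this
            linarith
          have h5 : (W.card : ℝ) ≤ K := by exact_mod_cast hW
          linarith
        nlinarith
      linarith
    have hmiss : selectionExp (probOn (pairsOff W) (s / n))
        (fun T₁ => if Disjoint T₁ P then 1 else 0) ≤ γ / 2 := by
      refine (selectionExp_disjoint_le hpv).trans ?_
      refine le_trans (Real.exp_le_exp.mpr ?_) (hN₂ n hn2).le
      rw [neg_le_neg_iff]
      have : ∑ e ∈ P, probOn (pairsOff W) (s / n) e = P.card * (s / n) := by
        rw [← nsmul_eq_mul, ← sum_const]
        refine sum_congr rfl fun e he => ?_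
        have : e ∈ pairsOff W := (mem_filter.mp he).1
        simp [probOn, this]
      rw [this]
      calc s * δ ^ 2 / 8 * n = δ ^ 2 / 8 * (n : ℝ) ^ 2 * (s / n) := by field_simp
        _ ≤ _ := by gcongr
    have hbound : ∀ T₁ : Finset (Fin n × Fin n),
        selectionExp (probOn (pairsOff W) (1 - (1 - s / n) ^ r))
          (fun T' => if PairColorable q (T ∪ (T₁ ∪ T')) then 1 else 0) ≤
        (if Disjoint T₁ P then 1 else 0) + γ / 2 := by
      intro T₁
      by_cases hd : Disjoint T₁ P
      · rw [if_pos hd]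
        refine (selectionExp_le_one hpv' fun T' => by split_ifs <;> norm_num).trans ?_
        linarith
      · rw [if_neg hd, zero_add]
        obtain ⟨e, he, heP⟩ := not_disjoint_iff.mp hd
        have hde : δ ^ 2 / 2 ≤ blockDensity (T ∪ T₁) (Fin.tail c) := by
          refine (mem_filter.mp heP).2.trans (blockDensity_mono ?_ _)
          exact insert_subset (mem_union_right _ he) subset_union_left
        have := hN₁ n hn1 W hW (T ∪ T₁) (Fin.tail c) hde
        simpa only [union_assoc] using this
    calc _ ≤ selectionExp (probOn (pairsOff W) (s / n))
          (fun T₁ => (if Disjoint T₁ P then 1 else 0) + γ / 2) := selectionExp_mono hpv hbound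
      _ = selectionExp (probOn (pairsOff W) (s / n))
          (fun T₁ => if Disjoint T₁ P then 1 else 0) + γ / 2 := by
          rw [selectionExp_add, selectionExp_const]
      _ ≤ γ := by linarith

end Sprinkling

/-- The indicator of `q`-colorability. -/
noncomputable def colInd {n : ℕ} (q : ℕ) (T : Finset (Fin n × Fin n)) : ℝ :=
  if PairColorable q T then 1 else 0

/-- The probability that the random graph with edge probability `p` is `q`-colorable after
deletion of the vertices in `W`. -/
noncomputable def offCol {n : ℕ} (q : ℕ) (W : Finset (Fin n)) (p : ℝ) : ℝ :=
  selectionExp (probOn (pairsOff W) p) (colInd q)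

/-- The effect of planting `S` on the probability of `q`-colorability. -/
noncomputable def plantEffect {n : ℕ} (q : ℕ) (S : Finset (Fin n × Fin n)) (p : ℝ) : ℝ :=
  selectionExp (probOn (pairSet n \ S) p) (fun T => colInd q T - colInd q (T ∪ S))

section Insensitivity

lemma colInd_nonneg {n q : ℕ} (T : Finset (Fin n × Fin n)) : 0 ≤ colInd q T := by
  unfold colInd; split_ifs <;> norm_num

lemma colInd_le_one {n q : ℕ} (T : Finset (Fin n × Fin n)) : colInd q T ≤ 1 := by
  unfold colInd; split_ifs <;> norm_num

lemma colInd_anti {n q : ℕ} {T T' : Finset (Fin n × Fin n)} (h : T ⊆ T') :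
    colInd q T' ≤ colInd q T := by
  unfold colInd
  by_cases h' : PairColorable q T'
  · simp [h', h'.mono h]
  · simp only [h', if_false]; split_ifs <;> norm_num

lemma selectionExp_subset {ε : Type*} [Fintype ε] [DecidableEq ε] (p : ε → ℝ) (R : Finset ε) :
    selectionExp p (fun T => if R ⊆ T then 1 else 0) = ∏ e ∈ R, p e := by
  have h : (fun T : Finset ε => if R ⊆ T then (1 : ℝ) else 0) =
      fun T => ∏ e, if e ∈ T then 1 else (if e ∈ R then 0 else 1) := by
    funext T
    by_cases hd : R ⊆ T
    · rw [if_pos hd]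
      refine (prod_eq_one fun e _ => ?_).symm
      by_cases he : e ∈ T
      · simp [he]
      · simp only [he, if_false]; rw [if_neg fun h => he (hd h)]
    · rw [if_neg hd]
      obtain ⟨e, he, he'⟩ := not_subset.mp hd
      exact (prod_eq_zero (mem_univ e) (by simp [he, he'])).symm
  rw [h, selectionExp_prod, ← prod_subset (subset_univ R)]
  · exact prod_congr rfl fun e he => by simp [he]
  · intro e _ he; simp [he]

lemma selectionExp_antitone_prob {n q : ℕ} (U : Finset (Fin n × Fin n)) {p p' : ℝ} (h0 : 0 ≤ p)
    (h : p ≤ p') (h1 : p' ≤ 1) :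
    selectionExp (probOn U p') (colInd q) ≤ selectionExp (probOn U p) (colInd q) := by
  have h2 := selectionExp_mono_prob U h0 h h1 (F := fun T => 1 - colInd q T)
    fun T T' hT => sub_le_sub_left (colInd_anti hT) _
  simp only [selectionExp_sub, selectionExp_const] at h2
  linarith

/-- The edge joining two vertices, as an ordered pair. -/
def sortPair {n : ℕ} (u v : Fin n) : Fin n × Fin n := if u < v then (u, v) else (v, u)

/-- The possible edges with exactly one endpoint in `W`. -/
def pairsAtt {n : ℕ} (W : Finset (Fin n)) : Finset (Fin n × Fin n) :=
  (pairSet n).filter fun e => (e.1 ∈ W ∧ e.2 ∉ W) ∨ (e.1 ∉ W ∧ e.2 ∈ W)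

/-- The possible edges with both endpoints in `W`. -/
def pairsIn {n : ℕ} (W : Finset (Fin n)) : Finset (Fin n × Fin n) :=
  (pairSet n).filter fun e => e.1 ∈ W ∧ e.2 ∈ W

lemma card_pairsAtt_le {n : ℕ} (W : Finset (Fin n)) : (pairsAtt W).card ≤ W.card * n := by
  have : pairsAtt W ⊆ (W ×ˢ univ).image fun z => sortPair z.1 z.2 := by
    intro e he
    obtain ⟨hlt, h⟩ := mem_filter.mp he
    have hlt : e.1 < e.2 := by simpa [pairSet] using hlt
    rcases h with h | h
    · exact mem_image.mpr ⟨(e.1, e.2), by simp [h.1], by simp [sortPair, hlt]⟩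
    · exact mem_image.mpr ⟨(e.2, e.1), by simp [h.2], by simp [sortPair, hlt.le.not_gt]⟩
  refine (card_le_card this).trans (card_image_le.trans ?_)
  simp

lemma card_pairsIn_le {n : ℕ} (W : Finset (Fin n)) : (pairsIn W).card ≤ W.card ^ 2 := by
  have : pairsIn W ⊆ W ×ˢ W := by
    intro e he
    exact mem_product.mpr (mem_filter.mp he).2
  exact (card_le_card this).trans (by rw [card_product, sq])

lemma blocks_of_not_colorable {n q r : ℕ} {W : Finset (Fin n)}
    {Toff Tatt S : Finset (Fin n × Fin n)}
    (hoff : Toff ⊆ pairsOff W) (hS : ∀ e ∈ S, e.1 ∈ W ∧ e.2 ∈ W) {c : Fin n → Fin q}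
    (hc : IsProper c S) {w y : Fin r → Fin n} (hw : ∀ i, w i ∈ W) (hy : ∀ i, y i ∉ W)
    (hatt : ∀ e ∈ Tatt, ∃ i, e = sortPair (w i) (y i))
    (h : ¬ PairColorable q (Toff ∪ Tatt ∪ S)) : Blocks Toff (c ∘ w) y := by
  rintro ⟨σ, h1, h2⟩
  refine h ⟨fun v => if v ∈ W then c v else σ v, fun e he => ?_⟩
  rcases mem_union.mp he with he | he
  · rcases mem_union.mp he with he | he
    · have := (mem_filter.mp (hoff he)).2
      simp only [this.1, this.2, if_false]
      exact h1 e he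
    · obtain ⟨i, rfl⟩ := hatt e he
      unfold sortPair
      split_ifs
      · simpa [hw i, hy i] using (h2 i).symm
      · simpa [hw i, hy i] using h2 i
  · have := hS e he
    simp only [this.1, this.2, if_true]
    exact hc e he

/-- Weighted count of the ways in which `r` attaching edges block. -/
noncomputable def attachCount {n q : ℕ} (W : Finset (Fin n)) (c : Fin n → Fin q) (r : ℕ)
    (Toff Tatt : Finset (Fin n × Fin n)) : ℝ :=
  ∑ w ∈ Fintype.piFinset (fun _ : Fin r => W), ∑ y : Fin r → Fin n,
    (if Blocks Toff (c ∘ w) y then 1 else 0) *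
      (if Function.Injective (fun i => sortPair (w i) (y i)) ∧
        univ.image (fun i => sortPair (w i) (y i)) ⊆ Tatt then 1 else 0)

lemma attachCount_nonneg {n q : ℕ} (W : Finset (Fin n)) (c : Fin n → Fin q) (r : ℕ)
    (Toff Tatt : Finset (Fin n × Fin n)) : 0 ≤ attachCount W c r Toff Tatt :=
  sum_nonneg fun w _ => sum_nonneg fun y _ => by split_ifs <;> norm_num

lemma one_le_attachCount {n q : ℕ} {W : Finset (Fin n)} {Toff Tatt S : Finset (Fin n × Fin n)}
    (hoff : Toff ⊆ pairsOff W) (hatt : Tatt ⊆ pairsAtt W) (hS : ∀ e ∈ S, e.1 ∈ W ∧ e.2 ∈ W)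
    {c : Fin n → Fin q} (hc : IsProper c S) (h : ¬ PairColorable q (Toff ∪ Tatt ∪ S)) :
    1 ≤ attachCount W c Tatt.card Toff Tatt := by
  let f : Fin Tatt.card → Fin n × Fin n := fun i => (Tatt.equivFin.symm i).1
  have hf : ∀ i, f i ∈ Tatt := fun i => (Tatt.equivFin.symm i).2
  have hfi : Function.Injective f :=
    Subtype.val_injective.comp Tatt.equivFin.symm.injective
  have hfs : ∀ e ∈ Tatt, ∃ i, e = f i := fun e he => ⟨Tatt.equivFin ⟨e, he⟩, by simp [f]⟩
  let w : Fin Tatt.card → Fin n := fun i => if (f i).1 ∈ W then (f i).1 else (f i).2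
  let y : Fin Tatt.card → Fin n := fun i => if (f i).1 ∈ W then (f i).2 else (f i).1
  have hprop : ∀ i, w i ∈ W ∧ y i ∉ W ∧ sortPair (w i) (y i) = f i := by
    intro i
    obtain ⟨hlt, h'⟩ := mem_filter.mp (hatt (hf i))
    have hlt : (f i).1 < (f i).2 := by simpa [pairSet] using hlt
    rcases h' with h' | h'
    · simp [w, y, h'.1, h'.2, sortPair, hlt]
    · simp [w, y, h'.1, h'.2, sortPair, hlt.le.not_gt]
  have hwy : (fun i => sortPair (w i) (y i)) = f := funext fun i => (hprop i).2.2
  have hb : Blocks Toff (c ∘ w) y :=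
    blocks_of_not_colorable hoff hS hc (fun i => (hprop i).1) (fun i => (hprop i).2.1)
      (fun e he => by
        obtain ⟨i, hi⟩ := hfs e he
        exact ⟨i, by rw [(hprop i).2.2, hi]⟩) h
  have hinner : ∀ w' : Fin Tatt.card → Fin n, ∀ y' : Fin Tatt.card → Fin n,
      (0 : ℝ) ≤ (if Blocks Toff (c ∘ w') y' then 1 else 0) *
      (if Function.Injective (fun i => sortPair (w' i) (y' i)) ∧
        univ.image (fun i => sortPair (w' i) (y' i)) ⊆ Tatt then 1 else 0) := fun w' y' => by
    split_ifs <;> norm_num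
  have himg : univ.image f ⊆ Tatt := image_subset_iff.mpr fun i _ => hf i
  refine le_trans ?_ (single_le_sum (fun w' _ => sum_nonneg fun y' _ => hinner w' y')
    (Fintype.mem_piFinset.mpr fun i => (hprop i).1))
  refine le_trans ?_ (single_le_sum (fun y' _ => hinner w y') (mem_univ y))
  rw [hwy, if_pos hb, if_pos ⟨hfi, himg⟩, mul_one]

lemma selectionExp_attachCount_le {n q : ℕ} (hn : 0 < n) (W : Finset (Fin n)) (c : Fin n → Fin q)
    (r : ℕ) (Toff : Finset (Fin n × Fin n)) {p : ℝ} (h0 : 0 ≤ p) :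
    selectionExp (probOn (pairsAtt W) p) (attachCount W c r Toff) ≤
      (n * p) ^ r * ∑ w ∈ Fintype.piFinset (fun _ : Fin r => W), blockDensity Toff (c ∘ w) := by
  have hn' : (0 : ℝ) < n := by exact_mod_cast hn
  unfold attachCount
  simp only [selectionExp_sum, selectionExp_const_mul]
  rw [mul_sum]
  refine sum_le_sum fun w _ => ?_
  rw [blockDensity, mul_pow, mul_comm ((n : ℝ) ^ r), mul_assoc, mul_div_cancel₀ _ (by positivity),
    mul_sum]
  refine sum_le_sum fun y _ => ?_
  rw [mul_comm]
  refine mul_le_mul_of_nonneg_right ?_ (by split_ifs <;> norm_num)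
  by_cases hi : Function.Injective fun i => sortPair (w i) (y i)
  · simp only [hi, true_and]
    rw [selectionExp_subset, prod_image fun i _ j _ hij => hi hij]
    calc _ ≤ ∏ _i : Fin r, p := prod_le_prod
          (fun i _ => by unfold probOn; split_ifs <;> simp [h0])
          (fun i _ => by unfold probOn; split_ifs <;> simp [h0])
      _ = p ^ r := by simp
  · simp only [hi, false_and, if_false, selectionExp_const]
    positivity

lemma selectionExp_colInd_blockDensity_le {n q r : ℕ} (W : Finset (Fin n)) (c : Fin r → Fin q)
    {p p₁ p' δ γ : ℝ} (h0 : 0 ≤ p) (h10 : 0 ≤ p₁) (h11 : p₁ ≤ 1) (hp : p ≤ 1)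
    (hp' : p + p₁ ≤ p') (h1 : p' ≤ 1) (hγ : 0 ≤ γ)
    (h : ∀ T, δ ≤ blockDensity T c → selectionExp (probOn (pairsOff W) p₁)
        (fun T' => if PairColorable q (T ∪ T') then 1 else 0) ≤ γ) :
    selectionExp (probOn (pairsOff W) p)
      (fun T => if PairColorable q T ∧ δ ≤ blockDensity T c then 1 else 0) ≤
      γ + (offCol q W p - offCol q W p') := by
  have hv := isProbVec_probOn (pairsOff W) h0 hp
  have hv1 := isProbVec_probOn (pairsOff W) h10 h11
  have hle : offCol q W p' ≤ offCol q W (p + p₁ - p * p₁) := by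
    refine selectionExp_antitone_prob _ ?_ ?_ h1
    · nlinarith
    · nlinarith
  have hU : offCol q W (p + p₁ - p * p₁) = selectionExp (probOn (pairsOff W) p) fun T =>
      selectionExp (probOn (pairsOff W) p₁) fun T' => colInd q (T ∪ T') := by
    rw [offCol, ← probUnion_probOn_same, selectionExp_union]
  have key : selectionExp (probOn (pairsOff W) p)
      (fun T => if PairColorable q T ∧ δ ≤ blockDensity T c then 1 else 0) ≤
      selectionExp (probOn (pairsOff W) p) (fun T => γ + (colInd q T -
        selectionExp (probOn (pairsOff W) p₁) fun T' => colInd q (T ∪ T'))) := by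
    refine selectionExp_mono hv fun T => ?_
    have hmono : selectionExp (probOn (pairsOff W) p₁) (fun T' => colInd q (T ∪ T')) ≤
        colInd q T := selectionExp_le_const hv1 fun T' => colInd_anti subset_union_left
    by_cases hT : PairColorable q T ∧ δ ≤ blockDensity T c
    · rw [if_pos hT]
      have h2 := h T hT.2
      have h3 : colInd q T = 1 := by simp [colInd, hT.1]
      have h4 : selectionExp (probOn (pairsOff W) p₁) (fun T' => colInd q (T ∪ T')) ≤ γ := h2
      linarith
    · rw [if_neg hT]; linarith
  refine key.trans ?_
  rw [selectionExp_add, selectionExp_const, selectionExp_sub, ← hU]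
  unfold offCol at *
  linarith

end Insensitivity

section Planting

lemma pairSet_sdiff_eq {n : ℕ} {S : Finset (Fin n × Fin n)} {W : Finset (Fin n)}
    (hS : ∀ e ∈ S, e.1 ∈ W ∧ e.2 ∈ W) :
    pairSet n \ S = pairsOff W ∪ (pairsAtt W ∪ (pairsIn W \ S)) := by
  ext e
  have := hS e
  simp only [pairsOff, pairsAtt, pairsIn, Finset.mem_sdiff, mem_union, mem_filter]
  tauto

lemma plantEffect_pointwise {n q : ℕ} (D : ℕ) {W : Finset (Fin n)}
    {Toff Tatt Tin S : Finset (Fin n × Fin n)} (hoff : Toff ⊆ pairsOff W)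
    (hatt : Tatt ⊆ pairsAtt W) (hS : ∀ e ∈ S, e.1 ∈ W ∧ e.2 ∈ W)
    {c : Fin n → Fin q} (hc : IsProper c S) :
    colInd q (Toff ∪ (Tatt ∪ Tin)) - colInd q (Toff ∪ (Tatt ∪ Tin) ∪ S) ≤
      (1 - if Disjoint Tin (pairsIn W \ S) then 1 else 0) +
      (if Tin ⊆ pairsIn W \ S then 0 else 1) + 2 ^ Tatt.card / 2 ^ (D + 1) +
      ∑ r ∈ range (D + 1), colInd q Toff * attachCount W c r Toff Tatt := by
  have hsum : 0 ≤ ∑ r ∈ range (D + 1), colInd q Toff * attachCount W c r Toff Tatt :=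
    sum_nonneg fun r _ => mul_nonneg (colInd_nonneg _) (attachCount_nonneg _ _ _ _ _)
  have hpow : (0 : ℝ) ≤ 2 ^ Tatt.card / 2 ^ (D + 1) := by positivity
  have hsub : (0 : ℝ) ≤ if Tin ⊆ pairsIn W \ S then 0 else 1 := by split_ifs <;> norm_num
  have hdis : (0 : ℝ) ≤ 1 - if Disjoint Tin (pairsIn W \ S) then 1 else 0 := by
    split_ifs <;> norm_num
  have h1 := colInd_le_one (q := q) (Toff ∪ (Tatt ∪ Tin))
  have h2 := colInd_nonneg (q := q) (Toff ∪ (Tatt ∪ Tin) ∪ S)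
  by_cases hT : Tin ⊆ pairsIn W \ S
  swap
  · simp only [hT, if_false] at hsub ⊢; linarith
  by_cases hd : Disjoint Tin (pairsIn W \ S)
  swap
  · simp only [hd, if_false] at hdis ⊢; linarith
  have hTin : Tin = ∅ := by
    have := disjoint_left.mp hd
    exact eq_empty_of_forall_notMem fun e he => this he (hT he)
  by_cases hcol : PairColorable q (Toff ∪ (Tatt ∪ Tin))
  swap
  · have : colInd q (Toff ∪ (Tatt ∪ Tin)) = 0 := by simp [colInd, hcol]
    linarith
  by_cases hcol' : PairColorable q (Toff ∪ (Tatt ∪ Tin) ∪ S)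
  · have : colInd q (Toff ∪ (Tatt ∪ Tin) ∪ S) = 1 := if_pos hcol'
    linarith
  by_cases hD : Tatt.card < D + 1
  · have h3 : colInd q Toff = 1 := by simp [colInd, hcol.mono subset_union_left]
    have h4 := one_le_attachCount hoff hatt hS hc (by simpa [hTin] using hcol')
    have h5 : colInd q Toff * attachCount W c Tatt.card Toff Tatt ≤
        ∑ r ∈ range (D + 1), colInd q Toff * attachCount W c r Toff Tatt :=
      single_le_sum (f := fun r => colInd q Toff * attachCount W c r Toff Tatt)
        (fun r _ => mul_nonneg (colInd_nonneg _) (attachCount_nonneg _ _ _ _ _))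
        (mem_range.mpr hD)
    rw [h3, one_mul, ← h3] at h5
    linarith
  · have : (1 : ℝ) ≤ 2 ^ Tatt.card / 2 ^ (D + 1) := by
      rw [one_le_div (by positivity)]
      exact pow_le_pow_right₀ (by norm_num) (by omega)
    linarith

lemma plantEffect_le {n q : ℕ} (hn : 0 < n) (D : ℕ) {W : Finset (Fin n)}
    {S : Finset (Fin n × Fin n)} (hS : ∀ e ∈ S, e.1 ∈ W ∧ e.2 ∈ W) {c : Fin n → Fin q}
    (hc : IsProper c S) {p δ B : ℝ} (h0 : 0 ≤ p) (h1 : p ≤ 1) (hδ : 0 ≤ δ)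
    (hB : ∀ r ≤ D, ∀ c' : Fin r → Fin q, selectionExp (probOn (pairsOff W) p)
      (fun T => if PairColorable q T ∧ δ ≤ blockDensity T c' then 1 else 0) ≤ B) :
    plantEffect q S p ≤ (W.card : ℝ) ^ 2 * p + (1 + p) ^ (W.card * n) / 2 ^ (D + 1) +
      ∑ r ∈ range (D + 1), (W.card * (n * p)) ^ r * (δ + B) := by
  have hvo := isProbVec_probOn (pairsOff W) h0 h1
  have hva := isProbVec_probOn (pairsAtt W) h0 h1
  have hvi := isProbVec_probOn (pairsIn W \ S) h0 h1
  have hdis1 : Disjoint (pairsAtt W) (pairsIn W \ S) := by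
    refine disjoint_left.mpr fun e h1 h2 => ?_
    have h3 := (mem_filter.mp h1).2
    have h4 := (mem_filter.mp (mem_sdiff.mp h2).1).2
    tauto
  have hdis2 : Disjoint (pairsOff W) (pairsAtt W ∪ (pairsIn W \ S)) := by
    refine disjoint_left.mpr fun e h1 h2 => ?_
    have h3 := (mem_filter.mp h1).2
    rcases mem_union.mp h2 with h2 | h2
    · have h4 := (mem_filter.mp h2).2
      tauto
    · have h4 := (mem_filter.mp (mem_sdiff.mp h2).1).2
      tauto
  unfold plantEffect
  rw [pairSet_sdiff_eq hS, ← probUnion_probOn_disjoint hdis2, ← selectionExp_union,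
    ← probUnion_probOn_disjoint hdis1]
  simp only [← selectionExp_union (probOn (pairsAtt W) p)]
  have hin : selectionExp (probOn (pairsIn W \ S) p)
      (fun Tin => (1 - if Disjoint Tin (pairsIn W \ S) then 1 else 0) +
        (if Tin ⊆ pairsIn W \ S then 0 else 1)) ≤ (W.card : ℝ) ^ 2 * p := by
    have e1 : selectionExp (probOn (pairsIn W \ S) p)
        (fun Tin => if Tin ⊆ pairsIn W \ S then (0 : ℝ) else 1) = 0 := by
      rw [selectionExp_congr_support fun T hT => if_pos (mem_of_probOn_ne_zero hT),
        selectionExp_const]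
    rw [selectionExp_add, selectionExp_sub, selectionExp_const, e1, add_zero]
    have e2 := one_sub_sum_le_selectionExp_disjoint (P := pairsIn W \ S) hvi
    have e3 : ∑ e ∈ pairsIn W \ S, probOn (pairsIn W \ S) p e ≤ (W.card : ℝ) ^ 2 * p := by
      rw [sum_congr rfl fun e he => show probOn (pairsIn W \ S) p e = p by
        unfold probOn; rw [if_pos he]]
      rw [sum_const, nsmul_eq_mul]
      refine mul_le_mul_of_nonneg_right ?_ h0
      exact_mod_cast (card_le_card sdiff_subset).trans (card_pairsIn_le W)
    linarith
  have hattc : ∀ Toff, selectionExp (probOn (pairsAtt W) p)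
      (fun Tatt => ((2 : ℝ) ^ Tatt.card / 2 ^ (D + 1)) +
        ∑ r ∈ range (D + 1), colInd q Toff * attachCount W c r Toff Tatt) ≤
      (1 + p) ^ (W.card * n) / 2 ^ (D + 1) + ∑ r ∈ range (D + 1), colInd q Toff *
        ((n * p) ^ r * ∑ w ∈ Fintype.piFinset (fun _ : Fin r => W),
          blockDensity Toff (c ∘ w)) := by
    intro Toff
    rw [selectionExp_add, selectionExp_sum]
    refine add_le_add ?_ (sum_le_sum fun r _ => ?_)
    · simp only [div_eq_inv_mul]
      rw [selectionExp_const_mul, selectionExp_pow_card]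
      refine mul_le_mul_of_nonneg_left ?_ (by positivity)
      rw [show 1 - p + p * 2 = 1 + p by ring]
      exact pow_le_pow_right₀ (by linarith) (card_pairsAtt_le W)
    · rw [selectionExp_const_mul]
      exact mul_le_mul_of_nonneg_left (selectionExp_attachCount_le hn W c r Toff h0)
        (colInd_nonneg _)
  have hoffc : ∀ r ∈ range (D + 1), selectionExp (probOn (pairsOff W) p)
      (fun Toff => colInd q Toff * ((n * p) ^ r * ∑ w ∈ Fintype.piFinset (fun _ : Fin r => W),
          blockDensity Toff (c ∘ w))) ≤ (W.card * (n * p)) ^ r * (δ + B) := by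
    intro r hr
    have e1 : ∀ Toff : Finset (Fin n × Fin n), colInd q Toff * ((n * p) ^ r *
        ∑ w ∈ Fintype.piFinset (fun _ : Fin r => W), blockDensity Toff (c ∘ w)) =
        (n * p) ^ r * ∑ w ∈ Fintype.piFinset (fun _ : Fin r => W),
          colInd q Toff * blockDensity Toff (c ∘ w) := fun Toff => by
      rw [mul_left_comm, mul_sum]
    simp only [e1, selectionExp_const_mul, selectionExp_sum]
    have e2 : ∀ w ∈ Fintype.piFinset (fun _ : Fin r => W), selectionExp (probOn (pairsOff W) p)
        (fun Toff => colInd q Toff * blockDensity Toff (c ∘ w)) ≤ δ + B := by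
      intro w _
      refine le_trans ?_ (add_le_add_right (hB r (by simpa [Nat.lt_succ_iff] using hr) (c ∘ w)) δ)
      rw [show δ + selectionExp (probOn (pairsOff W) p) (fun T => if PairColorable q T ∧
          δ ≤ blockDensity T (c ∘ w) then (1 : ℝ) else 0) = selectionExp (probOn (pairsOff W) p)
          (fun T => δ + if PairColorable q T ∧ δ ≤ blockDensity T (c ∘ w) then (1 : ℝ) else 0) by
        rw [selectionExp_add, selectionExp_const]]
      refine selectionExp_mono hvo fun T => ?_
      have hb1 := blockDensity_le_one T (c ∘ w)
      by_cases hT : PairColorable q T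
      · simp only [colInd, hT, if_true, true_and, one_mul]
        split_ifs with h
        · linarith
        · linarith
      · simp [colInd, hT, hδ]
    rw [mul_pow (W.card : ℝ), mul_comm ((W.card : ℝ) ^ r), mul_assoc]
    refine mul_le_mul_of_nonneg_left ?_ (by positivity)
    refine (sum_le_card_nsmul _ _ _ e2).trans (le_of_eq ?_)
    rw [nsmul_eq_mul, Fintype.card_piFinset]
    simp
  calc _ ≤ selectionExp (probOn (pairsOff W) p) (fun Toff =>
        selectionExp (probOn (pairsAtt W) p) (fun Tatt =>
          (W.card : ℝ) ^ 2 * p + (2 ^ Tatt.card / 2 ^ (D + 1) +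
            ∑ r ∈ range (D + 1), colInd q Toff * attachCount W c r Toff Tatt))) := by
        refine selectionExp_mono_support hvo fun Toff hoff => ?_
        refine selectionExp_mono_support hva fun Tatt hatt => ?_
        have hoff' := mem_of_probOn_ne_zero hoff
        have hatt' := mem_of_probOn_ne_zero hatt
        refine (selectionExp_mono hvi fun Tin =>
          (plantEffect_pointwise D (Tin := Tin) hoff' hatt' hS hc).trans_eq
            (add_assoc _ _ _)).trans ?_
        rw [selectionExp_add, selectionExp_const]
        exact add_le_add_left hin _
    _ ≤ selectionExp (probOn (pairsOff W) p) (fun Toff => ((W.card : ℝ) ^ 2 * p +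
          (1 + p) ^ (W.card * n) / 2 ^ (D + 1)) + ∑ r ∈ range (D + 1), colInd q Toff *
        ((n * p) ^ r * ∑ w ∈ Fintype.piFinset (fun _ : Fin r => W),
          blockDensity Toff (c ∘ w))) := by
        refine selectionExp_mono hvo fun Toff => ?_
        rw [selectionExp_add, selectionExp_const, add_assoc]
        exact add_le_add_right (hattc Toff) _
    _ ≤ _ := by
        rw [selectionExp_add, selectionExp_const, selectionExp_sum]
        exact add_le_add_right (sum_le_sum hoffc) _

/-- Planting a bounded colorable edge set is negligible at edge probabilities where removing
boundedly many vertices leaves a colorability probability that does not drop suddenly. -/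
lemma plantEffect_le_of_large (q K : ℕ) {M θ : ℝ} (hM : 1 ≤ M) (hθ : 0 < θ) :
    ∃ C > 0, ∀ η > 0, ∃ N : ℕ, ∀ n ≥ N, ∀ a a' : ℝ, 0 ≤ a → a + η ≤ a' → a' ≤ M →
      ∀ W : Finset (Fin n), W.card ≤ K → ∀ S : Finset (Fin n × Fin n),
      (∀ e ∈ S, e.1 ∈ W ∧ e.2 ∈ W) → PairColorable q S →
      plantEffect q S (a / n) ≤ θ + C * (offCol q W (a / n) - offCol q W (a' / n)) := by
  obtain ⟨D, hD⟩ : ∃ D : ℕ, Real.exp (K * M) / 2 ^ (D + 1) ≤ θ / 3 := by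
    obtain ⟨D, hD⟩ := pow_unbounded_of_one_lt (Real.exp (K * M) / (θ / 3)) (one_lt_two (α := ℝ))
    refine ⟨D, ?_⟩
    rw [div_le_iff₀ (by positivity)]
    rw [div_lt_iff₀ (by positivity)] at hD
    have : (2 : ℝ) ^ D ≤ 2 ^ (D + 1) := pow_le_pow_right₀ (by norm_num) (by omega)
    nlinarith
  set C : ℝ := ∑ r ∈ range (D + 1), (K * M) ^ r with hC
  have hC0 : 0 < C := by
    have : (K * M : ℝ) ^ 0 ≤ C := single_le_sum (f := fun r => (K * M : ℝ) ^ r)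
      (fun r _ => by positivity) (mem_range.mpr (Nat.succ_pos D))
    simp only [pow_zero] at this
    linarith
  refine ⟨C, hC0, fun η hη => ?_⟩
  set δ : ℝ := θ / (6 * C) with hδ
  have hδ0 : 0 < δ := by positivity
  have hs : 0 < η / (D + 1) := by positivity
  choose N₁ hN₁ using fun r : ℕ => sprinkle_blocks q K hs r δ hδ0 δ hδ0
  obtain ⟨N₂, hN₂⟩ := exists_nat_ge (K ^ 2 * M / (θ / 3))
  obtain ⟨N₃, hN₃⟩ := exists_nat_ge (M + η)
  refine ⟨max (max ((range (D + 1)).sup N₁) N₂) (max N₃ 1),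
    fun n hn a a' ha haa ha' W hW S hS hcol => ?_⟩
  simp only [ge_iff_le, max_le_iff] at hn
  obtain ⟨⟨hn1, hn2⟩, hn3, hn4⟩ := hn
  obtain ⟨c, hc⟩ := hcol
  have hn0 : (0 : ℝ) < n := by exact_mod_cast hn4
  have hMn : M + η ≤ n := hN₃.trans (by exact_mod_cast hn3)
  have hp0 : 0 ≤ a / n := by positivity
  have hp1 : a / n ≤ 1 := by rw [div_le_one hn0]; linarith
  have hp1' : a' / n ≤ 1 := by rw [div_le_one hn0]; linarith
  have hWK : (W.card : ℝ) ≤ K := by exact_mod_cast hW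
  set Δ := offCol q W (a / n) - offCol q W (a' / n) with hΔ
  have hΔ0 : 0 ≤ Δ := by
    have := selectionExp_antitone_prob (q := q) (pairsOff W) hp0
      (show a / n ≤ a' / n by gcongr; linarith) hp1'
    simp only [hΔ, offCol]
    linarith
  have hB : ∀ r ≤ D, ∀ c' : Fin r → Fin q, selectionExp (probOn (pairsOff W) (a / n))
      (fun T => if PairColorable q T ∧ δ ≤ blockDensity T c' then 1 else 0) ≤ δ + Δ := by
    intro r hr c'
    have hs0 : 0 ≤ η / (D + 1) / n := by positivity
    have hs1 : η / (D + 1) / n ≤ 1 := by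
      rw [div_le_one hn0, div_le_iff₀ (by positivity)]
      have : (0 : ℝ) ≤ D := by positivity
      nlinarith
    have hb : 1 - (1 - η / (D + 1) / n) ^ r ≤ η / n := by
      have := one_add_mul_le_pow (show (-2 : ℝ) ≤ -(η / (D + 1) / n) by linarith) r
      have h2 : (r : ℝ) * (η / (D + 1) / n) ≤ η / n := by
        rw [div_right_comm, mul_div_assoc', div_le_iff₀ (by positivity)]
        have : (r : ℝ) ≤ D + 1 := by
          have : (r : ℝ) ≤ D := by exact_mod_cast hr
          linarith
        nlinarith [show 0 ≤ η / n by positivity]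
      rw [← sub_eq_add_neg] at this
      linarith
    refine selectionExp_colInd_blockDensity_le W c' hp0 (p₁ := 1 - (1 - η / (D + 1) / n) ^ r)
      ?_ ?_ hp1 ?_ hp1' hδ0.le fun T hT => ?_
    · have := pow_le_one₀ (n := r) (show 0 ≤ 1 - η / (D + 1) / n by linarith) (by linarith)
      linarith
    · have := pow_nonneg (show 0 ≤ 1 - η / (D + 1) / n by linarith) r
      linarith
    · calc _ ≤ a / n + η / n := by gcongr
        _ = (a + η) / n := by ring
        _ ≤ a' / n := by gcongr
    · refine hN₁ r n ?_ W hW T c' hT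
      exact (le_sup (f := N₁) (mem_range.mpr (Nat.lt_succ_of_le hr))).trans hn1
  refine (plantEffect_le hn4 D hS hc hp0 hp1 hδ0.le hB).trans ?_
  have t1 : (W.card : ℝ) ^ 2 * (a / n) ≤ θ / 3 := by
    have h1 : (K : ℝ) ^ 2 * M ≤ θ / 3 * n := by
      have := hN₂.trans (show (N₂ : ℝ) ≤ n by exact_mod_cast hn2)
      rw [div_le_iff₀ (by positivity)] at this
      linarith
    rw [mul_div_assoc', div_le_iff₀ hn0]
    refine le_trans ?_ h1
    gcongr
    linarith
  have t2 : (1 + a / n) ^ (W.card * n) / 2 ^ (D + 1) ≤ θ / 3 := by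
    refine le_trans ?_ hD
    gcongr
    calc (1 + a / n) ^ (W.card * n) ≤ (Real.exp (a / n)) ^ (W.card * n) := by
          gcongr
          linarith [Real.add_one_le_exp (a / n)]
      _ = Real.exp (W.card * a) := by
          rw [← Real.exp_nat_mul]; push_cast; congr 1; field_simp
      _ ≤ _ := by
          refine Real.exp_le_exp.mpr ?_
          gcongr
          linarith
  have t3 : ∑ r ∈ range (D + 1), ((W.card : ℝ) * (n * (a / n))) ^ r * (δ + (δ + Δ)) ≤
      C * (δ + (δ + Δ)) := by
    rw [← sum_mul]
    refine mul_le_mul_of_nonneg_right (sum_le_sum fun r _ => ?_) (by positivity)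
    rw [mul_div_cancel₀ _ hn0.ne']
    gcongr
    linarith
  have t4 : C * (δ + (δ + Δ)) = θ / 3 + C * Δ := by
    rw [hδ]; field_simp; ring
  linarith

end Planting

/-- The Fourier coefficient attached to an edge by a coloring. -/
noncomputable def edgeCoef {n q : ℕ} (σ : Fin n → Fin q) (e : Fin n × Fin n) : ℝ :=
  if σ e.1 = σ e.2 then -1 else 1 / ((q : ℝ) - 1)

/-- The normalized edge indicator. -/
noncomputable def edgeChar {ε : Type*} [DecidableEq ε] (p : ℝ) (T : Finset ε) (e : ε) : ℝ :=
  if e ∈ T then 1 else -(p / (1 - p))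

/-- The averaged Fourier coefficient of the edge set `S` over the colorings in `B`. -/
noncomputable def colorCoef {n q : ℕ} (B : Finset (Fin n → Fin q)) (S : Finset (Fin n × Fin n)) :
    ℝ :=
  (∑ σ ∈ B, ∏ e ∈ S, edgeCoef σ e) / (q : ℝ) ^ n

section Fourier

lemma abs_edgeCoef_le_one {n q : ℕ} (hq : 2 ≤ q) (σ : Fin n → Fin q) (e : Fin n × Fin n) :
    |edgeCoef σ e| ≤ 1 := by
  have : (2 : ℝ) ≤ q := by exact_mod_cast hq
  unfold edgeCoef
  split_ifs
  · simp
  · rw [abs_of_nonneg (by apply div_nonneg <;> linarith), div_le_one (by linarith)]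
    linarith

lemma selectionExp_edgeChar_mul {ε : Type*} [Fintype ε] [DecidableEq ε] {U S S' : Finset ε}
    (hS : S ⊆ U) (hS' : S' ⊆ U) {p : ℝ} (hp : p < 1) :
    selectionExp (probOn U p)
      (fun T => (∏ e ∈ S, edgeChar p T e) * ∏ e ∈ S', edgeChar p T e) =
      if S = S' then (p / (1 - p)) ^ S.card else 0 := by
  have hp' : 1 - p ≠ 0 := by linarith
  have h : (fun T : Finset ε => (∏ e ∈ S, edgeChar p T e) * ∏ e ∈ S', edgeChar p T e) =
      fun T => ∏ e, if e ∈ T then 1 else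
        ((if e ∈ S then -(p / (1 - p)) else 1) * (if e ∈ S' then -(p / (1 - p)) else 1)) := by
    funext T
    rw [← univ_inter S, ← univ_inter S', ← prod_ite_mem, ← prod_ite_mem, ← prod_mul_distrib]
    refine prod_congr rfl fun e _ => ?_
    unfold edgeChar
    by_cases he : e ∈ T <;> simp [he]
  rw [h, selectionExp_prod]
  by_cases hSS : S = S'
  · subst hSS
    rw [if_pos rfl, ← prod_const, ← prod_subset (subset_univ S)]
    · refine prod_congr rfl fun e he => ?_
      simp only [probOn, hS he, he, if_true]
      field_simp
      ring
    · intro e _ he; simp [he]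
  · rw [if_neg hSS]
    have : ∃ e, (e ∈ S ∧ e ∉ S') ∨ (e ∉ S ∧ e ∈ S') := by
      by_contra hc
      push Not at hc
      exact hSS (Finset.ext fun e => by have := hc e; tauto)
    obtain ⟨e, he⟩ := this
    refine prod_eq_zero (mem_univ e) ?_
    rcases he with he | he
    · simp only [probOn, hS he.1, he.1, he.2, if_true, if_false]
      field_simp
      ring
    · simp only [probOn, hS' he.2, he.1, he.2, if_true, if_false]
      field_simp
      ring

lemma selectionExp_edgeChar {ε : Type*} [Fintype ε] [DecidableEq ε] {S : Finset ε}
    (hS : S.Nonempty) {p : ℝ} (hp : p < 1) :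
    selectionExp (probOn S p) (fun T => ∏ e ∈ S, edgeChar p T e) = 0 := by
  have := selectionExp_edgeChar_mul (Subset.refl S) (empty_subset S) hp
  rw [if_neg hS.ne_empty] at this
  simpa using this

lemma selectionExp_abs_edgeChar {ε : Type*} [Fintype ε] [DecidableEq ε] (S : Finset ε)
    {p : ℝ} (h0 : 0 ≤ p) (hp : p < 1) :
    selectionExp (probOn S p) (fun T => |∏ e ∈ S, edgeChar p T e|) = (2 * p) ^ S.card := by
  have hp' : 1 - p ≠ 0 := by linarith
  have h : (fun T : Finset ε => |∏ e ∈ S, edgeChar p T e|) =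
      fun T => ∏ e, if e ∈ T then 1 else (if e ∈ S then p / (1 - p) else 1) := by
    funext T
    rw [abs_prod, ← univ_inter S, ← prod_ite_mem]
    refine prod_congr rfl fun e _ => ?_
    unfold edgeChar
    by_cases he : e ∈ T
    · simp [he]
    · simp only [he, if_false, univ_inter, abs_neg,
        abs_of_nonneg (div_nonneg h0 (show 0 ≤ 1 - p by linarith))]
  rw [h, selectionExp_prod, ← prod_const, ← prod_subset (subset_univ S)]
  · refine prod_congr rfl fun e he => ?_
    simp only [probOn, he, if_true]
    field_simp
    ring
  · intro e _ he; simp [he]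

lemma plantEffect_le_one {n q : ℕ} {p : ℝ} (h0 : 0 ≤ p) (h1 : p ≤ 1)
    (S : Finset (Fin n × Fin n)) : plantEffect q S p ≤ 1 :=
  selectionExp_le_one (isProbVec_probOn _ h0 h1) fun T => by
    linarith [colInd_le_one (q := q) T, colInd_nonneg (q := q) (T ∪ S)]

lemma abs_selectionExp_colInd_edgeChar_le {n q : ℕ} {S : Finset (Fin n × Fin n)}
    (hS : S ⊆ pairSet n) (hne : S.Nonempty) {p : ℝ} (h0 : 0 ≤ p) (h1 : p < 1) :
    |selectionExp (probOn (pairSet n) p)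
      (fun T => (1 - colInd q T) * ∏ e ∈ S, edgeChar p T e)| ≤
      (2 * p) ^ S.card * plantEffect q S p := by
  have hv := isProbVec_probOn (pairSet n \ S) h0 h1.le
  have hvS := isProbVec_probOn S h0 h1.le
  have e0 : probOn (pairSet n) p = probUnion (probOn (pairSet n \ S) p) (probOn S p) := by
    rw [probUnion_probOn_disjoint sdiff_disjoint, sdiff_union_of_subset hS]
  rw [e0, ← selectionExp_union, plantEffect, ← selectionExp_const_mul]
  refine (abs_selectionExp_le hv _).trans (selectionExp_mono_support hv fun T hT => ?_)
  have hT' := mem_of_probOn_ne_zero hT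
  have hY : ∀ T', ∏ e ∈ S, edgeChar p (T ∪ T') e = ∏ e ∈ S, edgeChar p T' e := fun T' =>
    prod_congr rfl fun e he => by
      have : e ∉ T := fun h => (Finset.mem_sdiff.mp (hT' h)).2 he
      simp [edgeChar, this]
  have e1 : selectionExp (probOn S p)
      (fun T' => (1 - colInd q (T ∪ T')) * ∏ e ∈ S, edgeChar p (T ∪ T') e) =
      selectionExp (probOn S p)
      (fun T' => (colInd q T - colInd q (T ∪ T')) * ∏ e ∈ S, edgeChar p T' e) := by
    have : ∀ T' : Finset (Fin n × Fin n),
        (1 - colInd q (T ∪ T')) * ∏ e ∈ S, edgeChar p (T ∪ T') e =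
        (1 - colInd q T) * (∏ e ∈ S, edgeChar p T' e) +
          (colInd q T - colInd q (T ∪ T')) * ∏ e ∈ S, edgeChar p T' e := fun T' => by
      rw [hY]; ring
    simp only [this]
    rw [selectionExp_add, selectionExp_const_mul, selectionExp_edgeChar hne h1, mul_zero, zero_add]
  rw [e1]
  refine (abs_selectionExp_le hvS _).trans ?_
  rw [← selectionExp_abs_edgeChar S h0 h1, mul_comm, ← selectionExp_const_mul]
  refine selectionExp_mono_support hvS fun T' hT'' => ?_
  have hsub := mem_of_probOn_ne_zero hT''
  rw [abs_mul]
  refine mul_le_mul_of_nonneg_right ?_ (abs_nonneg _)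
  rw [abs_of_nonneg (by linarith [colInd_anti (q := q) (subset_union_left (s₁ := T) (s₂ := T'))])]
  linarith [colInd_anti (q := q) (union_subset_union_right (s := T) hsub)]

lemma sum_colorCoef_mul {n q : ℕ} (B : Finset (Fin n → Fin q)) (p : ℝ)
    (T : Finset (Fin n × Fin n)) :
    ∑ S ∈ (pairSet n).powerset, colorCoef B S * ∏ e ∈ S, edgeChar p T e =
      (∑ σ ∈ B, ∏ e ∈ pairSet n, (1 + edgeCoef σ e * edgeChar p T e)) / (q : ℝ) ^ n := by
  simp only [prod_one_add, colorCoef, prod_mul_distrib]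
  rw [sum_comm, sum_div]
  refine sum_congr rfl fun S _ => ?_
  rw [← sum_mul]
  ring

lemma sum_colorCoef_mul_eq_zero {n q : ℕ} (B : Finset (Fin n → Fin q)) (p : ℝ)
    {T : Finset (Fin n × Fin n)} (hT : T ⊆ pairSet n) (h : ¬ PairColorable q T) :
    ∑ S ∈ (pairSet n).powerset, colorCoef B S * ∏ e ∈ S, edgeChar p T e = 0 := by
  rw [sum_colorCoef_mul, sum_eq_zero, zero_div]
  intro σ _
  have : ¬ IsProper σ T := fun hσ => h ⟨σ, hσ⟩
  unfold IsProper at this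
  push Not at this
  obtain ⟨e, he, hmono⟩ := this
  exact prod_eq_zero (hT he) (by simp [edgeCoef, edgeChar, he, hmono])

lemma sum_colorCoef_sq {n q : ℕ} (B : Finset (Fin n → Fin q)) (l : ℝ) :
    ∑ S ∈ (pairSet n).powerset, l ^ S.card * colorCoef B S ^ 2 =
      (∑ σ ∈ B, ∑ τ ∈ B, ∏ e ∈ pairSet n, (1 + l * (edgeCoef σ e * edgeCoef τ e))) /
        ((q : ℝ) ^ n) ^ 2 := by
  simp only [prod_one_add, colorCoef, prod_mul_distrib, prod_const, div_pow]
  rw [sum_congr rfl fun σ _ => sum_comm, sum_comm, sum_div]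
  refine sum_congr rfl fun S _ => ?_
  rw [mul_div_assoc', sq (∑ σ ∈ B, _), sum_mul_sum, mul_sum]
  simp only [mul_sum]

lemma selectionExp_sq_high {n q : ℕ} (B : Finset (Fin n → Fin q)) (K : ℕ) {p l : ℝ}
    (h0 : 0 ≤ p) (h1 : p < 1) (hl : 1 ≤ l) :
    selectionExp (probOn (pairSet n) p)
      (fun T => (∑ S ∈ (pairSet n).powerset.filter (fun S => K < S.card),
        colorCoef B S * ∏ e ∈ S, edgeChar p T e) ^ 2) ≤
      (∑ S ∈ (pairSet n).powerset, (l * (p / (1 - p))) ^ S.card * colorCoef B S ^ 2) / l ^ K := by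
  have hlp : 0 ≤ p / (1 - p) := div_nonneg h0 (by linarith)
  have hl0 : 0 < l := by linarith
  have e1 : selectionExp (probOn (pairSet n) p)
      (fun T => (∑ S ∈ (pairSet n).powerset.filter (fun S => K < S.card),
        colorCoef B S * ∏ e ∈ S, edgeChar p T e) ^ 2) =
      ∑ S ∈ (pairSet n).powerset.filter (fun S => K < S.card),
        (p / (1 - p)) ^ S.card * colorCoef B S ^ 2 := by
    simp only [sq, sum_mul_sum, selectionExp_sum]
    refine sum_congr rfl fun S hS => ?_
    have hS' := mem_powerset.mp (mem_filter.mp hS).1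
    have : ∀ S' ∈ (pairSet n).powerset.filter (fun S => K < S.card),
        selectionExp (probOn (pairSet n) p) (fun T =>
          colorCoef B S * (∏ e ∈ S, edgeChar p T e) * (colorCoef B S' * ∏ e ∈ S', edgeChar p T e))
        = if S = S' then (p / (1 - p)) ^ S.card * (colorCoef B S * colorCoef B S) else 0 := by
      intro S' hS'2
      have hS'3 := mem_powerset.mp (mem_filter.mp hS'2).1
      simp only [mul_mul_mul_comm (colorCoef B S)]
      rw [selectionExp_const_mul, selectionExp_edgeChar_mul hS' hS'3 h1]
      split_ifs with h
      · subst h; ring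
      · simp
    rw [sum_congr rfl this, sum_ite_eq, if_pos hS]
  rw [e1, sum_div]
  refine (sum_le_sum fun S hS => ?_).trans
    (sum_le_sum_of_subset_of_nonneg (filter_subset _ _) fun S _ _ => by positivity)
  have hK := (mem_filter.mp hS).2
  rw [mul_pow, le_div_iff₀ (by positivity)]
  have : l ^ K ≤ l ^ S.card := pow_le_pow_right₀ hl hK.le
  have h3 : 0 ≤ (p / (1 - p)) ^ S.card * colorCoef B S ^ 2 := by positivity
  nlinarith

lemma selectionExp_sq_le {ε : Type*} [Fintype ε] [DecidableEq ε] {p : ε → ℝ} (hp : IsProbVec p)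
    (F : Finset ε → ℝ) : selectionExp p F ^ 2 ≤ selectionExp p (fun T => F T ^ 2) := by
  have h : 0 ≤ selectionExp p (fun T => (F T - selectionExp p F) ^ 2) :=
    selectionExp_nonneg hp fun T => sq_nonneg _
  have e : (fun T => (F T - selectionExp p F) ^ 2) =
      fun T => (F T ^ 2 - (2 * selectionExp p F) * F T) + selectionExp p F ^ 2 := by
    funext T; ring
  rw [e, selectionExp_add, selectionExp_sub, selectionExp_const_mul, selectionExp_const] at h
  nlinarith

lemma colorCoef_empty {n q : ℕ} (B : Finset (Fin n → Fin q)) :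
    colorCoef B ∅ = B.card / (q : ℝ) ^ n := by
  simp [colorCoef]

/-- Fourier bound for the probability of non-colorability. -/
lemma colorCoef_mul_prob_le {n q : ℕ} (B : Finset (Fin n → Fin q)) (K : ℕ) {p l : ℝ}
    (h0 : 0 ≤ p) (h1 : p < 1) (hl : 1 ≤ l) :
    colorCoef B ∅ * selectionExp (probOn (pairSet n) p) (fun T => 1 - colInd q T) ≤
      ∑ S ∈ (pairSet n).powerset.filter (fun S => S.Nonempty ∧ S.card ≤ K),
        |colorCoef B S| * ((2 * p) ^ S.card * plantEffect q S p) +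
      √((∑ S ∈ (pairSet n).powerset, (l * (p / (1 - p))) ^ S.card * colorCoef B S ^ 2) / l ^ K) := by
  have hv := isProbVec_probOn (pairSet n) h0 h1.le
  set g : Finset (Fin n × Fin n) → ℝ := fun T => 1 - colInd q T with hg
  set Y : Finset (Fin n × Fin n) → Finset (Fin n × Fin n) → ℝ :=
    fun S T => ∏ e ∈ S, edgeChar p T e with hY
  have hzero : selectionExp (probOn (pairSet n) p)
      (fun T => g T * ∑ S ∈ (pairSet n).powerset, colorCoef B S * Y S T) = 0 := by
    rw [selectionExp_congr_support (G := fun _ => 0), selectionExp_const]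
    intro T hT
    by_cases h : PairColorable q T
    · simp [hg, colInd, h]
    · rw [sum_colorCoef_mul_eq_zero B p (mem_of_probOn_ne_zero hT) h, mul_zero]
  set P1 := (pairSet n).powerset.filter (fun S => S.Nonempty ∧ S.card ≤ K) with hP1
  set P2 := (pairSet n).powerset.filter (fun S => K < S.card) with hP2
  have hsplit : ∀ T, ∑ S ∈ (pairSet n).powerset, colorCoef B S * Y S T =
      colorCoef B ∅ + ∑ S ∈ P1, colorCoef B S * Y S T + ∑ S ∈ P2, colorCoef B S * Y S T := by
    intro T
    have e1 : (pairSet n).powerset = insert ∅ (P1 ∪ P2) := by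
      ext S
      simp only [hP1, hP2, mem_insert, mem_union, mem_filter]
      rcases S.eq_empty_or_nonempty with h | h
      · simp [h]
      · simp only [h, h.ne_empty, true_and, false_or]
        have := le_or_gt S.card K
        tauto
    have e2 : ∅ ∉ P1 ∪ P2 := by simp [hP1, hP2]
    have e3 : Disjoint P1 P2 := by
      refine disjoint_left.mpr fun S h1 h2 => ?_
      have := (mem_filter.mp h1).2.2
      have := (mem_filter.mp h2).2
      omega
    rw [e1, sum_insert e2, sum_union e3, ← add_assoc]
    simp [hY]
  have h2 : colorCoef B ∅ * selectionExp (probOn (pairSet n) p) g =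
      -(∑ S ∈ P1, colorCoef B S * selectionExp (probOn (pairSet n) p) (fun T => g T * Y S T)) -
      selectionExp (probOn (pairSet n) p) (fun T => g T * ∑ S ∈ P2, colorCoef B S * Y S T) := by
    have e1 : (fun T => g T * ∑ S ∈ (pairSet n).powerset, colorCoef B S * Y S T) = fun T =>
        (colorCoef B ∅ * g T + ∑ S ∈ P1, colorCoef B S * (g T * Y S T)) +
          g T * ∑ S ∈ P2, colorCoef B S * Y S T := by
      funext T
      rw [hsplit, mul_add, mul_add, mul_comm (g T), mul_sum P1]
      simp only [mul_left_comm (g T)]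
    rw [e1, selectionExp_add, selectionExp_add, selectionExp_const_mul, selectionExp_sum] at hzero
    simp only [selectionExp_const_mul] at hzero
    linarith
  have h3 : -(∑ S ∈ P1, colorCoef B S *
      selectionExp (probOn (pairSet n) p) (fun T => g T * Y S T)) ≤
      ∑ S ∈ P1, |colorCoef B S| * ((2 * p) ^ S.card * plantEffect q S p) := by
    refine (neg_le_abs _).trans ((abs_sum_le_sum_abs _ _).trans (sum_le_sum fun S hS => ?_))
    rw [abs_mul]
    obtain ⟨hS1, hS2, -⟩ := mem_filter.mp hS
    exact mul_le_mul_of_nonneg_left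
      (abs_selectionExp_colInd_edgeChar_le (mem_powerset.mp hS1) hS2 h0 h1) (abs_nonneg _)
  have h4 : -selectionExp (probOn (pairSet n) p) (fun T => g T * ∑ S ∈ P2, colorCoef B S * Y S T) ≤
      √((∑ S ∈ (pairSet n).powerset, (l * (p / (1 - p))) ^ S.card * colorCoef B S ^ 2) / l ^ K) := by
    refine (neg_le_abs _).trans (Real.abs_le_sqrt ?_)
    refine (selectionExp_sq_le hv _).trans (le_trans ?_ (selectionExp_sq_high B K h0 h1 hl))
    refine selectionExp_mono hv fun T => ?_
    rw [mul_pow]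
    refine mul_le_of_le_one_left (sq_nonneg _) ?_
    have h5 := colInd_nonneg (q := q) T
    have h6 := colInd_le_one (q := q) T
    simp only [hg]
    nlinarith
  linarith

end Fourier

/-- The edges in `S` at the vertex `v`. -/
def edgesAt {n : ℕ} (S : Finset (Fin n × Fin n)) (v : Fin n) : Finset (Fin n × Fin n) :=
  S.filter fun e => e.1 = v ∨ e.2 = v

/-- The vertices incident with an edge of `S`. -/
def edgeSupport {n : ℕ} (S : Finset (Fin n × Fin n)) : Finset (Fin n) :=
  univ.filter fun v => (edgesAt S v).Nonempty

section LowDegree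

lemma plantEffect_nonneg {n q : ℕ} {p : ℝ} (h0 : 0 ≤ p) (h1 : p ≤ 1)
    (S : Finset (Fin n × Fin n)) : 0 ≤ plantEffect q S p :=
  selectionExp_nonneg (isProbVec_probOn _ h0 h1) fun T => by
    linarith [colInd_anti (q := q) (subset_union_left (s₁ := T) (s₂ := S))]

lemma ne_of_mem_pairSet {n : ℕ} {e : Fin n × Fin n} (h : e ∈ pairSet n) : e.1 ≠ e.2 := by
  have : e.1 < e.2 := by simpa [pairSet] using h
  exact this.ne

lemma mem_edgeSupport {n : ℕ} {S : Finset (Fin n × Fin n)} {e : Fin n × Fin n} (he : e ∈ S) :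
    e.1 ∈ edgeSupport S ∧ e.2 ∈ edgeSupport S := by
  constructor
  · exact mem_filter.mpr ⟨mem_univ _, e, mem_filter.mpr ⟨he, Or.inl rfl⟩⟩
  · exact mem_filter.mpr ⟨mem_univ _, e, mem_filter.mpr ⟨he, Or.inr rfl⟩⟩

lemma sum_card_edgesAt {n : ℕ} {S : Finset (Fin n × Fin n)} (hS : S ⊆ pairSet n) :
    ∑ v ∈ edgeSupport S, (edgesAt S v).card = 2 * S.card := by
  have e1 : ∑ v ∈ edgeSupport S, (edgesAt S v).card = ∑ v, (edgesAt S v).card := by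
    refine sum_subset (subset_univ _) fun v _ hv => ?_
    simpa [edgeSupport] using hv
  have e2 : ∀ v, (edgesAt S v).card = ∑ e ∈ S, if e.1 = v ∨ e.2 = v then 1 else 0 := fun v => by
    rw [edgesAt, card_filter]
  rw [e1]
  simp only [e2]
  rw [sum_comm, sum_congr rfl (g := fun _ => 2), sum_const, smul_eq_mul, mul_comm]
  intro e he
  have hne := ne_of_mem_pairSet (hS he)
  rw [← card_filter, ← card_pair hne]
  congr 1
  ext v
  simp [eq_comm]

lemma pairColorable_of_degree_le {n q : ℕ} (hq : 3 ≤ q) {S : Finset (Fin n × Fin n)}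
    (hS : S ⊆ pairSet n) (h : ∀ v, (edgesAt S v).card ≤ 2) : PairColorable q S := by
  have key : ∀ X : Finset (Fin n), ∃ σ : Fin n → Fin q,
      ∀ e ∈ S, e.1 ∈ X → e.2 ∈ X → σ e.1 ≠ σ e.2 := by
    intro X
    induction X using Finset.induction_on with
    | empty => exact ⟨fun _ => ⟨0, by omega⟩, by simp⟩
    | insert v X hv ih =>
      obtain ⟨σ, hσ⟩ := ih
      set F : Finset (Fin q) :=
        (edgesAt S v).image fun e => if e.1 = v then σ e.2 else σ e.1 with hF
      have hcard : F.card < (univ : Finset (Fin q)).card := by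
        have : F.card ≤ (edgesAt S v).card := card_image_le
        have := h v
        simp only [card_univ, Fintype.card_fin]
        omega
      obtain ⟨a, -, ha⟩ := exists_mem_notMem_of_card_lt_card hcard
      refine ⟨Function.update σ v a, fun e he h1 h2 => ?_⟩
      have hne := ne_of_mem_pairSet (hS he)
      by_cases e1 : e.1 = v
      · have h2' : e.2 ≠ v := fun h => hne (e1.trans h.symm)
        rw [e1, Function.update_self, Function.update_of_ne h2']
        rintro rfl
        exact ha (mem_image.mpr ⟨e, mem_filter.mpr ⟨he, Or.inl e1⟩, by simp [e1]⟩)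
      · by_cases e2 : e.2 = v
        · rw [e2, Function.update_self, Function.update_of_ne e1]
          rintro rfl
          exact ha (mem_image.mpr ⟨e, mem_filter.mpr ⟨he, Or.inr e2⟩, by simp [e1]⟩)
        · rw [Function.update_of_ne e1, Function.update_of_ne e2]
          exact hσ e he ((mem_insert.mp h1).resolve_left e1) ((mem_insert.mp h2).resolve_left e2)
  obtain ⟨σ, hσ⟩ := key univ
  exact ⟨σ, fun e he => hσ e he (mem_univ _) (mem_univ _)⟩

lemma sum_prod_edgeCoef_eq_zero {n q : ℕ} (hq : 2 ≤ q) {S : Finset (Fin n × Fin n)}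
    (hS : S ⊆ pairSet n) {v : Fin n} (h : (edgesAt S v).card = 1) :
    ∑ σ : Fin n → Fin q, ∏ e ∈ S, edgeCoef σ e = 0 := by
  obtain ⟨e₀, he₀⟩ := card_eq_one.mp h
  have hmem : e₀ ∈ S ∧ (e₀.1 = v ∨ e₀.2 = v) := mem_filter.mp (he₀ ▸ mem_singleton_self e₀)
  have hne := ne_of_mem_pairSet (hS hmem.1)
  have hq1 : (q : ℝ) - 1 ≠ 0 := by
    have : (2 : ℝ) ≤ q := by exact_mod_cast hq
    linarith
  rw [← (Equiv.funSplitAt v (Fin q)).symm.sum_comp, Fintype.sum_prod_type_right]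
  refine sum_eq_zero fun f _ => ?_
  have hval : ∀ c u, ∀ hu : u ≠ v, (Equiv.funSplitAt v (Fin q)).symm (c, f) u = f ⟨u, hu⟩ := by
    intro c u hu
    simp [Equiv.funSplitAt, Equiv.piSplitAt, hu]
  have hval' : ∀ c, (Equiv.funSplitAt v (Fin q)).symm (c, f) v = c := by
    intro c
    simp [Equiv.funSplitAt, Equiv.piSplitAt]
  set c₀ : Fin q := ⟨0, by omega⟩
  have hsplit : ∀ c, ∏ e ∈ S, edgeCoef ((Equiv.funSplitAt v (Fin q)).symm (c, f)) e =
      edgeCoef ((Equiv.funSplitAt v (Fin q)).symm (c, f)) e₀ *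
        ∏ e ∈ S.erase e₀, edgeCoef ((Equiv.funSplitAt v (Fin q)).symm (c₀, f)) e := by
    intro c
    rw [← mul_prod_erase S _ hmem.1]
    congr 1
    refine prod_congr rfl fun e he => ?_
    have hev : ¬ (e.1 = v ∨ e.2 = v) := by
      intro hev
      have : e ∈ edgesAt S v := mem_filter.mpr ⟨(mem_erase.mp he).2, hev⟩
      rw [he₀, mem_singleton] at this
      exact (mem_erase.mp he).1 this
    push Not at hev
    simp only [edgeCoef, hval _ _ hev.1, hval _ _ hev.2]
  simp only [hsplit]
  rw [← sum_mul]
  have hone : ∀ b : Fin q, ∑ c : Fin q, (if c = b then (-1 : ℝ) else 1 / ((q : ℝ) - 1)) = 0 := by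
    intro b
    rw [← add_sum_erase _ _ (mem_univ b), if_pos rfl,
      sum_congr rfl fun c hc => if_neg (mem_erase.mp hc).1, sum_const, card_erase_of_mem
      (mem_univ b), nsmul_eq_mul, card_univ, Fintype.card_fin, Nat.cast_sub (by omega)]
    field_simp
    simp
  convert zero_mul _
  rcases hmem.2 with h1 | h1
  · have h2 : e₀.2 ≠ v := fun h => hne (h1.trans h.symm)
    simp only [edgeCoef, h1, hval', hval _ _ h2]
    exact hone _
  · have h2 : e₀.1 ≠ v := fun h => hne (h.trans h1.symm)
    simp only [edgeCoef, h1, hval', hval _ _ h2, eq_comm]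
    exact (hone _).symm

lemma abs_colorCoef_le {n q : ℕ} (hq : 2 ≤ q) (B : Finset (Fin n → Fin q))
    (S : Finset (Fin n × Fin n)) : |colorCoef B S| ≤ B.card / (q : ℝ) ^ n := by
  rw [colorCoef, abs_div, abs_of_nonneg (show (0 : ℝ) ≤ (q : ℝ) ^ n by positivity)]
  gcongr
  refine (abs_sum_le_sum_abs _ _).trans ((sum_le_card_nsmul _ _ 1 fun σ _ => ?_).trans (by simp))
  rw [abs_prod]
  exact prod_le_one (fun _ _ => abs_nonneg _) fun e _ => abs_edgeCoef_le_one hq σ e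

lemma abs_colorCoef_le_one {n q : ℕ} (hq : 2 ≤ q) (B : Finset (Fin n → Fin q))
    (S : Finset (Fin n × Fin n)) : |colorCoef B S| ≤ 1 := by
  refine (abs_colorCoef_le hq B S).trans (div_le_one_of_le₀ ?_ (by positivity))
  have := card_le_univ B
  simp only [Fintype.card_fun, Fintype.card_fin] at this
  exact_mod_cast this

lemma abs_colorCoef_le_of_leaf {n q : ℕ} (hq : 2 ≤ q) (B : Finset (Fin n → Fin q))
    {S : Finset (Fin n × Fin n)} (hS : S ⊆ pairSet n) {v : Fin n} (h : (edgesAt S v).card = 1) :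
    |colorCoef B S| ≤ Bᶜ.card / (q : ℝ) ^ n := by
  have h1 := sum_prod_edgeCoef_eq_zero hq hS h
  rw [← sum_add_sum_compl B] at h1
  have : colorCoef B S = - colorCoef Bᶜ S := by
    rw [colorCoef, colorCoef, ← neg_div]
    congr 1
    linarith
  rw [this, abs_neg]
  exact abs_colorCoef_le hq _ S

lemma sum_two_mul_pow_card_le {n : ℕ} (hn : 0 < n) (K : ℕ) {p : ℝ} (h0 : 0 ≤ p) :
    ∑ S ∈ (pairSet n).powerset.filter (fun S => S.Nonempty ∧ S.card ≤ K), (2 * p) ^ S.card ≤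
      (n : ℝ) ^ K * Real.exp (2 * p * n) := by
  have hn' : (1 : ℝ) ≤ n := by exact_mod_cast hn
  calc _ ≤ ∑ S ∈ (pairSet n).powerset.filter (fun S => S.Nonempty ∧ S.card ≤ K),
        (n : ℝ) ^ K * (2 * p / n) ^ S.card := by
        refine sum_le_sum fun S hS => ?_
        have hK := (mem_filter.mp hS).2.2
        rw [div_pow, mul_div_assoc', le_div_iff₀ (by positivity), mul_comm]
        refine mul_le_mul_of_nonneg_right (pow_le_pow_right₀ hn' hK) (by positivity)
    _ ≤ ∑ S ∈ (pairSet n).powerset, (n : ℝ) ^ K * (2 * p / n) ^ S.card :=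
        sum_le_sum_of_subset_of_nonneg (filter_subset _ _) fun _ _ _ => by positivity
    _ = (n : ℝ) ^ K * (1 + 2 * p / n) ^ (pairSet n).card := by
        rw [← mul_sum, ← prod_const, prod_one_add]
        simp only [prod_const]
    _ ≤ (n : ℝ) ^ K * (1 + 2 * p / n) ^ (n * n) := by
        gcongr
        · have : 0 ≤ 2 * p / n := by positivity
          linarith
        · exact (card_le_univ _).trans (by simp)
    _ ≤ (n : ℝ) ^ K * Real.exp (2 * p / n) ^ (n * n) := by
        gcongr
        linarith [Real.add_one_le_exp (2 * p / n)]
    _ = _ := by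
        rw [← Real.exp_nat_mul]; push_cast; congr 2; field_simp

/-- Bound for the low-degree part of the Fourier expansion. -/
lemma low_degree_le {n q : ℕ} (hn : 0 < n) (hq : 3 ≤ q) (B : Finset (Fin n → Fin q)) (K : ℕ)
    {p : ℝ} (h0 : 0 ≤ p) (h1 : 2 * p ≤ 1) {R : Finset (Fin n) → ℝ}
    (hR : ∀ W : Finset (Fin n), W.card ≤ K → 0 ≤ R W ∧ ∀ S : Finset (Fin n × Fin n),
      (∀ e ∈ S, e.1 ∈ W ∧ e.2 ∈ W) → PairColorable q S → plantEffect q S p ≤ R W) :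
    ∑ S ∈ (pairSet n).powerset.filter (fun S => S.Nonempty ∧ S.card ≤ K),
        |colorCoef B S| * ((2 * p) ^ S.card * plantEffect q S p) ≤
      Bᶜ.card / (q : ℝ) ^ n * ((n : ℝ) ^ K * Real.exp (2 * p * n)) +
      ∑ W ∈ univ.filter (fun W : Finset (Fin n) => W.card ≤ K),
        2 ^ (K ^ 2) * ((2 * p) ^ W.card * (2 * p + R W)) := by
  set P := (pairSet n).powerset.filter (fun S => S.Nonempty ∧ S.card ≤ K) with hP
  set β : ℝ := Bᶜ.card / (q : ℝ) ^ n with hβ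
  have hβ0 : 0 ≤ β := by positivity
  have hpe0 := fun S => plantEffect_nonneg (n := n) (q := q) h0 (by linarith) S
  have hpe1 := fun S => plantEffect_le_one (n := n) (q := q) h0 (by linarith) S
  have key : ∀ S ∈ P, |colorCoef B S| * ((2 * p) ^ S.card * plantEffect q S p) ≤
      β * (2 * p) ^ S.card +
        if (edgeSupport S).card ≤ K then
          (2 * p) ^ (edgeSupport S).card * (2 * p + R (edgeSupport S)) else 0 := by
    intro S hS
    obtain ⟨hSU, hne, hK⟩ := mem_filter.mp hS
    have hSU := mem_powerset.mp hSU
    have hnn : 0 ≤ (2 * p) ^ S.card * plantEffect q S p := mul_nonneg (by positivity) (hpe0 S)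
    by_cases hleaf : ∃ v, (edgesAt S v).card = 1
    · obtain ⟨v, hv⟩ := hleaf
      have e1 := abs_colorCoef_le_of_leaf (by omega) B hSU hv
      have e2 : (2 * p) ^ S.card * plantEffect q S p ≤ (2 * p) ^ S.card :=
        mul_le_of_le_one_right (by positivity) (hpe1 S)
      have e3 : 0 ≤ if (edgeSupport S).card ≤ K then
          (2 * p) ^ (edgeSupport S).card * (2 * p + R (edgeSupport S)) else 0 := by
        split_ifs with h
        · have := (hR _ h).1
          positivity
        · exact le_rfl
      have e4 := mul_le_mul e1 e2 hnn hβ0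
      linarith
    · push Not at hleaf
      have hdeg : ∀ v ∈ edgeSupport S, 2 ≤ (edgesAt S v).card := by
        intro v hv
        have := card_pos.mpr (mem_filter.mp hv).2
        have := hleaf v
        omega
      have hsum := sum_card_edgesAt hSU
      have hle : (edgeSupport S).card ≤ S.card := by
        have := card_nsmul_le_sum _ _ 2 hdeg
        simp only [smul_eq_mul] at this
        omega
      rw [if_pos (hle.trans hK)]
      have hRW := hR _ (hle.trans hK)
      have e0 : |colorCoef B S| * ((2 * p) ^ S.card * plantEffect q S p) ≤
          (2 * p) ^ S.card * plantEffect q S p :=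
        mul_le_of_le_one_left hnn (abs_colorCoef_le_one (by omega) B S)
      have e1 : 0 ≤ β * (2 * p) ^ S.card := by positivity
      suffices (2 * p) ^ S.card * plantEffect q S p ≤
          (2 * p) ^ (edgeSupport S).card * (2 * p + R (edgeSupport S)) by linarith
      rcases hle.lt_or_eq with hlt | heq
      · have e2 : (2 * p) ^ S.card ≤ (2 * p) ^ ((edgeSupport S).card + 1) :=
          pow_le_pow_of_le_one (by positivity) h1 hlt
        calc _ ≤ (2 * p) ^ S.card := mul_le_of_le_one_right (by positivity) (hpe1 S)
          _ ≤ _ := e2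
          _ = (2 * p) ^ (edgeSupport S).card * (2 * p) := pow_succ _ _
          _ ≤ _ := by
            refine mul_le_mul_of_nonneg_left ?_ (by positivity)
            linarith [hRW.1]
      · have hdeg2 : ∀ v, (edgesAt S v).card ≤ 2 := by
          intro v
          by_cases hv : v ∈ edgeSupport S
          · by_contra hlt
            push Not at hlt
            have := sum_lt_sum hdeg ⟨v, hv, hlt⟩
            rw [hsum, sum_const, smul_eq_mul] at this
            omega
          · have : ¬ (edgesAt S v).Nonempty := by simpa [edgeSupport] using hv
            rw [not_nonempty_iff_eq_empty.mp this]
            simp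
        have e2 := hRW.2 S (fun e he => mem_edgeSupport he) (pairColorable_of_degree_le hq hSU hdeg2)
        rw [← heq]
        refine mul_le_mul_of_nonneg_left ?_ (by positivity)
        linarith
  refine (sum_le_sum key).trans ?_
  rw [sum_add_distrib, ← mul_sum]
  refine add_le_add (mul_le_mul_of_nonneg_left (sum_two_mul_pow_card_le hn K h0) hβ0) ?_
  rw [← sum_filter]
  rw [← sum_fiberwise_of_maps_to (g := edgeSupport)
    (t := univ.filter (fun W : Finset (Fin n) => W.card ≤ K))
    (fun S hS => mem_filter.mpr ⟨mem_univ _, (mem_filter.mp hS).2⟩)]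
  refine sum_le_sum fun W hW => ?_
  have hWK := (mem_filter.mp hW).2
  rw [sum_congr rfl (g := fun _ => (2 * p) ^ W.card * (2 * p + R W)) fun S hS => by
    rw [(mem_filter.mp hS).2]]
  rw [sum_const, nsmul_eq_mul]
  have hRW := (hR W hWK).1
  refine mul_le_mul_of_nonneg_right ?_ (by positivity)
  have hsub : (P.filter (fun S => (edgeSupport S).card ≤ K)).filter (fun S => edgeSupport S = W) ⊆
      (pairsIn W).powerset := by
    intro S hS
    obtain ⟨hS1, hS2⟩ := mem_filter.mp hS
    have hSU := mem_powerset.mp (mem_filter.mp (mem_filter.mp hS1).1).1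
    refine mem_powerset.mpr fun e he => mem_filter.mpr ⟨hSU he, ?_⟩
    rw [← hS2]
    exact mem_edgeSupport he
  have hc := card_le_card hsub
  rw [card_powerset] at hc
  have hc2 : 2 ^ (pairsIn W).card ≤ 2 ^ (K ^ 2) :=
    Nat.pow_le_pow_right (by norm_num) ((card_pairsIn_le W).trans (Nat.pow_le_pow_left hWK 2))
  exact_mod_cast hc.trans hc2

end LowDegree

section TwoPoint

lemma convexOn_sinh : ConvexOn ℝ (Set.Ici 0) Real.sinh := by
  refine convexOn_of_deriv2_nonneg (convex_Ici 0) Real.continuous_sinh.continuousOn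
    Real.differentiable_sinh.differentiableOn ?_ fun x hx => ?_
  · rw [Real.deriv_sinh]; exact Real.differentiable_cosh.differentiableOn
  · rw [interior_Ici] at hx
    simp only [Function.iterate_succ, Function.iterate_zero, Function.comp, id, Real.deriv_sinh,
      Real.deriv_cosh]
    exact Real.sinh_nonneg_iff.mpr (le_of_lt hx)

lemma mul_sinh_le {x y : ℝ} (hx : 0 ≤ x) (hxy : x ≤ y) : y * Real.sinh x ≤ x * Real.sinh y := by
  rcases (hx.trans hxy).eq_or_lt with h | h
  · have : x = 0 := le_antisymm (hxy.trans h.symm.le) hx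
    simp [this, ← h]
  · have hc := convexOn_sinh.2 (Set.mem_Ici.mpr le_rfl) (Set.mem_Ici.mpr h.le)
      (show 0 ≤ 1 - x / y by rw [sub_nonneg, div_le_one h]; exact hxy)
      (show 0 ≤ x / y by positivity) (by ring)
    simp only [smul_eq_mul, mul_zero, zero_add, Real.sinh_zero, div_mul_cancel₀ _ h.ne'] at hc
    calc y * Real.sinh x ≤ y * (x / y * Real.sinh y) := by gcongr
      _ = x * Real.sinh y := by field_simp

lemma mul_tanh_le {x y : ℝ} (hx : 0 ≤ x) (hxy : x ≤ y) : x * Real.tanh y ≤ y * Real.tanh x := by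
  rw [Real.tanh_eq_sinh_div_cosh, Real.tanh_eq_sinh_div_cosh, mul_div_assoc', mul_div_assoc',
    div_le_div_iff₀ (Real.cosh_pos _) (Real.cosh_pos _)]
  have h := mul_sinh_le (x := y - x) (y := y + x) (by linarith) (by linarith)
  rw [Real.sinh_add, Real.sinh_sub] at h
  nlinarith

lemma log_cosh_le {l y : ℝ} (hl : 0 < l) (hy : 0 ≤ y) :
    Real.log (Real.cosh y) ≤
      Real.log (Real.cosh l) + Real.tanh l / (2 * l) * (y ^ 2 - l ^ 2) := by
  set g : ℝ → ℝ := fun y => Real.tanh l / (2 * l) * (y ^ 2 - l ^ 2) - Real.log (Real.cosh y) with hg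
  have hd : ∀ x, HasDerivAt g (Real.tanh l / l * x - Real.tanh x) x := by
    intro x
    have h1 := (((hasDerivAt_pow 2 x).sub_const (l ^ 2)).const_mul (Real.tanh l / (2 * l))).sub
      ((Real.hasDerivAt_cosh x).log (Real.cosh_pos x).ne')
    refine h1.congr_deriv ?_
    rw [Real.tanh_eq_sinh_div_cosh x]
    norm_num
    field_simp
  have hcont : Continuous g := continuous_iff_continuousAt.mpr fun x => (hd x).continuousAt
  have hderiv : ∀ x, deriv g x = Real.tanh l / l * x - Real.tanh x := fun x => (hd x).deriv
  suffices g l ≤ g y by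
    simp only [hg, sub_self, mul_zero, zero_sub] at this
    linarith
  rcases le_total y l with h | h
  · have : AntitoneOn g (Set.Icc 0 l) := by
      refine antitoneOn_of_deriv_nonpos (convex_Icc 0 l) hcont.continuousOn
        (fun x _ => (hd x).differentiableAt.differentiableWithinAt) fun x hx => ?_
      rw [interior_Icc] at hx
      rw [hderiv, sub_nonpos, div_mul_eq_mul_div, div_le_iff₀ hl]
      linarith [mul_tanh_le hx.1.le hx.2.le]
    exact this ⟨hy, h⟩ ⟨hl.le, le_rfl⟩ h
  · have : MonotoneOn g (Set.Ici l) := by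
      refine monotoneOn_of_deriv_nonneg (convex_Ici l) hcont.continuousOn
        (fun x _ => (hd x).differentiableAt.differentiableWithinAt) fun x hx => ?_
      rw [interior_Ici] at hx
      rw [hderiv, sub_nonneg, div_mul_eq_mul_div, le_div_iff₀ hl]
      linarith [mul_tanh_le hl.le (le_of_lt hx)]
    exact this (Set.mem_Ici.mpr le_rfl) h h

lemma two_mul_le_exp (L : ℝ) : 2 * L ≤ Real.exp L := by
  have h := Real.add_one_le_exp (L - 1)
  have h2 : Real.exp (L - 1) * Real.exp 1 = Real.exp L := by rw [← Real.exp_add]; ring_nf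
  have h3 : (2 : ℝ) ≤ Real.exp 1 := by linarith [Real.add_one_le_exp (1 : ℝ)]
  have h4 := Real.exp_pos (L - 1)
  nlinarith

/-- Two-point case, parametrized by half the log-odds. -/
lemma two_point_of_pos {l y L : ℝ} (hl : 0 < l) (hL : 2 * l ≤ L) :
    Real.exp (Real.tanh l * y) * Real.cosh (y - l) / Real.cosh l ≤
      Real.exp (Real.exp L / L * (1 / (4 * Real.cosh l ^ 2)) * y ^ 2) := by
  have hL0 : 0 < L := by linarith
  have hc := Real.cosh_pos l
  have h1 : Real.log (Real.cosh (y - l)) ≤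
      Real.log (Real.cosh l) + Real.tanh l / (2 * l) * ((y - l) ^ 2 - l ^ 2) := by
    have := log_cosh_le hl (abs_nonneg (y - l))
    rwa [Real.cosh_abs, sq_abs] at this
  have h2 : Real.tanh l / (2 * l) ≤ Real.exp L / L * (1 / (4 * Real.cosh l ^ 2)) := by
    have h3 := mul_sinh_le (x := 2 * l) (by linarith) hL
    rw [Real.sinh_two_mul, Real.sinh_eq L] at h3
    rw [Real.tanh_eq_sinh_div_cosh, div_div, div_mul_div_comm,
      div_le_div_iff₀ (by positivity) (by positivity)]
    have h4 := Real.exp_pos (-L)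
    have h5 : 4 * (L * Real.sinh l * Real.cosh l) ≤ 2 * l * Real.exp L := by nlinarith
    nlinarith [mul_le_mul_of_nonneg_right h5 hc.le]
  have h6 : Real.tanh l * y + Real.tanh l / (2 * l) * ((y - l) ^ 2 - l ^ 2) =
      Real.tanh l / (2 * l) * y ^ 2 := by
    field_simp; ring
  have h7 := mul_le_mul_of_nonneg_right h2 (sq_nonneg y)
  calc _ = Real.exp (Real.tanh l * y + Real.log (Real.cosh (y - l)) - Real.log (Real.cosh l)) := by
        rw [Real.exp_sub, Real.exp_add, Real.exp_log (Real.cosh_pos _), Real.exp_log hc]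
    _ ≤ _ := Real.exp_le_exp.mpr (by linarith)

lemma two_point_aux {t s L : ℝ} (ht0 : 0 < t) (ht1 : t < 1 / 2) (hL : 1 - t ≤ Real.exp L * t) :
    t * Real.exp ((1 - t) * s) + (1 - t) * Real.exp (-t * s) ≤
      Real.exp (Real.exp L / (4 * L) * (t * (1 - t)) * s ^ 2) := by
  set l := Real.log ((1 - t) / t) / 2 with hl
  have hr : 1 < (1 - t) / t := by rw [one_lt_div ht0]; linarith
  have hl0 : 0 < l := by have := Real.log_pos hr; positivity
  have hlL : 2 * l ≤ L := by
    rw [hl, mul_div_cancel₀ _ (two_ne_zero), Real.log_le_iff_le_exp (by linarith),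
      div_le_iff₀ ht0]
    exact hL
  have hexp : Real.exp l ^ 2 = (1 - t) / t := by
    rw [← Real.exp_nat_mul, hl]; push_cast
    rw [mul_div_cancel₀ _ (two_ne_zero), Real.exp_log (by linarith)]
  have hE := Real.exp_pos l
  set E := Real.exp l with hEd
  have hEt : E ^ 2 * t = 1 - t := by rw [hexp]; field_simp
  have hcosh : Real.cosh l = (E + E⁻¹) / 2 := by rw [Real.cosh_eq, Real.exp_neg]
  have hcosh' : Real.cosh l = 1 / (2 * t * E) := by
    rw [hcosh]; field_simp; nlinarith
  have htanh : Real.tanh l = 1 - 2 * t := by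
    rw [Real.tanh_eq_sinh_div_cosh, hcosh', Real.sinh_eq, Real.exp_neg, ← hEd]
    field_simp; nlinarith
  have h := two_point_of_pos (y := s / 2) hl0 hlL
  have e1 : 1 / (4 * Real.cosh l ^ 2) = t * (1 - t) := by
    rw [hcosh', ← hEt]; field_simp; ring
  rw [e1] at h
  convert h using 1
  · rw [htanh, Real.cosh_eq, hcosh', neg_sub, Real.exp_sub, Real.exp_sub, ← hEd]
    have a1 : Real.exp ((1 - t) * s) = Real.exp ((1 - 2 * t) * (s / 2)) * Real.exp (s / 2) := by
      rw [← Real.exp_add]; ring_nf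
    have a2 : Real.exp (-t * s) = Real.exp ((1 - 2 * t) * (s / 2)) * (Real.exp (s / 2))⁻¹ := by
      rw [← Real.exp_neg, ← Real.exp_add]; ring_nf
    rw [a1, a2, ← hEt]
    have := Real.exp_pos (s / 2)
    field_simp
  · congr 1
    field_simp
    ring

lemma two_point {t s L : ℝ} (hL0 : 0 < L) (ht0 : 0 < t) (ht1 : t < 1)
    (hL : 1 - t ≤ Real.exp L * t) (hL' : t ≤ Real.exp L * (1 - t)) :
    t * Real.exp ((1 - t) * s) + (1 - t) * Real.exp (-t * s) ≤
      Real.exp (Real.exp L / (4 * L) * (t * (1 - t)) * s ^ 2) := by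
  rcases lt_trichotomy t (1 / 2) with h | h | h
  · exact two_point_aux ht0 h hL
  · subst h
    have h1 := Real.cosh_le_exp_half_sq (s / 2)
    rw [Real.cosh_eq] at h1
    calc _ = (Real.exp (s / 2) + Real.exp (-(s / 2))) / 2 := by ring_nf
      _ ≤ _ := h1
      _ ≤ _ := by
        refine Real.exp_le_exp.mpr ?_
        have h2 : 2 ≤ Real.exp L / L := by rw [le_div_iff₀ hL0]; exact two_mul_le_exp L
        have h3 : Real.exp L / (4 * L) = Real.exp L / L / 4 := by field_simp
        rw [h3]
        nlinarith [sq_nonneg s]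
  · have := two_point_aux (t := 1 - t) (s := -s) (L := L) (by linarith) (by linarith)
      (by linarith)
    convert this using 1
    · ring_nf
    · ring_nf

end TwoPoint

section LogSumExp

variable {q : ℕ}

/-- The gap in the logarithmic Sobolev type bound for the uniform measure on `q` points. -/
noncomputable def logSumExpGap (κ : ℝ) (a : Fin q → ℝ) : ℝ :=
  Real.log (∑ i, Real.exp (a i)) - Real.log q - (∑ i, a i) / q - κ * ∑ i, a i ^ 2

lemma sum_exp_pos (hq : 0 < q) (a : Fin q → ℝ) : 0 < ∑ i, Real.exp (a i) :=
  sum_pos (fun _ _ => Real.exp_pos _) ⟨⟨0, hq⟩, mem_univ _⟩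

lemma exists_logSumExpGap_max (hq : 0 < q) {κ : ℝ} (hκ : 0 < κ) :
    ∃ a : Fin q → ℝ, ∀ b : Fin q → ℝ, logSumExpGap κ b ≤ logSumExpGap κ a := by
  have hcont : Continuous (logSumExpGap (q := q) κ) := by
    unfold logSumExpGap
    refine Continuous.sub (Continuous.sub (Continuous.sub (Continuous.log ?_ fun a => ?_) ?_) ?_) ?_
    any_goals fun_prop
    exact (sum_exp_pos hq a).ne'
  refine hcont.exists_forall_ge' 0 ?_
  have hq' : (0 : ℝ) < q := by exact_mod_cast hq
  have h0 : logSumExpGap (q := q) κ 0 = 0 := by simp [logSumExpGap]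
  rw [h0]
  filter_upwards [(tendsto_norm_cocompact_atTop (E := Fin q → ℝ)).eventually_ge_atTop (2 / κ)]
    with a ha
  have hle : ∀ i, |a i| ≤ ‖a‖ := fun i => norm_le_pi_norm a i
  have h1 : Real.log (∑ i, Real.exp (a i)) ≤ Real.log q + ‖a‖ := by
    rw [Real.log_le_iff_le_exp (sum_exp_pos hq a), Real.exp_add, Real.exp_log hq']
    calc ∑ i, Real.exp (a i) ≤ ∑ _i : Fin q, Real.exp ‖a‖ :=
          sum_le_sum fun i _ => Real.exp_le_exp.mpr ((le_abs_self _).trans (hle i))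
      _ = q * Real.exp ‖a‖ := by simp
  have h2 : -‖a‖ ≤ (∑ i, a i) / q := by
    rw [le_div_iff₀ hq']
    calc -‖a‖ * q = ∑ _i : Fin q, -‖a‖ := by simp [mul_comm]
      _ ≤ _ := sum_le_sum fun i _ => (neg_le_neg (hle i)).trans (neg_abs_le _)
  have h3 : ‖a‖ ^ 2 ≤ ∑ i, a i ^ 2 := by
    have h4 : ‖a‖ ≤ √(∑ i, a i ^ 2) := by
      rw [pi_norm_le_iff_of_nonneg (Real.sqrt_nonneg _)]
      intro i
      rw [Real.norm_eq_abs]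
      refine Real.abs_le_sqrt ?_
      exact single_le_sum (f := fun i => a i ^ 2) (fun i _ => sq_nonneg _) (mem_univ i)
    calc ‖a‖ ^ 2 ≤ √(∑ i, a i ^ 2) ^ 2 := by gcongr
      _ = _ := Real.sq_sqrt (sum_nonneg fun i _ => sq_nonneg _)
  have h5 : 2 ≤ κ * ‖a‖ := by rwa [div_le_iff₀' hκ] at ha
  have h6 : κ * ‖a‖ ^ 2 ≤ κ * ∑ i, a i ^ 2 := by gcongr
  unfold logSumExpGap
  nlinarith [norm_nonneg a]

lemma logSumExpGap_critical (hq : 0 < q) {κ : ℝ} {a : Fin q → ℝ}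
    (ha : ∀ b : Fin q → ℝ, logSumExpGap κ b ≤ logSumExpGap κ a) (i : Fin q) :
    Real.exp (a i) / (∑ j, Real.exp (a j)) = 1 / q + 2 * κ * a i := by
  set S := ∑ j, Real.exp (a j) with hS
  have hS0 : 0 < S := sum_exp_pos hq a
  set f : ℝ → ℝ := fun x => Real.log (S - Real.exp (a i) + Real.exp x) - Real.log q
    - ((∑ j, a j) - a i + x) / q - κ * ((∑ j, a j ^ 2) - a i ^ 2 + x ^ 2) with hf
  have key : ∀ (g : ℝ → ℝ) (x : ℝ),
      ∑ j, g (Function.update a i x j) = (∑ j, g (a j)) - g (a i) + g x := by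
    intro g x
    rw [← add_sum_erase _ _ (mem_univ i),
      ← add_sum_erase (s := univ) (fun j => g (a j)) (mem_univ i)]
    rw [sum_congr rfl fun j hj => by rw [Function.update_of_ne (ne_of_mem_erase hj)]]
    simp only [Function.update_self]
    ring
  have hfe : ∀ x, f x = logSumExpGap κ (Function.update a i x) := by
    intro x
    simp only [hf, logSumExpGap]
    rw [key Real.exp x, key (fun y => y) x, key (fun y => y ^ 2) x]
  have hmax : IsLocalMax f (a i) := by
    refine Filter.Eventually.of_forall fun x => ?_
    rw [hfe, hfe, Function.update_eq_self]
    exact ha _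
  have hd : HasDerivAt f (Real.exp (a i) / S - 1 / q - κ * (2 * a i)) (a i) := by
    have e : S - Real.exp (a i) + Real.exp (a i) = S := by ring
    have h1 := ((((Real.hasDerivAt_exp (a i)).const_add (S - Real.exp (a i))).log
      (by rw [e]; exact hS0.ne')).sub_const (Real.log q)).sub
      (((hasDerivAt_id (a i)).const_add ((∑ j, a j) - a i)).div_const (q : ℝ))
    have h2 := h1.sub (((hasDerivAt_pow 2 (a i)).const_add
      ((∑ j, a j ^ 2) - a i ^ 2)).const_mul κ)
    refine h2.congr_deriv ?_
    rw [e]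
    norm_num
  have := hmax.hasDerivAt_eq_zero hd
  linarith

lemma exp_affine_three {x y z u v : ℝ} (hxy : x < y) (hyz : y < z) (hx : Real.exp x = u + v * x)
    (hy : Real.exp y = u + v * y) (hz : Real.exp z = u + v * z) : False := by
  have h := strictConvexOn_exp.slope_strict_mono_adjacent (Set.mem_univ x) (Set.mem_univ z) hxy hyz
  rw [hx, hy, hz] at h
  have h1 : (u + v * y - (u + v * x)) / (y - x) = v := by
    rw [div_eq_iff (by linarith)]; ring
  have h2 : (u + v * z - (u + v * y)) / (z - y) = v := by
    rw [div_eq_iff (by linarith)]; ring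
  rw [h1, h2] at h
  exact lt_irrefl _ h

lemma exp_affine_two {x y z u v : ℝ} (hx : Real.exp x = u + v * x)
    (hy : Real.exp y = u + v * y) (hz : Real.exp z = u + v * z) (hxy : x ≠ y) : z = x ∨ z = y := by
  by_contra! h
  obtain ⟨h1, h2⟩ := h
  rcases lt_or_gt_of_ne hxy with a | a <;> rcases lt_or_gt_of_ne h1 with b | b <;>
    rcases lt_or_gt_of_ne h2 with c | c
  · exact exp_affine_three b a hz hx hy
  · linarith
  · exact exp_affine_three b c hx hz hy
  · exact exp_affine_three a c hx hy hz
  · exact exp_affine_three c a hz hy hx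
  · exact exp_affine_three c b hy hz hx
  · linarith
  · exact exp_affine_three a b hy hx hz

/-- Sharp sub-Gaussian bound for the uniform distribution on `q` points. -/
lemma sum_exp_le (hq : 3 ≤ q) (b : Fin q → ℝ) :
    (∑ i, Real.exp (b i)) / q ≤ Real.exp ((∑ i, b i) / q +
      (q - 1) / (4 * q * Real.log (q - 1)) * ∑ i, b i ^ 2) := by
  have hq0 : 0 < q := by omega
  have hq' : (3 : ℝ) ≤ q := by exact_mod_cast hq
  set L := Real.log (q - 1) with hL
  have hL0 : 0 < L := Real.log_pos (by linarith)
  have hexpL : Real.exp L = q - 1 := Real.exp_log (by linarith)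
  set κ : ℝ := (q - 1) / (4 * q * L) with hκ
  have hκ0 : 0 < κ := div_pos (by linarith) (by positivity)
  suffices logSumExpGap κ b ≤ 0 by
    unfold logSumExpGap at this
    rw [div_le_iff₀ (by linarith), ← Real.exp_log (show (0 : ℝ) < q by linarith),
      ← Real.exp_add, ← Real.log_le_iff_le_exp (sum_exp_pos hq0 b),
      Real.exp_log (show (0 : ℝ) < q by linarith)]
    linarith
  obtain ⟨a, ha⟩ := exists_logSumExpGap_max hq0 hκ0
  refine (ha b).trans ?_
  have hcr := logSumExpGap_critical hq0 ha
  set S := ∑ j, Real.exp (a j) with hS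
  have hS0 : 0 < S := sum_exp_pos hq0 a
  have hsum : ∑ i, a i = 0 := by
    have h1 : ∑ i, Real.exp (a i) / S = ∑ i, (1 / (q : ℝ) + 2 * κ * a i) :=
      sum_congr rfl fun i _ => hcr i
    rw [← sum_div, ← hS, div_self hS0.ne', sum_add_distrib, ← mul_sum] at h1
    simp only [sum_const, card_univ, Fintype.card_fin, nsmul_eq_mul] at h1
    rw [mul_one_div_cancel (by linarith)] at h1
    have : 2 * κ * ∑ i, a i = 0 := by linarith
    rcases mul_eq_zero.mp this with h | h
    · linarith
    · exact h
  have haff : ∀ i, Real.exp (a i) = S / q + 2 * κ * S * a i := by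
    intro i
    have := hcr i
    rw [div_eq_iff hS0.ne'] at this
    rw [this]; ring
  by_cases hall : ∀ i j, a i = a j
  · have h0 : ∀ i, a i = 0 := by
      intro i
      have : ∑ j, a j = q * a i := by
        rw [sum_congr rfl fun j _ => hall j i]; simp
      rw [hsum] at this
      rcases mul_eq_zero.mp this.symm with h | h
      · linarith
      · exact h
    simp [logSumExpGap, h0]
  push Not at hall
  obtain ⟨i, j, hij⟩ := hall
  have htwo : ∀ l, a l = a i ∨ a l = a j := fun l =>
    exp_affine_two (haff i) (haff j) (haff l) hij
  set X := a i
  set Y := a j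
  set A := univ.filter fun l => a l = X with hA
  set m := A.card with hm
  have hm1 : 1 ≤ m := card_pos.mpr ⟨i, by simp [hA, X]⟩
  have hmq : m + 1 ≤ q := by
    have : A.card < (univ : Finset (Fin q)).card := by
      refine card_lt_card ?_
      rw [ssubset_univ_iff]
      intro h
      have : j ∈ A := by rw [h]; exact mem_univ j
      rw [hA, mem_filter] at this
      exact hij this.2.symm
    simpa using this
  have hsg : ∀ g : ℝ → ℝ, ∑ l, g (a l) = m * g X + (q - m) * g Y := by
    intro g
    rw [← sum_filter_add_sum_filter_not univ (fun l => a l = X)]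
    rw [sum_congr rfl (g := fun _ => g X) fun l hl => by rw [(mem_filter.mp hl).2],
      sum_congr (s₁ := univ.filter fun l => ¬ a l = X) rfl (g := fun _ => g Y) fun l hl => by
        rw [(htwo l).resolve_left (mem_filter.mp hl).2]]
    simp only [sum_const, nsmul_eq_mul]
    have h3 := card_filter_add_card_filter_not (s := (univ : Finset (Fin q))) (fun l => a l = X)
    simp only [card_univ, Fintype.card_fin] at h3
    have h4 : ((univ.filter fun l => ¬ a l = X).card : ℝ) = q - m := by
      rw [eq_sub_iff_add_eq, ← Nat.cast_add, hm, hA, add_comm, h3]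
    rw [h4]
  have hmr : (1 : ℝ) ≤ m := by exact_mod_cast hm1
  have hmr' : (m : ℝ) + 1 ≤ q := by exact_mod_cast hmq
  have e1 := hsg fun x => x
  rw [hsum] at e1
  set t : ℝ := m / q with ht
  have hqt : (m : ℝ) = q * t := by rw [ht]; field_simp
  have hq1 : (0 : ℝ) < q := by linarith
  have htX : t * X + (1 - t) * Y = 0 := by
    rw [hqt] at e1
    have : (q : ℝ) * (t * X + (1 - t) * Y) = 0 := by rw [e1]; ring
    rcases mul_eq_zero.mp this with h | h
    · linarith
    · exact h
  have hX : X = (1 - t) * (X - Y) := by linarith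
  have hY : Y = -t * (X - Y) := by linarith
  have ht0 : 0 < t := div_pos (by linarith) hq1
  have ht1 : t < 1 := by rw [ht, div_lt_one hq1]; linarith
  have h := two_point (t := t) (s := X - Y) hL0 ht0 ht1
    (by rw [hexpL]; nlinarith) (by rw [hexpL]; nlinarith)
  rw [← hX, ← hY] at h
  have hSe : S = q * (t * Real.exp X + (1 - t) * Real.exp Y) := by
    rw [hS, hsg Real.exp, hqt]; ring
  have hlog : Real.log S ≤ Real.log q + Real.exp L / (4 * L) * (t * (1 - t)) * (X - Y) ^ 2 := by
    rw [Real.log_le_iff_le_exp hS0, Real.exp_add, Real.exp_log hq1, hSe]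
    gcongr
  have hsq : κ * ∑ l, a l ^ 2 = Real.exp L / (4 * L) * (t * (1 - t)) * (X - Y) ^ 2 := by
    rw [hsg (fun x => x ^ 2), hexpL, hκ, hqt]
    have h7 : (q : ℝ) * t * X ^ 2 + (q - q * t) * Y ^ 2 = q * (t * (1 - t)) * (X - Y) ^ 2 := by
      nth_rewrite 1 [hX]
      nth_rewrite 2 [hY]
      ring
    rw [h7]
    field_simp
  unfold logSumExpGap
  rw [← hS, hsum, hsq]
  simp only [zero_div]
  linarith

end LogSumExp

section GaussianLinearization

open MeasureTheory ProbabilityTheory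

/-- The standard Gaussian measure on `ι → ℝ`. -/
noncomputable def stdGaussianPi (ι : Type*) [Fintype ι] : Measure (ι → ℝ) :=
  Measure.pi fun _ => gaussianReal 0 1

lemma integrable_exp_sq_gaussian {β : ℝ} (hβ : β < 1 / 2) :
    Integrable (fun x => Real.exp (β * x ^ 2)) (gaussianReal 0 1) := by
  rw [gaussianReal_of_var_ne_zero 0 one_ne_zero,
    integrable_withDensity_iff_integrable_smul' (measurable_gaussianPDF 0 1)
      (ae_of_all _ fun _ => gaussianPDF_lt_top)]
  have h : (fun x => (gaussianPDF 0 1 x).toReal • Real.exp (β * x ^ 2)) =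
      fun x => (√(2 * Real.pi))⁻¹ * Real.exp (-(1 / 2 - β) * x ^ 2) := by
    ext x
    rw [toReal_gaussianPDF, gaussianPDFReal]
    simp only [NNReal.coe_one, mul_one, sub_zero, smul_eq_mul]
    rw [mul_assoc, ← Real.exp_add]
    ring_nf
  rw [h]
  exact (integrable_exp_neg_mul_sq (by linarith)).const_mul _

variable {ι : Type*} [Fintype ι]

lemma integrable_exp_sum_sq {β : ℝ} (hβ : β < 1 / 2) :
    Integrable (fun g : ι → ℝ => Real.exp (β * ∑ i, g i ^ 2)) (stdGaussianPi ι) := by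
  have := Integrable.fintype_prod (ι := ι) (f := fun _ x => Real.exp (β * x ^ 2))
    (μ := fun _ => gaussianReal 0 1) fun _ => integrable_exp_sq_gaussian hβ
  refine this.congr (ae_of_all _ fun g => ?_)
  simp only [mul_sum, Real.exp_sum]

lemma integrable_exp_sum_mul (x : ι → ℝ) :
    Integrable (fun g : ι → ℝ => Real.exp (∑ i, x i * g i)) (stdGaussianPi ι) := by
  have := Integrable.fintype_prod (ι := ι) (f := fun i y => Real.exp (x i * y))
    (μ := fun _ => gaussianReal 0 1) fun i => integrable_exp_mul_gaussianReal (x i)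
  refine this.congr (ae_of_all _ fun g => ?_)
  simp only [Real.exp_sum]

lemma exp_half_sum_sq_eq (x : ι → ℝ) :
    Real.exp (∑ i, x i ^ 2 / 2) = ∫ g, Real.exp (∑ i, x i * g i) ∂(stdGaussianPi ι) := by
  simp only [Real.exp_sum, stdGaussianPi]
  rw [integral_fintype_prod_eq_prod (fun i y => Real.exp (x i * y))]
  refine prod_congr rfl fun i _ => ?_
  have := congrFun (mgf_id_gaussianReal (μ := 0) (v := 1)) (x i)
  simp only [mgf, id, zero_mul, zero_add, NNReal.coe_one, one_mul] at this
  exact this.symm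

end GaussianLinearization

section Overlap

open MeasureTheory

variable {n q : ℕ}

/-- Centered overlap of the color class `i` of `σ` with the color class `j` of `τ`. -/
noncomputable def overlapDev (σ τ : Fin n → Fin q) (i j : Fin q) : ℝ :=
  ∑ v, if σ v = i then (if τ v = j then (1 : ℝ) else 0) - 1 / q else 0

lemma sum_overlapDev_mul (σ τ : Fin n → Fin q) (g : Fin q × Fin q → ℝ) :
    ∑ x : Fin q × Fin q, overlapDev σ τ x.1 x.2 * g x =
      ∑ v, (g (σ v, τ v) - (∑ j, g (σ v, j)) / q) := by
  rw [Fintype.sum_prod_type]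
  simp only [overlapDev, sum_mul]
  calc _ = ∑ i, ∑ v, ∑ j, (if σ v = i then (if τ v = j then (1 : ℝ) else 0) - 1 / q else 0)
        * g (i, j) := sum_congr rfl fun i _ => sum_comm
    _ = ∑ v, ∑ i, ∑ j, (if σ v = i then (if τ v = j then (1 : ℝ) else 0) - 1 / q else 0)
        * g (i, j) := sum_comm
    _ = _ := by
      refine sum_congr rfl fun v _ => ?_
      rw [sum_eq_single (σ v) (fun i _ hi => sum_eq_zero fun j _ => by rw [if_neg hi.symm, zero_mul])
        (fun h => absurd (mem_univ _) h)]
      simp only [if_true, sub_mul, ite_mul, one_mul, zero_mul, sum_sub_distrib, sum_ite_eq,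
        mem_univ, ← mul_sum]
      ring

/-- Bound for the exponential moment of the overlap with a uniformly random coloring. -/
lemma sum_exp_overlap_le (hq : 3 ≤ q) {s β N : ℝ} (σ : Fin n → Fin q)
    (hσ : ∀ i, ((univ.filter fun v => σ v = i).card : ℝ) ≤ N)
    (hβ : (q - 1) / (4 * q * Real.log (q - 1)) * s ^ 2 * N ≤ β) (hβ' : β < 1 / 2) :
    ∑ τ : Fin n → Fin q, Real.exp (s ^ 2 / 2 * ∑ x : Fin q × Fin q, overlapDev σ τ x.1 x.2 ^ 2) ≤
      (q : ℝ) ^ n * ∫ g, Real.exp (β * ∑ x, g x ^ 2) ∂(stdGaussianPi (Fin q × Fin q)) := by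
  have hq' : (3 : ℝ) ≤ q := by exact_mod_cast hq
  have hL0 : 0 < Real.log ((q : ℝ) - 1) := Real.log_pos (by linarith)
  set κ : ℝ := (q - 1) / (4 * q * Real.log (q - 1)) with hκ
  have hκ0 : 0 < κ := div_pos (by linarith) (by positivity)
  have h1 : ∀ τ : Fin n → Fin q,
      Real.exp (s ^ 2 / 2 * ∑ x : Fin q × Fin q, overlapDev σ τ x.1 x.2 ^ 2) =
      ∫ g, Real.exp (∑ x : Fin q × Fin q, (s * overlapDev σ τ x.1 x.2) * g x)
        ∂(stdGaussianPi (Fin q × Fin q)) := by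
    intro τ
    rw [← exp_half_sum_sq_eq, mul_sum]
    congr 1
    exact sum_congr rfl fun x _ => by ring
  rw [sum_congr rfl fun τ _ => h1 τ, ← integral_finsetSum _ fun τ _ => integrable_exp_sum_mul _,
    ← integral_const_mul]
  refine integral_mono (integrable_finsetSum _ fun τ _ => integrable_exp_sum_mul _)
    ((integrable_exp_sum_sq hβ').const_mul _) fun g => ?_
  simp only
  set ψ : Fin n → Fin q → ℝ := fun v j => s * (g (σ v, j) - (∑ l, g (σ v, l)) / q) with hψ
  have h2 : ∀ τ : Fin n → Fin q, Real.exp (∑ x : Fin q × Fin q,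
      (s * overlapDev σ τ x.1 x.2) * g x) = ∏ v, Real.exp (ψ v (τ v)) := by
    intro τ
    rw [← Real.exp_sum]
    congr 1
    simp only [mul_assoc, ← mul_sum, hψ]
    rw [sum_overlapDev_mul]
  have h3 : ∀ v, ∑ j, Real.exp (ψ v j) ≤ q * Real.exp (κ * s ^ 2 * ∑ j, g (σ v, j) ^ 2) := by
    intro v
    have h := sum_exp_le hq (ψ v)
    rw [div_le_iff₀' (by linarith)] at h
    refine h.trans ?_
    have hz : ∑ i, ψ v i = 0 := by
      simp only [hψ, ← mul_sum, sum_sub_distrib, sum_const, card_univ, Fintype.card_fin,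
        nsmul_eq_mul]
      rw [mul_div_cancel₀ _ (by linarith), sub_self, mul_zero]
    rw [hz, zero_div, zero_add]
    have hv : ∑ i, ψ v i ^ 2 ≤ s ^ 2 * ∑ j, g (σ v, j) ^ 2 := by
      simp only [hψ, mul_pow, ← mul_sum]
      refine mul_le_mul_of_nonneg_left ?_ (sq_nonneg s)
      set m := (∑ l, g (σ v, l)) / q with hm
      have e : ∑ l, g (σ v, l) = q * m := by rw [hm]; field_simp
      calc ∑ i, (g (σ v, i) - m) ^ 2
          = ∑ i, g (σ v, i) ^ 2 - 2 * m * ∑ i, g (σ v, i) + q * m ^ 2 := by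
            simp only [sub_sq, sum_add_distrib, sum_sub_distrib, sum_const, card_univ,
              Fintype.card_fin, nsmul_eq_mul]
            congr 2
            rw [mul_sum]
            exact sum_congr rfl fun i _ => by ring
        _ ≤ _ := by rw [e]; nlinarith [sq_nonneg m]
    have := mul_le_mul_of_nonneg_left hv hκ0.le
    refine mul_le_mul_of_nonneg_left (Real.exp_le_exp.mpr ?_) (by linarith)
    rw [mul_assoc κ]
    exact this
  have h4 : ∑ v, ∑ j, g (σ v, j) ^ 2 ≤ N * ∑ x, g x ^ 2 := by
    rw [Fintype.sum_prod_type, mul_sum, ← sum_fiberwise univ σ]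
    refine sum_le_sum fun i _ => ?_
    rw [sum_congr rfl (g := fun _ => ∑ j, g (i, j) ^ 2) fun v hv => by
      rw [(mem_filter.mp hv).2], sum_const, nsmul_eq_mul]
    exact mul_le_mul_of_nonneg_right (hσ i) (sum_nonneg fun _ _ => sq_nonneg _)
  have h5 : 0 ≤ ∑ x, g x ^ 2 := sum_nonneg fun _ _ => sq_nonneg _
  calc ∑ τ : Fin n → Fin q, Real.exp (∑ x : Fin q × Fin q, (s * overlapDev σ τ x.1 x.2) * g x)
      = ∏ v, ∑ j, Real.exp (ψ v j) := by
        rw [sum_congr rfl fun τ _ => h2 τ, prod_univ_sum, Fintype.piFinset_univ]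
    _ ≤ ∏ v, ((q : ℝ) * Real.exp (κ * s ^ 2 * ∑ j, g (σ v, j) ^ 2)) :=
        prod_le_prod (fun v _ => sum_nonneg fun _ _ => (Real.exp_pos _).le) fun v _ => h3 v
    _ = (q : ℝ) ^ n * Real.exp (κ * s ^ 2 * ∑ v, ∑ j, g (σ v, j) ^ 2) := by
        rw [prod_mul_distrib, ← Real.exp_sum, ← mul_sum]; simp
    _ ≤ (q : ℝ) ^ n * Real.exp (β * ∑ x, g x ^ 2) := by
        have : κ * s ^ 2 * ∑ v, ∑ j, g (σ v, j) ^ 2 ≤ β * ∑ x, g x ^ 2 :=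
          calc _ ≤ κ * s ^ 2 * (N * ∑ x, g x ^ 2) := by gcongr
            _ = (κ * s ^ 2 * N) * ∑ x, g x ^ 2 := by ring
            _ ≤ _ := by gcongr
        gcongr

lemma sum_overlapDev_sq (σ τ : Fin n → Fin q) (hq : 0 < q) :
    ∑ x : Fin q × Fin q, overlapDev σ τ x.1 x.2 ^ 2 =
      ∑ u, ∑ v, (if σ u = σ v then (1 : ℝ) else 0) * ((if τ u = τ v then (1 : ℝ) else 0) - 1 / q) := by
  have h := sum_overlapDev_mul σ τ fun x => overlapDev σ τ x.1 x.2
  simp only [← pow_two] at h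
  rw [h]
  refine sum_congr rfl fun u _ => ?_
  simp only [overlapDev]
  rw [sum_comm, sum_div, ← sum_sub_distrib]
  refine sum_congr rfl fun v _ => ?_
  have hq' : (0 : ℝ) < q := by exact_mod_cast hq
  have e1 : (σ v = σ u) ↔ (σ u = σ v) := eq_comm
  have e2 : (τ v = τ u) ↔ (τ u = τ v) := eq_comm
  simp only [e1, e2]
  split_ifs with h1 h2 <;>
    simp [sum_sub_distrib] <;> field_simp <;> simp

lemma sum_same_color_ge (τ : Fin n → Fin q) :
    (n : ℝ) ^ 2 ≤ q * ∑ u, ∑ v, (if τ u = τ v then (1 : ℝ) else 0) := by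
  have h1 : ∑ j : Fin q, ∑ u, (if τ u = j then (1 : ℝ) else 0) = n := by
    rw [sum_comm]; simp
  have h2 : ∑ j : Fin q, (∑ u, (if τ u = j then (1 : ℝ) else 0)) ^ 2 =
      ∑ u, ∑ v, (if τ u = τ v then (1 : ℝ) else 0) := by
    simp only [pow_two, sum_mul_sum]
    rw [sum_comm]
    refine sum_congr rfl fun u _ => ?_
    rw [sum_comm]
    refine sum_congr rfl fun v _ => ?_
    simp [eq_comm]
  have h3 := sq_sum_le_card_mul_sum_sq (s := (univ : Finset (Fin q)))
    (f := fun j => ∑ u, (if τ u = j then (1 : ℝ) else 0))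
  rw [h1, h2] at h3
  simpa using h3

lemma sum_pairSet_symm (f : Fin n × Fin n → ℝ) (hf : ∀ u v, f (u, v) = f (v, u))
    (hd : ∀ u, 0 ≤ f (u, u)) : 2 * ∑ e ∈ pairSet n, f e ≤ ∑ u, ∑ v, f (u, v) := by
  have h1 : ∑ e ∈ pairSet n, f e = ∑ u, ∑ v, if u < v then f (u, v) else 0 := by
    rw [pairSet, sum_filter, Fintype.sum_prod_type]
  have h2 : ∑ e ∈ pairSet n, f e = ∑ u, ∑ v, if v < u then f (u, v) else 0 := by
    rw [h1, sum_comm]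
    exact sum_congr rfl fun u _ => sum_congr rfl fun v _ => by rw [hf]
  rw [two_mul]
  nth_rewrite 1 [h1]
  rw [h2, ← sum_add_distrib]
  refine sum_le_sum fun u _ => ?_
  rw [← sum_add_distrib]
  refine sum_le_sum fun v _ => ?_
  rcases lt_trichotomy u v with h | h | h
  · simp [h, h.not_gt]
  · subst h; simpa using hd u
  · simp [h, h.not_gt]

lemma sum_edgeCoef_mul_le (hq : 2 ≤ q) (σ τ : Fin n → Fin q) :
    ∑ e ∈ pairSet n, edgeCoef σ e * edgeCoef τ e ≤
      (q : ℝ) ^ 2 / (2 * ((q : ℝ) - 1) ^ 2) *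
        ∑ x : Fin q × Fin q, overlapDev σ τ x.1 x.2 ^ 2 := by
  have hq' : (2 : ℝ) ≤ q := by exact_mod_cast hq
  have hq1 : (0 : ℝ) < (q : ℝ) - 1 := by linarith
  have h1 := sum_pairSet_symm (fun e : Fin n × Fin n => edgeCoef σ e * edgeCoef τ e)
    (fun u v => by simp only [edgeCoef, eq_comm]) (fun u => by simp [edgeCoef])
  have h2 : ∀ u v, edgeCoef σ (u, v) * edgeCoef τ (u, v) = ((q : ℝ) ^ 2 *
      ((if σ u = σ v then (1 : ℝ) else 0) * ((if τ u = τ v then (1 : ℝ) else 0) - 1 / q)) -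
      (q * (if τ u = τ v then (1 : ℝ) else 0) - 1)) / ((q : ℝ) - 1) ^ 2 := by
    intro u v
    simp only [edgeCoef]
    split_ifs <;> field_simp <;> ring
  have h3 : ∑ u, ∑ v, edgeCoef σ (u, v) * edgeCoef τ (u, v) =
      ((q : ℝ) ^ 2 * ∑ x : Fin q × Fin q, overlapDev σ τ x.1 x.2 ^ 2 -
        (q * ∑ u, ∑ v, (if τ u = τ v then (1 : ℝ) else 0) - (n : ℝ) ^ 2)) / ((q : ℝ) - 1) ^ 2 := by
    simp only [h2, ← sum_div, sum_sub_distrib, ← mul_sum]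
    rw [sum_overlapDev_sq σ τ (by omega)]
    simp [pow_two]
  have h4 := sum_same_color_ge τ
  have h5 : ∑ u, ∑ v, edgeCoef σ (u, v) * edgeCoef τ (u, v) ≤
      ((q : ℝ) ^ 2 * ∑ x : Fin q × Fin q, overlapDev σ τ x.1 x.2 ^ 2) / ((q : ℝ) - 1) ^ 2 := by
    rw [h3]
    gcongr
    linarith
  calc _ ≤ ((q : ℝ) ^ 2 * ∑ x : Fin q × Fin q, overlapDev σ τ x.1 x.2 ^ 2) /
        ((q : ℝ) - 1) ^ 2 / 2 := by linarith
    _ = _ := by field_simp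

/-- Bound for the second moment over balanced colorings. -/
lemma second_moment_le (hq : 3 ≤ q) {l β N : ℝ} (hl0 : 0 ≤ l) (hl1 : l ≤ 1)
    (B : Finset (Fin n → Fin q))
    (hB : ∀ σ ∈ B, ∀ i, ((univ.filter fun v => σ v = i).card : ℝ) ≤ N)
    (hβ : l * q * N / (4 * (q - 1) * Real.log (q - 1)) ≤ β) (hβ' : β < 1 / 2) :
    (∑ σ ∈ B, ∑ τ ∈ B, ∏ e ∈ pairSet n, (1 + l * (edgeCoef σ e * edgeCoef τ e))) /
      ((q : ℝ) ^ n) ^ 2 ≤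
      ∫ g, Real.exp (β * ∑ x, g x ^ 2) ∂(stdGaussianPi (Fin q × Fin q)) := by
  have hq' : (3 : ℝ) ≤ q := by exact_mod_cast hq
  have hL0 : 0 < Real.log ((q : ℝ) - 1) := Real.log_pos (by linarith)
  set I := ∫ g, Real.exp (β * ∑ x, g x ^ 2) ∂(stdGaussianPi (Fin q × Fin q))
  have hI : 0 ≤ I := integral_nonneg fun _ => (Real.exp_pos _).le
  set s := √(l * q ^ 2 / (q - 1) ^ 2) with hs
  have hs2 : s ^ 2 = l * q ^ 2 / (q - 1) ^ 2 := Real.sq_sqrt (by positivity)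
  have hfac : ∀ σ τ : Fin n → Fin q, ∀ e, |edgeCoef σ e * edgeCoef τ e| ≤ 1 := by
    intro σ τ e
    rw [abs_mul]
    exact mul_le_one₀ (abs_edgeCoef_le_one (by omega) σ e) (abs_nonneg _)
      (abs_edgeCoef_le_one (by omega) τ e)
  have hpt : ∀ σ τ : Fin n → Fin q, ∏ e ∈ pairSet n, (1 + l * (edgeCoef σ e * edgeCoef τ e)) ≤
      Real.exp (s ^ 2 / 2 * ∑ x : Fin q × Fin q, overlapDev σ τ x.1 x.2 ^ 2) := by
    intro σ τ
    calc _ ≤ ∏ e ∈ pairSet n, Real.exp (l * (edgeCoef σ e * edgeCoef τ e)) := by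
          refine prod_le_prod (fun e _ => ?_) fun e _ => ?_
          · have := (abs_le.mp (hfac σ τ e)).1
            nlinarith
          · rw [add_comm]; exact Real.add_one_le_exp _
      _ = Real.exp (l * ∑ e ∈ pairSet n, edgeCoef σ e * edgeCoef τ e) := by
          rw [← Real.exp_sum, mul_sum]
      _ ≤ _ := by
          refine Real.exp_le_exp.mpr ?_
          have := mul_le_mul_of_nonneg_left (sum_edgeCoef_mul_le (by omega) σ τ) hl0
          refine this.trans (le_of_eq ?_)
          rw [hs2]
          field_simp
  have hβ2 : (q - 1) / (4 * q * Real.log (q - 1)) * s ^ 2 * N ≤ β := by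
    refine le_trans (le_of_eq ?_) hβ
    have hq1 : (0 : ℝ) < (q : ℝ) - 1 := by linarith
    rw [hs2]
    field_simp
  have hBc : (B.card : ℝ) ≤ (q : ℝ) ^ n := by
    have := card_le_univ B
    rw [Fintype.card_fun, Fintype.card_fin, Fintype.card_fin] at this
    exact_mod_cast this
  rw [div_le_iff₀ (by positivity)]
  calc _ ≤ ∑ σ ∈ B, ∑ τ : Fin n → Fin q,
        Real.exp (s ^ 2 / 2 * ∑ x : Fin q × Fin q, overlapDev σ τ x.1 x.2 ^ 2) := by
        refine sum_le_sum fun σ _ => (sum_le_sum fun τ _ => hpt σ τ).trans ?_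
        exact sum_le_sum_of_subset_of_nonneg (subset_univ _) fun _ _ _ => (Real.exp_pos _).le
    _ ≤ ∑ _σ ∈ B, (q : ℝ) ^ n * I :=
        sum_le_sum fun σ hσ => sum_exp_overlap_le hq σ (hB σ hσ) hβ2 hβ'
    _ = B.card * ((q : ℝ) ^ n * I) := by rw [sum_const, nsmul_eq_mul]
    _ ≤ (q : ℝ) ^ n * ((q : ℝ) ^ n * I) := by gcongr
    _ = _ := by ring

end Overlap

section Balanced

/-- The colorings all of whose color classes have at most `(1 + ε) n / q` vertices. -/
noncomputable def balancedColorings (n q : ℕ) (ε : ℝ) : Finset (Fin n → Fin q) :=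
  univ.filter fun σ => ∀ i, ((univ.filter fun v => σ v = i).card : ℝ) ≤ (1 + ε) * n / q

variable {n q : ℕ}

lemma card_large_class_le (hq : 0 < q) {ε : ℝ} (hε0 : 0 < ε) (hε1 : ε ≤ 1) (i : Fin q) :
    ((univ.filter fun σ : Fin n → Fin q =>
      (1 + ε) * n / q < ((univ.filter fun v => σ v = i).card : ℝ)).card : ℝ) ≤
      (q : ℝ) ^ n * Real.exp (-(ε ^ 2 / (4 * q)) * n) := by
  have hq' : (0 : ℝ) < q := by exact_mod_cast hq
  set s := ε / 2 with hs
  have h1 : ∀ σ : Fin n → Fin q, (if (1 + ε) * n / q <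
      ((univ.filter fun v => σ v = i).card : ℝ) then (1 : ℝ) else 0) ≤
      (∏ v, Real.exp (if σ v = i then s else 0)) * Real.exp (-(s * ((1 + ε) * n / q))) := by
    intro σ
    rw [← Real.exp_sum, ← Real.exp_add, ← sum_filter, sum_const, nsmul_eq_mul]
    split_ifs with h
    · rw [Real.one_le_exp_iff]
      nlinarith
    · exact (Real.exp_pos _).le
  have h2 : ∑ j : Fin q, Real.exp (if j = i then s else 0) ≤ q * Real.exp ((s + s ^ 2) / q) := by
    have : ∀ j : Fin q, Real.exp (if j = i then s else 0) =
        1 + if j = i then Real.exp s - 1 else 0 := fun j => by split_ifs <;> simp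
    simp only [this, sum_add_distrib, sum_const, card_univ, Fintype.card_fin, nsmul_eq_mul,
      mul_one, sum_ite_eq', mem_univ, if_true]
    have h3 : Real.exp s ≤ 1 + s + s ^ 2 := by
      have := Real.abs_exp_sub_one_sub_id_le (x := s) (by rw [abs_le]; constructor <;> linarith)
      linarith [(abs_le.mp this).2]
    have h4 := Real.add_one_le_exp ((s + s ^ 2) / q)
    calc (q : ℝ) + (Real.exp s - 1) ≤ q * ((s + s ^ 2) / q + 1) := by
          rw [mul_add, mul_div_cancel₀ _ hq'.ne']; linarith
      _ ≤ _ := by gcongr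
  calc _ = ∑ σ : Fin n → Fin q, (if (1 + ε) * n / q <
      ((univ.filter fun v => σ v = i).card : ℝ) then (1 : ℝ) else 0) := by rw [sum_boole]
    _ ≤ ∑ σ : Fin n → Fin q, (∏ v, Real.exp (if σ v = i then s else 0)) *
        Real.exp (-(s * ((1 + ε) * n / q))) := sum_le_sum fun σ _ => h1 σ
    _ = (∑ j : Fin q, Real.exp (if j = i then s else 0)) ^ n *
        Real.exp (-(s * ((1 + ε) * n / q))) := by
        rw [← sum_mul, Fintype.sum_pow]
    _ ≤ (q * Real.exp ((s + s ^ 2) / q)) ^ n * Real.exp (-(s * ((1 + ε) * n / q))) := by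
        gcongr
    _ = _ := by
        rw [mul_pow, ← Real.exp_nat_mul, mul_assoc, ← Real.exp_add, hs]
        congr 2
        field_simp
        ring

lemma card_balancedColorings_compl_le (hq : 0 < q) {ε : ℝ} (hε0 : 0 < ε) (hε1 : ε ≤ 1) :
    ((balancedColorings n q ε)ᶜ.card : ℝ) / (q : ℝ) ^ n ≤
      q * Real.exp (-(ε ^ 2 / (4 * q)) * n) := by
  have hq' : (0 : ℝ) < q := by exact_mod_cast hq
  rw [div_le_iff₀ (by positivity)]
  have h1 : (balancedColorings n q ε)ᶜ ⊆ univ.biUnion fun i => univ.filter fun σ : Fin n → Fin q =>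
      (1 + ε) * n / q < ((univ.filter fun v => σ v = i).card : ℝ) := by
    intro σ hσ
    simpa [balancedColorings] using hσ
  calc ((balancedColorings n q ε)ᶜ.card : ℝ) ≤ ∑ i : Fin q, ((univ.filter fun σ : Fin n → Fin q =>
      (1 + ε) * n / q < ((univ.filter fun v => σ v = i).card : ℝ)).card : ℝ) := by
        exact_mod_cast (card_le_card h1).trans card_biUnion_le
    _ ≤ ∑ _i : Fin q, (q : ℝ) ^ n * Real.exp (-(ε ^ 2 / (4 * q)) * n) :=
        sum_le_sum fun i _ => card_large_class_le hq hε0 hε1 i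
    _ = _ := by simp; ring

lemma card_balancedColorings_add :
    ((balancedColorings n q ε).card : ℝ) + (balancedColorings n q ε)ᶜ.card = (q : ℝ) ^ n := by
  have := card_add_card_compl (balancedColorings n q ε)
  rw [Fintype.card_fun, Fintype.card_fin, Fintype.card_fin] at this
  exact_mod_cast this

end Balanced

section Assembly

/-- Weighted total of the colorability probabilities after deleting few vertices. -/
noncomputable def colPotential (n q K : ℕ) (a : ℝ) : ℝ :=
  ∑ W ∈ univ.filter (fun W : Finset (Fin n) => W.card ≤ K), ((n : ℝ)⁻¹) ^ W.card * offCol q W (a / n)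

variable {n q : ℕ}

lemma sum_inv_pow_card_le (n K : ℕ) :
    ∑ W ∈ univ.filter (fun W : Finset (Fin n) => W.card ≤ K), ((n : ℝ)⁻¹) ^ W.card ≤ K + 1 := by
  rw [← sum_fiberwise_of_maps_to (g := Finset.card) (t := range (K + 1))
    (by intro W hW; rw [mem_filter] at hW; rw [mem_range]; omega)]
  calc _ ≤ ∑ _w ∈ range (K + 1), (1 : ℝ) := by
        refine sum_le_sum fun w _ => ?_
        calc _ ≤ ∑ W ∈ powersetCard w (univ : Finset (Fin n)), ((n : ℝ)⁻¹) ^ w := by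
              rw [sum_congr rfl (g := fun _ => ((n : ℝ)⁻¹) ^ w) fun W hW => by
                rw [(mem_filter.mp hW).2]]
              refine sum_le_sum_of_subset_of_nonneg (fun W hW => ?_) fun _ _ _ => by positivity
              rw [mem_powersetCard]
              exact ⟨subset_univ _, (mem_filter.mp hW).2⟩
          _ = n.choose w * ((n : ℝ)⁻¹) ^ w := by
              rw [sum_const, card_powersetCard, nsmul_eq_mul, card_univ, Fintype.card_fin]
          _ ≤ (n : ℝ) ^ w * ((n : ℝ)⁻¹) ^ w := by
              gcongr
              exact_mod_cast Nat.choose_le_pow n w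
          _ ≤ 1 := by
              rw [← mul_pow]
              exact pow_le_one₀ (by positivity) mul_inv_le_one
    _ = K + 1 := by simp

lemma colPotential_nonneg {K : ℕ} {a : ℝ} (h0 : 0 ≤ a) (h1 : a / n ≤ 1) :
    0 ≤ colPotential n q K a :=
  sum_nonneg fun W _ => mul_nonneg (by positivity)
    (selectionExp_nonneg (isProbVec_probOn _ (by positivity) h1) fun T => colInd_nonneg T)

lemma colPotential_le {K : ℕ} {a : ℝ} (h0 : 0 ≤ a) (h1 : a / n ≤ 1) :
    colPotential n q K a ≤ K + 1 := by
  refine le_trans (sum_le_sum fun W _ => ?_) (sum_inv_pow_card_le n K)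
  exact mul_le_of_le_one_right (by positivity)
    (selectionExp_le_one (isProbVec_probOn _ (by positivity) h1) fun T => colInd_le_one T)

lemma exists_small_step {J K : ℕ} (hJ : 0 < J) {a η : ℝ} (h0 : 0 ≤ a) (hη : 0 < η)
    (h1 : (a + J * η) / n ≤ 1) :
    ∃ j < J, colPotential n q K (a + j * η) - colPotential n q K (a + (j + 1 : ℕ) * η) ≤
      (K + 1) / J := by
  have hJ' : (0 : ℝ) < J := by exact_mod_cast hJ
  by_contra! h
  have h2 : ∑ j ∈ range J, ((K : ℝ) + 1) / J < ∑ j ∈ range J,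
      (colPotential n q K (a + j * η) - colPotential n q K (a + (j + 1 : ℕ) * η)) :=
    sum_lt_sum_of_nonempty ⟨0, mem_range.mpr hJ⟩ fun j hj => h j (mem_range.mp hj)
  rw [sum_range_sub' (fun j : ℕ => colPotential n q K (a + j * η)), sum_const, card_range,
    nsmul_eq_mul, mul_div_cancel₀ _ hJ'.ne'] at h2
  have h3 := colPotential_nonneg (n := n) (q := q) (K := K) (a := a + J * η) (by positivity) h1
  have h4 := colPotential_le (n := n) (q := q) (K := K) (a := a + (0 : ℕ) * η) (by simpa)
    (le_trans (by gcongr) h1)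
  linarith

/-- Estimate for the non-colorability probability at a fixed edge density. -/
lemma prob_not_colorable_le (hn : 0 < n) (hq : 3 ≤ q) {ε β l : ℝ} (hε0 : 0 < ε) (hε1 : ε ≤ 1)
    (hl : 1 ≤ l) (K : ℕ) {a a' M θ C : ℝ} (ha : 0 ≤ a) (haa : a ≤ a') (hM : a' ≤ M) (hM1 : 1 ≤ M)
    (hθ : 0 < θ) (hC : 0 < C) (hpn : 2 * M / n ≤ 1)
    (hβ : l * ((a / n) / (1 - a / n)) * q * ((1 + ε) * n / q) / (4 * (q - 1) * Real.log (q - 1)) ≤ β)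
    (hβ' : β < 1 / 2) (hl2 : l * ((a / n) / (1 - a / n)) ≤ 1)
    (hB : (q : ℝ) * Real.exp (-(ε ^ 2 / (4 * q)) * n) ≤ 1 / 2)
    (hplant : ∀ W : Finset (Fin n), W.card ≤ K → ∀ S : Finset (Fin n × Fin n),
      (∀ e ∈ S, e.1 ∈ W ∧ e.2 ∈ W) → PairColorable q S →
      plantEffect q S (a / n) ≤ θ + C * (offCol q W (a / n) - offCol q W (a' / n))) :
    selectionExp (probOn (pairSet n) (a / n)) (fun T => 1 - colInd q T) ≤
      2 * ((q : ℝ) * Real.exp (-(ε ^ 2 / (4 * q)) * n) * ((n : ℝ) ^ K * Real.exp (2 * M)) +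
        2 ^ (K ^ 2) * (2 * M) ^ K * ((2 * M / n + θ) * (K + 1) +
          C * (colPotential n q K a - colPotential n q K a')) +
        √((∫ g, Real.exp (β * ∑ x, g x ^ 2) ∂(stdGaussianPi (Fin q × Fin q))) / l ^ K)) := by
  have hn' : (0 : ℝ) < n := by exact_mod_cast hn
  have hq' : (3 : ℝ) ≤ q := by exact_mod_cast hq
  set p := a / n with hp
  have hp0 : 0 ≤ p := by positivity
  have hpM : p ≤ M / n := by rw [hp]; gcongr; linarith
  have hp2 : 2 * p ≤ 1 := by
    calc 2 * p ≤ 2 * (M / n) := by gcongr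
      _ = 2 * M / n := by ring
      _ ≤ 1 := hpn
  have hp1 : p < 1 := by linarith
  have hp' : a' / n ≤ 1 := by
    have : a' / n ≤ 2 * M / n := by gcongr; linarith
    linarith
  set B := balancedColorings n q ε with hBdef
  have hcomp := card_balancedColorings_compl_le (n := n) (q := q) (by omega) hε0 hε1
  rw [← hBdef] at hcomp
  have hqn : (0 : ℝ) < (q : ℝ) ^ n := by positivity
  have hBhalf : 1 / 2 ≤ colorCoef B ∅ := by
    rw [colorCoef_empty]
    have h := card_balancedColorings_add (n := n) (q := q) (ε := ε)
    rw [← hBdef] at h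
    have h2 : (B.card : ℝ) / (q : ℝ) ^ n = 1 - (Bᶜ.card : ℝ) / (q : ℝ) ^ n := by
      rw [eq_sub_iff_add_eq, ← add_div, h, div_self hqn.ne']
    rw [h2]; linarith
  set X := selectionExp (probOn (pairSet n) p) (fun T => 1 - colInd q T) with hX
  have hX0 : 0 ≤ X := selectionExp_nonneg (isProbVec_probOn _ hp0 hp1.le)
    fun T => sub_nonneg.mpr (colInd_le_one T)
  set Δ : Finset (Fin n) → ℝ := fun W => offCol q W p - offCol q W (a' / n) with hΔ
  have hΔ0 : ∀ W, 0 ≤ Δ W := fun W => sub_nonneg.mpr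
    (selectionExp_antitone_prob _ hp0 (by rw [hp]; gcongr) hp')
  have hlow := low_degree_le hn hq B K hp0 hp2 (R := fun W => θ + C * Δ W) fun W hW =>
    ⟨by have := hΔ0 W; positivity, hplant W hW⟩
  have hmain := colorCoef_mul_prob_le B K hp0 hp1 hl
  rw [sum_colorCoef_sq] at hmain
  have hsec := second_moment_le hq (l := l * (p / (1 - p))) (N := (1 + ε) * n / q)
    (mul_nonneg (by linarith) (div_nonneg hp0 (by linarith))) hl2 B
    (fun σ hσ => (mem_filter.mp hσ).2) hβ hβ'
  have hsqrt := Real.sqrt_le_sqrt (div_le_div_of_nonneg_right hsec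
    (show 0 ≤ l ^ K by positivity))
  have h1 : (Bᶜ.card : ℝ) / (q : ℝ) ^ n * ((n : ℝ) ^ K * Real.exp (2 * p * n)) ≤
      (q : ℝ) * Real.exp (-(ε ^ 2 / (4 * q)) * n) * ((n : ℝ) ^ K * Real.exp (2 * M)) := by
    have : 2 * p * n ≤ 2 * M := by
      rw [hp, mul_assoc, div_mul_cancel₀ _ hn'.ne']; linarith
    gcongr
  have h2 : ∑ W ∈ univ.filter (fun W : Finset (Fin n) => W.card ≤ K),
      2 ^ (K ^ 2) * ((2 * p) ^ W.card * (2 * p + (θ + C * Δ W))) ≤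
      2 ^ (K ^ 2) * (2 * M) ^ K * ((2 * M / n + θ) * (K + 1) +
          C * (colPotential n q K a - colPotential n q K a')) := by
    calc _ ≤ ∑ W ∈ univ.filter (fun W : Finset (Fin n) => W.card ≤ K),
          2 ^ (K ^ 2) * ((2 * M) ^ K * ((n : ℝ)⁻¹) ^ W.card * (2 * M / n + θ + C * Δ W)) := by
          refine sum_le_sum fun W hW => ?_
          have hW := (mem_filter.mp hW).2
          have e1 : (2 * p) ^ W.card ≤ (2 * M) ^ K * ((n : ℝ)⁻¹) ^ W.card := by
            calc (2 * p) ^ W.card ≤ (2 * M * (n : ℝ)⁻¹) ^ W.card := by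
                  refine pow_le_pow_left₀ (by positivity) ?_ _
                  rw [mul_assoc, ← div_eq_mul_inv]; gcongr
              _ = (2 * M) ^ W.card * ((n : ℝ)⁻¹) ^ W.card := mul_pow _ _ _
              _ ≤ _ := by gcongr; linarith
          have e2 : 2 * p + (θ + C * Δ W) ≤ 2 * M / n + θ + C * Δ W := by
            have : 2 * p ≤ 2 * M / n := by rw [mul_div_assoc]; gcongr
            linarith
          have := hΔ0 W
          gcongr
      _ = 2 ^ (K ^ 2) * (2 * M) ^ K * ((2 * M / n + θ) *
            (∑ W ∈ univ.filter (fun W : Finset (Fin n) => W.card ≤ K), ((n : ℝ)⁻¹) ^ W.card) +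
          C * (colPotential n q K a - colPotential n q K a')) := by
          simp only [colPotential]
          rw [← sum_sub_distrib, mul_sum, mul_sum, ← sum_add_distrib, mul_sum]
          refine sum_congr rfl fun W _ => ?_
          simp only [hΔ]
          ring
      _ ≤ _ := by
          have := sum_inv_pow_card_le n K
          gcongr
  have h3 : 1 / 2 * X ≤ colorCoef B ∅ * X := by gcongr
  linarith

lemma tendsto_exp_mul_pow (c : ℝ) (hc : 0 < c) (K : ℕ) :
    Tendsto (fun n : ℕ => Real.exp (-c * n) * (n : ℝ) ^ K) atTop (nhds 0) := by
  have h := (Real.tendsto_pow_mul_exp_neg_atTop_nhds_zero K).comp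
    ((tendsto_natCast_atTop_atTop (R := ℝ)).const_mul_atTop hc)
  have h2 := h.const_mul ((c ^ K)⁻¹)
  rw [mul_zero] at h2
  refine h2.congr fun n => ?_
  simp only [Function.comp, mul_pow]
  field_simp

lemma overlap_rate_le {n q L ε d y : ℝ} (hn : 0 < n) (hq : 1 < q) (hL : 0 < L) (hε : 0 ≤ ε)
    (hy : y ≤ (1 + ε) * (d / n)) :
    (1 + ε) * y * q * ((1 + ε) * n / q) / (4 * (q - 1) * L) ≤
      (1 + ε) ^ 3 * (d / (2 * (q - 1) * L)) / 2 := by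
  have hq1 : 0 < q - 1 := by linarith
  calc (1 + ε) * y * q * ((1 + ε) * n / q) / (4 * (q - 1) * L)
      ≤ (1 + ε) * ((1 + ε) * (d / n)) * q * ((1 + ε) * n / q) / (4 * (q - 1) * L) := by gcongr
    _ = _ := by
        field_simp
        norm_num

lemma odds_le {ε x y z : ℝ} (hε : 0 < ε) (hx0 : 0 ≤ x) (hxy : x ≤ y) (hxz : x ≤ z)
    (hz : z * (1 + 1 / ε) ≤ 1) : x / (1 - x) ≤ (1 + ε) * y := by
  have h1 : x * (1 + 1 / ε) ≤ 1 := le_trans (by gcongr) hz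
  have h2 : x * (1 + ε) ≤ ε := by
    calc x * (1 + ε) = x * (1 + 1 / ε) * ε := by field_simp; ring
      _ ≤ 1 * ε := by gcongr
      _ = ε := one_mul ε
  have h3 : 0 < 1 - x := by nlinarith
  rw [div_le_iff₀ h3]
  nlinarith

lemma exists_slack {r : ℝ} (hr0 : 0 < r) (hr1 : r < 1) :
    ∃ ε : ℝ, 0 < ε ∧ ε ≤ 1 ∧ (1 + ε) ^ 3 * r / 2 < 1 / 2 := by
  refine ⟨(1 - r) / 7, by linarith, by linarith, ?_⟩
  set ε := (1 - r) / 7 with hε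
  have hε0 : 0 < ε := by linarith
  have hε1 : ε ≤ 1 := by linarith
  have h1 : (1 + ε) ^ 3 ≤ 1 + 7 * ε := by nlinarith [mul_nonneg hε0.le hε0.le]
  have h2 : (1 + 7 * ε) * r < 1 := by rw [hε]; nlinarith
  nlinarith

set_option maxHeartbeats 400000 in
/-- With high probability `G(n, d/n)` is `q`-colorable when `d < 2 (q - 1) log (q - 1)`. -/
theorem tendsto_prob_not_colorable (hq : 3 ≤ q) {d : ℝ} (hd0 : 0 ≤ d)
    (hd : d < 2 * (q - 1) * Real.log (q - 1)) :
    Tendsto (fun n : ℕ => selectionExp (probOn (pairSet n) (d / n)) (fun T => 1 - colInd q T))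
      atTop (nhds 0) := by
  have hq' : (3 : ℝ) ≤ q := by exact_mod_cast hq
  have hL0 : 0 < Real.log ((q : ℝ) - 1) := Real.log_pos (by linarith)
  set c₀ := 2 * ((q : ℝ) - 1) * Real.log (q - 1) with hc₀
  have hc0 : 0 < c₀ := by rw [hc₀]; have : (0 : ℝ) < q - 1 := by linarith
                          positivity
  set d₁ := (d + c₀) / 2 with hd₁
  have hdd₁ : d < d₁ := by rw [hd₁]; linarith
  have hd₁c : d₁ < c₀ := by rw [hd₁]; linarith
  have hd₁0 : 0 < d₁ := by linarith
  set r := d₁ / c₀ with hr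
  have hr1 : r < 1 := by rw [hr, div_lt_one hc0]; exact hd₁c
  have hr0 : 0 < r := by positivity
  obtain ⟨ε, hε0, hε1, hβ'⟩ := exists_slack hr0 hr1
  set β := (1 + ε) ^ 3 * r / 2 with hβ
  set I := ∫ g, Real.exp (β * ∑ x, g x ^ 2) ∂(stdGaussianPi (Fin q × Fin q)) with hI
  set M := 1 + d₁ with hM
  have hM0 : 0 < M := by linarith
  clear_value M d₁
  rw [Metric.tendsto_atTop]
  intro δ hδ
  obtain ⟨K, hK⟩ : ∃ K : ℕ, √(I / (1 + ε) ^ K) ≤ δ / 16 := by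
    have ht : Tendsto (fun K : ℕ => √(I / (1 + ε) ^ K)) atTop (nhds 0) := by
      have := (tendsto_const_nhds (x := I)).div_atTop
        (tendsto_pow_atTop_atTop_of_one_lt (show 1 < 1 + ε by linarith))
      simpa [Function.comp_def] using (Real.continuous_sqrt.tendsto 0).comp this
    exact (ht.eventually_le_const (by positivity)).exists
  set D : ℝ := 2 ^ (K ^ 2) * (2 * M) ^ K with hD
  have hD0 : 0 < D := by positivity
  set θ := δ / (32 * D * (K + 1)) with hθ
  have hθ0 : 0 < θ := by positivity
  obtain ⟨C, hC, hplant⟩ := plantEffect_le_of_large q K (M := M) (by rw [hM]; linarith) hθ0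
  obtain ⟨J, hJ⟩ := exists_nat_gt (16 * D * C * (K + 1) / δ)
  have hJ0 : (0 : ℝ) < J := lt_of_le_of_lt (by positivity) hJ
  set η := (d₁ - d) / J with hη
  have hη0 : 0 < η := div_pos (by linarith) hJ0
  have hJη : d + J * η = d₁ := by rw [hη]; field_simp; ring
  obtain ⟨N₀, hN₀⟩ := hplant η hη0
  have hinv : ∀ c : ℝ, Tendsto (fun n : ℕ => c / (n : ℝ)) atTop (nhds 0) := fun c =>
    tendsto_const_div_atTop_nhds_zero_nat c
  have hc4 : 0 < ε ^ 2 / (4 * q) := by positivity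
  have ev1 := (hinv (2 * M)).eventually_le_const (show (0 : ℝ) < 1 by norm_num)
  have ev2 := (hinv (2 * M)).eventually_le_const hθ0
  have ev3 := (hinv (M * (1 + 1 / ε))).eventually_le_const (show (0 : ℝ) < 1 by norm_num)
  have ev4 := (hinv ((1 + ε) * (1 + ε) * d₁)).eventually_le_const (show (0 : ℝ) < 1 by norm_num)
  have ev5 := ((tendsto_exp_mul_pow _ hc4 0).const_mul (q : ℝ)).eventually_le_const
    (show (q : ℝ) * 0 < 1 / 2 by norm_num)
  have ev6 := ((tendsto_exp_mul_pow _ hc4 K).const_mul (q * Real.exp (2 * M))).eventually_le_const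
    (show (q * Real.exp (2 * M)) * 0 < δ / 16 by rw [mul_zero]; positivity)
  clear_value D θ η I β r c₀
  obtain ⟨N, hN⟩ := eventually_atTop.mp (ev1.and (ev2.and (ev3.and (ev4.and (ev5.and (ev6.and
    (eventually_ge_atTop (max N₀ 1))))))))
  refine ⟨N, fun n hn => ?_⟩
  obtain ⟨e1, e2, e3, e4, e5, e6, e7⟩ := hN n hn
  have hnN : N₀ ≤ n := (le_max_left _ _).trans e7
  have hn0 : 0 < n := (le_max_right _ _).trans e7
  have hn' : (0 : ℝ) < n := by exact_mod_cast hn0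
  have hdM : d₁ / n ≤ 1 := by
    refine le_trans ?_ e1
    gcongr
    linarith
  obtain ⟨j, hj, hstep⟩ := exists_small_step (n := n) (q := q) (K := K) (J := J)
    (by exact_mod_cast hJ0) hd0 hη0 (by rw [hJη]; exact hdM)
  obtain ⟨a, ha⟩ : ∃ a, a = d + j * η := ⟨_, rfl⟩
  obtain ⟨a', ha'⟩ : ∃ a', a' = d + (j + 1 : ℕ) * η := ⟨_, rfl⟩
  rw [← ha, ← ha'] at hstep
  have hda : d ≤ a := by rw [ha]; have : 0 ≤ j * η := by positivity
                         linarith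
  have haa : a + η = a' := by rw [ha, ha']; push_cast; ring
  have ha'd : a' ≤ d₁ := by
    rw [← hJη, ha']
    have : ((j + 1 : ℕ) : ℝ) ≤ J := by exact_mod_cast hj
    gcongr
  have had₁ : a ≤ d₁ := by linarith
  have ha0 : 0 ≤ a := hd0.trans hda
  have hp1 : a / n ≤ d₁ / n := by gcongr
  have hodds : (a / n) / (1 - a / n) ≤ (1 + ε) * (d₁ / n) := by
    refine odds_le hε0 (by positivity) hp1 (z := M / n) (by gcongr; linarith) ?_
    rwa [div_mul_eq_mul_div]
  have hX := prob_not_colorable_le hn0 hq (β := β) (l := 1 + ε) hε0 hε1 (by linarith) K ha0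
    (by linarith : a ≤ a') (by linarith : a' ≤ M) (by linarith) hθ0 hC e1
    ((overlap_rate_le hn' (by linarith) hL0 hε0.le hodds).trans_eq (by rw [hβ, hr, hc₀])) hβ'
    (le_trans (mul_le_mul_of_nonneg_left hodds (by linarith))
      (le_trans (le_of_eq (by ring)) e4))
    (by simpa using e5) (hN₀ n hnN a a' ha0 haa.le (by linarith))
  rw [← hI, ← hD] at hX
  have hmono : selectionExp (probOn (pairSet n) (d / n)) (fun T => 1 - colInd q T) ≤
      selectionExp (probOn (pairSet n) (a / n)) (fun T => 1 - colInd q T) := by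
    rw [selectionExp_sub, selectionExp_sub, selectionExp_const, selectionExp_const]
    have := selectionExp_antitone_prob (q := q) (pairSet n) (p := d / n) (p' := a / n)
      (by positivity) (by gcongr) (hp1.trans hdM)
    linarith
  have hnn : 0 ≤ selectionExp (probOn (pairSet n) (d / n)) (fun T => 1 - colInd q T) :=
    selectionExp_nonneg (isProbVec_probOn _ (by positivity)
      (le_trans (by gcongr) hdM)) fun T => sub_nonneg.mpr (colInd_le_one T)
  rw [Real.dist_eq, sub_zero, abs_of_nonneg hnn]
  have t1 : (q : ℝ) * Real.exp (-(ε ^ 2 / (4 * q)) * n) * ((n : ℝ) ^ K * Real.exp (2 * M)) ≤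
      δ / 16 := by
    calc _ = q * Real.exp (2 * M) * (Real.exp (-(ε ^ 2 / (4 * q)) * n) * (n : ℝ) ^ K) := by ring
      _ ≤ _ := e6
  have t2 : D * ((2 * M / n + θ) * (K + 1) +
      C * (colPotential n q K a - colPotential n q K a')) ≤ δ / 16 + δ / 16 := by
    calc _ ≤ D * ((θ + θ) * (K + 1) + C * ((K + 1) / J)) := by gcongr
      _ = D * (θ * (K + 1)) * 2 + D * C * (K + 1) / J := by ring
      _ ≤ _ := by
        refine add_le_add (le_of_eq ?_) ?_
        · rw [hθ]; field_simp; norm_num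
        · rw [div_lt_iff₀ hδ] at hJ
          rw [div_le_iff₀ hJ0]
          linarith
  linarith

end Assembly

section LowerBound

variable {n k : ℕ}

lemma sum_pairSet_mono_le (σ : Fin n → Fin k) :
    2 * ∑ e ∈ pairSet n, (1 - k * (if σ e.1 = σ e.2 then (1 : ℝ) else 0)) ≤ (k - 1) * n := by
  have h1 := sum_pairSet_symm (fun e : Fin n × Fin n =>
    1 - k * (if σ e.1 = σ e.2 then (1 : ℝ) else 0) + (k - 1) * (if e.1 = e.2 then (1 : ℝ) else 0))
    (fun u v => by simp only [eq_comm]) (fun u => by simp)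
  have h2 : ∑ e ∈ pairSet n, (1 - k * (if σ e.1 = σ e.2 then (1 : ℝ) else 0) +
      (k - 1) * (if e.1 = e.2 then (1 : ℝ) else 0)) =
      ∑ e ∈ pairSet n, (1 - k * (if σ e.1 = σ e.2 then (1 : ℝ) else 0)) := by
    refine sum_congr rfl fun e he => ?_
    rw [pairSet, mem_filter] at he
    simp [he.2.ne]
  rw [h2] at h1
  refine h1.trans ?_
  have h3 := sum_same_color_ge σ
  simp only [sum_add_distrib, sum_sub_distrib, ← mul_sum]
  simp only [sum_const, card_univ, Fintype.card_fin, nsmul_eq_mul, mul_one, sum_ite_eq,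
    mem_univ, if_true]
  nlinarith

lemma selectionExp_proper_pow (p θ : ℝ) (σ : Fin n → Fin k) :
    selectionExp (probOn (pairSet n) p) (fun T => if IsProper σ T then θ ^ T.card else 0) =
      ∏ e ∈ pairSet n, (1 - p + p * (if σ e.1 = σ e.2 then 0 else θ)) := by
  have h1 : (fun T : Finset (Fin n × Fin n) => if IsProper σ T then θ ^ T.card else 0) =
      fun T => ∏ e, if e ∈ T then (if σ e.1 = σ e.2 then 0 else θ) else 1 := by
    funext T
    rw [prod_ite_mem, univ_inter]
    by_cases h : IsProper σ T
    · rw [if_pos h, prod_congr rfl fun e he => if_neg (h e he), prod_const]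
    · rw [if_neg h]
      simp only [IsProper, not_forall, not_not] at h
      obtain ⟨e, he, h⟩ := h
      symm
      exact Finset.prod_eq_zero (i := e) he (if_pos h)
  rw [h1, selectionExp_prod]
  symm
  refine prod_subset_one_on_sdiff (subset_univ _) (fun e he => ?_) fun e he => ?_
  · simp [probOn, (Finset.mem_sdiff.mp he).2]
  · simp only [probOn, if_pos he]
    ring

lemma selectionExp_proper_pow_le (hk : 2 ≤ k) {p : ℝ} (h0 : 0 ≤ p) (h1 : p ≤ 1)
    (σ : Fin n → Fin k) :
    selectionExp (probOn (pairSet n) p)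
      (fun T => if IsProper σ T then ((k : ℝ) / (k - 1)) ^ T.card else 0) ≤
      Real.exp (p * n / 2) := by
  have hk' : (2 : ℝ) ≤ k := by exact_mod_cast hk
  have hk1 : (0 : ℝ) < k - 1 := by linarith
  rw [selectionExp_proper_pow]
  have h2 : ∀ e : Fin n × Fin n,
      1 - p + p * (if σ e.1 = σ e.2 then 0 else (k : ℝ) / (k - 1)) =
      p / (k - 1) * (1 - k * (if σ e.1 = σ e.2 then (1 : ℝ) else 0)) + 1 := by
    intro e
    split_ifs <;> field_simp <;> ring
  calc _ ≤ ∏ e ∈ pairSet n,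
        Real.exp (p / (k - 1) * (1 - k * (if σ e.1 = σ e.2 then (1 : ℝ) else 0))) := by
        refine prod_le_prod (fun e _ => ?_) fun e _ => ?_
        · have : 0 ≤ p * (if σ e.1 = σ e.2 then 0 else (k : ℝ) / (k - 1)) :=
            mul_nonneg h0 (by split_ifs <;> positivity)
          linarith
        · rw [h2]
          exact Real.add_one_le_exp _
    _ = Real.exp (p / (k - 1) *
        ∑ e ∈ pairSet n, (1 - k * (if σ e.1 = σ e.2 then (1 : ℝ) else 0))) := by
        rw [← Real.exp_sum, mul_sum]
    _ ≤ _ := by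
        refine Real.exp_le_exp.mpr ?_
        calc _ ≤ p / (k - 1) * ((k - 1) * n / 2) := by
              gcongr
              linarith [sum_pairSet_mono_le σ]
          _ = _ := by field_simp

lemma colInd_le_sum {θ x y : ℝ} (T : Finset (Fin n × Fin n)) (hθ : 1 ≤ θ) {s : ℝ} (hs : 0 ≤ s)
    (hy : y = Real.log θ * x) :
    colInd k T ≤ Real.exp (s * x) * Real.exp (-s) ^ T.card +
      Real.exp (-y) * ∑ σ : Fin n → Fin k, if IsProper σ T then θ ^ T.card else 0 := by
  have hθ0 : 0 < θ := by linarith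
  have hnn : 0 ≤ Real.exp (-y) *
      ∑ σ : Fin n → Fin k, if IsProper σ T then θ ^ T.card else 0 :=
    mul_nonneg (Real.exp_pos _).le (sum_nonneg fun σ _ => by split_ifs <;> positivity)
  by_cases hx : (T.card : ℝ) ≤ x
  · refine (colInd_le_one T).trans (le_add_of_le_of_nonneg ?_ hnn)
    rw [← Real.exp_nat_mul, ← Real.exp_add]
    exact Real.one_le_exp (by nlinarith)
  · push Not at hx
    refine le_add_of_nonneg_of_le (by positivity) ?_
    unfold colInd
    split_ifs with h
    · obtain ⟨σ, hσ⟩ := h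
      calc (1 : ℝ) ≤ Real.exp (-y) * θ ^ T.card := by
            rw [← Real.exp_log (pow_pos hθ0 T.card), Real.log_pow, ← Real.exp_add]
            refine Real.one_le_exp ?_
            have := Real.log_nonneg hθ
            nlinarith
        _ ≤ _ := by
            gcongr
            exact (if_pos (α := ℝ) hσ (t := θ ^ T.card) (e := 0)).symm.trans_le <|
              single_le_sum (f := fun σ => if IsProper σ T then θ ^ T.card else 0)
                (fun σ _ => by split_ifs <;> positivity) (mem_univ σ)
    · exact hnn

lemma card_pairSet (n : ℕ) : (pairSet n).card = n.choose 2 := by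
  have h : ∀ m : ℕ, ∑ i ∈ range m, i = m.choose 2 := fun m => by
    rw [sum_range_id, Nat.choose_two_right]
  rw [← h, pairSet, card_filter, Fintype.sum_prod_type_right, ← Fin.sum_univ_eq_sum_range]
  refine sum_congr rfl fun v _ => ?_
  dsimp only
  rw [← card_filter, ← Fin.card_Iio v]
  congr 1
  ext u
  simp

lemma selectionExp_pow_card_le {d s : ℝ} (hn : 0 < n) (hd : 0 ≤ d) (h1 : d / n ≤ 1) :
    selectionExp (probOn (pairSet n) (d / n)) (fun T => Real.exp (-s) ^ T.card) ≤
      Real.exp (-(d / 2 * (1 - Real.exp (-s))) * (n - 1)) := by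
  have hn' : (0 : ℝ) < n := by exact_mod_cast hn
  rw [selectionExp_pow_card, card_pairSet]
  have h0 : 0 ≤ d / n := by positivity
  calc _ ≤ Real.exp (-(d / n * (1 - Real.exp (-s)))) ^ n.choose 2 := by
        refine pow_le_pow_left₀ ?_ ?_ _
        · have : 0 ≤ d / n * Real.exp (-s) := by positivity
          linarith
        · have := Real.add_one_le_exp (-(d / n * (1 - Real.exp (-s))))
          linarith
    _ = _ := by
        rw [← Real.exp_nat_mul, Nat.cast_choose_two]
        congr 1
        field_simp

lemma one_lt_mul_log (hk : 2 ≤ k) : 1 < ((k : ℝ) - 1 / 2) * Real.log (k / (k - 1)) := by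
  have hk' : (2 : ℝ) ≤ k := by exact_mod_cast hk
  obtain ⟨x, hx⟩ : ∃ x : ℝ, x = 1 / (2 * k - 1) := ⟨_, rfl⟩
  have h2 : (0 : ℝ) < 2 * k - 1 := by linarith
  have hx0 : 0 < x := by rw [hx]; positivity
  have hx1 : x < 1 := by rw [hx, div_lt_one h2]; linarith
  have hs := Real.hasSum_log_sub_log_of_abs_lt_one (by rwa [abs_of_pos hx0])
  have h3 := sum_le_hasSum (range 2) (fun i _ => by positivity) hs
  rw [sum_range_succ, sum_range_one, ← Real.log_div (by linarith) (by linarith)] at h3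
  have h4 : (1 + x) / (1 - x) = k / (k - 1) := by
    have : (0 : ℝ) < k - 1 := by linarith
    rw [div_eq_div_iff (by linarith) (by linarith), hx]
    field_simp
    ring
  rw [h4] at h3
  have h5 : 2 * x < Real.log (k / (k - 1)) := by
    refine lt_of_lt_of_le ?_ h3
    norm_num
    positivity
  have h6 : ((k : ℝ) - 1 / 2) * (2 * x) = 1 := by
    rw [hx]
    field_simp
    rw [div_eq_one_iff_eq (by linarith)]
  exact h6.symm.trans_lt <| mul_lt_mul_of_pos_left h5 (show (0 : ℝ) < k - 1 / 2 by linarith)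

theorem tendsto_prob_colorable (hk : 2 ≤ k) {d : ℝ} (hd : (2 * k - 1) * Real.log k ≤ d) :
    Tendsto (fun n : ℕ => selectionExp (probOn (pairSet n) (d / n)) (colInd k))
      atTop (nhds 0) := by
  have hk' : (2 : ℝ) ≤ k := by exact_mod_cast hk
  have hL : 0 < Real.log k := Real.log_pos (by linarith)
  obtain ⟨θ, hθ⟩ : ∃ θ : ℝ, θ = k / (k - 1) := ⟨_, rfl⟩
  have hθ1 : 1 < θ := by rw [hθ, one_lt_div (by linarith)]; linarith
  have hl0 : 0 < Real.log θ := Real.log_pos hθ1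
  have hkey := one_lt_mul_log hk
  rw [← hθ] at hkey
  have hc' : Real.log k / Real.log θ < d / 2 := by
    rw [div_lt_iff₀ hl0]
    calc Real.log k < (((k : ℝ) - 1 / 2) * Real.log θ) * Real.log k := lt_mul_of_one_lt_left hL hkey
      _ = (2 * k - 1) * Real.log k / 2 * Real.log θ := by ring
      _ ≤ _ := by gcongr
  obtain ⟨c, hc1, hc2⟩ := exists_between hc'
  have hc0 : 0 < c := lt_trans (by positivity) hc1
  rw [div_lt_iff₀ hl0] at hc1
  have hd0 : 0 < d := by linarith
  obtain ⟨s, hs⟩ : ∃ s, s = (d / 2 - c) / (2 * c) := ⟨_, rfl⟩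
  have hs0 : 0 < s := by rw [hs]; exact div_pos (by linarith) (by linarith)
  obtain ⟨g, hg⟩ : ∃ g, g = d / 2 * (1 - Real.exp (-s)) := ⟨_, rfl⟩
  have hgc : s * c < g := by
    have h1 : s / (1 + s) ≤ 1 - Real.exp (-s) := by
      have h2 := Real.add_one_le_exp s
      rw [Real.exp_neg, div_le_iff₀ (by linarith), sub_mul, one_mul]
      have h3 : (Real.exp s)⁻¹ * (1 + s) ≤ 1 := by
        rw [inv_mul_le_iff₀ (Real.exp_pos s)]; linarith
      linarith
    have h2 : c * (1 + s) < d / 2 := by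
      have : c * s = (d / 2 - c) / 2 := by rw [hs]; field_simp
      linarith
    have h3 : s * c = (c * (1 + s)) * (s / (1 + s)) := by field_simp
    rw [h3, hg]
    calc _ < d / 2 * (s / (1 + s)) := by gcongr
      _ ≤ _ := by gcongr
  have hlim : Tendsto (fun n : ℕ => Real.exp g * (Real.exp (-(g - s * c) * n) * (n : ℝ) ^ 0) +
      Real.exp (d / 2) * (Real.exp (-(c * Real.log θ - Real.log k) * n) * (n : ℝ) ^ 0))
      atTop (nhds 0) := by
    have h1 := (tendsto_exp_mul_pow (g - s * c) (by linarith) 0).const_mul (Real.exp g)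
    have h2 := (tendsto_exp_mul_pow (c * Real.log θ - Real.log k) (by linarith) 0).const_mul
      (Real.exp (d / 2))
    simpa using h1.add h2
  refine squeeze_zero' ?_ ?_ hlim
  · filter_upwards [eventually_ge_atTop (max 1 ⌈d⌉₊)] with n hn
    have hn0 : (0 : ℝ) < n := by exact_mod_cast (le_max_left _ _).trans hn
    have hn1 : d ≤ n := (Nat.le_ceil d).trans (by exact_mod_cast (le_max_right _ _).trans hn)
    exact selectionExp_nonneg (isProbVec_probOn _ (by positivity) ((div_le_one hn0).mpr hn1))
      colInd_nonneg
  · filter_upwards [eventually_ge_atTop (max 1 ⌈d⌉₊)] with n hn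
    have hn0' : 0 < n := (le_max_left _ _).trans hn
    have hn0 : (0 : ℝ) < n := by exact_mod_cast hn0'
    have hn1 : d ≤ n := (Nat.le_ceil d).trans (by exact_mod_cast (le_max_right _ _).trans hn)
    have hp0 : 0 ≤ d / n := by positivity
    have hp1 : d / n ≤ 1 := (div_le_one hn0).mpr hn1
    have hp := isProbVec_probOn (pairSet n) hp0 hp1
    refine (selectionExp_mono hp fun T => colInd_le_sum (x := c * n) T hθ1.le hs0.le rfl).trans ?_
    rw [selectionExp_add, selectionExp_const_mul, selectionExp_const_mul, selectionExp_sum]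
    refine add_le_add ?_ ?_
    · calc _ ≤ Real.exp (s * (c * n)) * Real.exp (-g * (n - 1)) := by
            rw [hg]
            gcongr
            exact selectionExp_pow_card_le hn0' hd0.le hp1
        _ = _ := by
            rw [pow_zero, mul_one, ← Real.exp_add, ← Real.exp_add]
            congr 1
            ring
    · calc _ ≤ Real.exp (-(Real.log θ * (c * n))) *
            ∑ _σ : Fin n → Fin k, Real.exp (d / n * n / 2) := by
            gcongr with σ
            rw [hθ]
            exact selectionExp_proper_pow_le hk hp0 hp1 σ
        _ = _ := by
            rw [sum_const, card_univ, Fintype.card_fun, Fintype.card_fin, Fintype.card_fin,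
              nsmul_eq_mul, Nat.cast_pow, div_mul_cancel₀ _ hn0.ne',
              ← Real.exp_log (show (0 : ℝ) < (k : ℝ) ^ n by positivity), Real.log_pow,
              pow_zero, mul_one, ← Real.exp_add, ← Real.exp_add, ← Real.exp_add]
            congr 1
            ring

end LowerBound

section Translation

variable {n : ℕ}

/-- The edges of `G`, each written with its smaller endpoint first. -/
noncomputable def orderedEdges (G : SimpleGraph (Fin n)) : Finset (Fin n × Fin n) :=
  (pairSet n).filter fun e => G.Adj e.1 e.2

lemma mem_orderedEdges {G : SimpleGraph (Fin n)} {e : Fin n × Fin n} :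
    e ∈ orderedEdges G ↔ e.1 < e.2 ∧ G.Adj e.1 e.2 := by
  simp [orderedEdges, pairSet]

lemma card_orderedEdges (G : SimpleGraph (Fin n)) :
    (orderedEdges G).card = G.edgeFinset.card := by
  refine card_bij (fun e _ => s(e.1, e.2)) (fun e he => ?_) (fun e he f hf h => ?_) fun b hb => ?_
  · rw [SimpleGraph.mem_edgeFinset, SimpleGraph.mem_edgeSet]
    exact (mem_orderedEdges.mp he).2
  · have h1 := (mem_orderedEdges.mp he).1
    have h2 := (mem_orderedEdges.mp hf).1
    rw [Sym2.eq_iff] at h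
    rcases h with ⟨h3, h4⟩ | ⟨h3, h4⟩
    · exact Prod.ext h3 h4
    · rw [h3, h4] at h1
      exact absurd h1 h2.asymm
  · induction b with | _ u v
    rw [SimpleGraph.mem_edgeFinset, SimpleGraph.mem_edgeSet] at hb
    rcases lt_or_gt_of_ne hb.ne with h | h
    · exact ⟨(u, v), mem_orderedEdges.mpr ⟨h, hb⟩, rfl⟩
    · exact ⟨(v, u), mem_orderedEdges.mpr ⟨h, hb.symm⟩, Sym2.eq_swap⟩

lemma orderedEdges_injective : Function.Injective (orderedEdges (n := n)) := by
  have key : ∀ G H : SimpleGraph (Fin n), orderedEdges G = orderedEdges H → ∀ u v,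
      G.Adj u v → H.Adj u v := by
    intro G H h u v hG
    rcases lt_or_gt_of_ne hG.ne with huv | huv
    · have : (u, v) ∈ orderedEdges H := h ▸ mem_orderedEdges.mpr ⟨huv, hG⟩
      exact (mem_orderedEdges.mp this).2
    · have : (v, u) ∈ orderedEdges H := h ▸ mem_orderedEdges.mpr ⟨huv, hG.symm⟩
      exact (mem_orderedEdges.mp this).2.symm
  intro G H h
  ext u v
  exact ⟨key G H h u v, key H G h.symm u v⟩

lemma exists_orderedEdges_eq {T : Finset (Fin n × Fin n)} (hT : T ⊆ pairSet n) :
    ∃ G, orderedEdges G = T := by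
  refine ⟨SimpleGraph.fromRel fun u v => (u, v) ∈ T, ?_⟩
  have hlt : ∀ u v, (u, v) ∈ T → u < v := fun u v h => (mem_filter.mp (hT h)).2
  ext ⟨u, v⟩
  rw [mem_orderedEdges, SimpleGraph.fromRel_adj]
  constructor
  · rintro ⟨h1, -, h2 | h2⟩
    · exact h2
    · exact absurd (hlt _ _ h2) h1.asymm
  · exact fun h => ⟨hlt _ _ h, (hlt _ _ h).ne, Or.inl h⟩

lemma selectionWeight_probOn {T : Finset (Fin n × Fin n)} (hT : T ⊆ pairSet n) (p : ℝ) :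
    selectionWeight (probOn (pairSet n) p) T =
      p ^ T.card * (1 - p) ^ (n.choose 2 - T.card) := by
  rw [selectionWeight, ← card_pairSet, ← card_sdiff_of_subset hT]
  congr 1
  · rw [← prod_const]
    exact prod_congr rfl fun e he => if_pos (hT he)
  · rw [← prod_const]
    symm
    refine prod_subset_one_on_sdiff (sdiff_subset_sdiff (subset_univ _) subset_rfl)
      (fun e he => ?_) fun e he => ?_
    · simp only [Finset.mem_sdiff, mem_univ, true_and, not_and, not_not] at he
      have : e ∉ pairSet n := fun h => he.1 (he.2 h)
      simp [probOn, this]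
    · simp [probOn, (Finset.mem_sdiff.mp he).1]

lemma erdosRenyiProb_eq_selectionExp (p : ℝ) (P : SimpleGraph (Fin n) → Prop)
    (F : Finset (Fin n × Fin n) → ℝ) (h : ∀ G, (if P G then 1 else 0) = F (orderedEdges G)) :
    erdosRenyiProb n p P = selectionExp (probOn (pairSet n) p) F := by
  have h1 : erdosRenyiProb n p P = ∑ G : SimpleGraph (Fin n),
      selectionWeight (probOn (pairSet n) p) (orderedEdges G) * F (orderedEdges G) := by
    refine sum_congr rfl fun G _ => ?_
    rw [selectionWeight_probOn (T := orderedEdges G) (filter_subset _ _), ← h, card_orderedEdges]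
    split_ifs <;> simp
  rw [h1, selectionExp, ← sum_image (s := univ) (g := orderedEdges)
    (f := fun T => selectionWeight (probOn (pairSet n) p) T * F T)
    (orderedEdges_injective.injOn)]
  refine sum_subset (subset_univ _) fun T _ hT => ?_
  have h2 : ¬ T ⊆ pairSet n := fun hs => by
    obtain ⟨G, hG⟩ := exists_orderedEdges_eq hs
    exact hT (mem_image.mpr ⟨G, mem_univ _, hG⟩)
  obtain ⟨e, he, hU⟩ := not_subset.mp h2
  rw [selectionWeight_eq_zero he (by simp [probOn, hU]), zero_mul]

lemma pairColorable_orderedEdges {q : ℕ} {G : SimpleGraph (Fin n)} :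
    PairColorable q (orderedEdges G) ↔ G.Colorable q := by
  constructor
  · rintro ⟨σ, hσ⟩
    refine ⟨SimpleGraph.Coloring.mk σ fun {u v} h => ?_⟩
    rcases lt_or_gt_of_ne h.ne with huv | huv
    · exact hσ (u, v) (mem_orderedEdges.mpr ⟨huv, h⟩)
    · exact (hσ (v, u) (mem_orderedEdges.mpr ⟨huv, h.symm⟩)).symm
  · rintro ⟨C⟩
    exact ⟨C, fun e he => C.valid (mem_orderedEdges.mp he).2⟩

lemma chromaticNumber_eq_succ_iff {V : Type*} {G : SimpleGraph V} {k : ℕ} :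
    G.chromaticNumber = (k : ℕ∞) + 1 ↔ G.Colorable (k + 1) ∧ ¬ G.Colorable k := by
  rw [← SimpleGraph.chromaticNumber_le_iff_colorable,
    ← SimpleGraph.chromaticNumber_le_iff_colorable,
    not_le, ← ENat.add_one_le_iff (ENat.natCast_ne_top k), Nat.cast_add, Nat.cast_one]
  exact le_antisymm_iff

lemma erdosRenyiProb_chromaticNumber (p : ℝ) (k : ℕ) :
    erdosRenyiProb n p (fun G => G.chromaticNumber = (k : ℕ∞) + 1) =
      1 - selectionExp (probOn (pairSet n) p) (fun T => 1 - colInd (k + 1) T) -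
        selectionExp (probOn (pairSet n) p) (colInd k) := by
  rw [erdosRenyiProb_eq_selectionExp p _ (fun T => 1 - (1 - colInd (k + 1) T) - colInd k T),
    selectionExp_sub, selectionExp_sub, selectionExp_const]
  intro G
  simp only [chromaticNumber_eq_succ_iff, colInd, pairColorable_orderedEdges]
  have := fun h : G.Colorable k => h.mono k.le_succ
  by_cases h1 : G.Colorable k <;> by_cases h2 : G.Colorable (k + 1) <;> simp_all

end Translation

/-- If `k ≥ 2` and `(2k-1) log k ≤ d < 2k log k`, then w.h.p. the chromatic number of
`G(n, d/n)` equals `k + 1`. -/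
theorem chromatic_number_exact (k : ℕ) (hk : 2 ≤ k) (d : ℝ)
    (hd₁ : (2 * k - 1) * Real.log k ≤ d) (hd₂ : d < 2 * k * Real.log k) :
    Tendsto (fun n : ℕ =>
        erdosRenyiProb n (d / n) (fun G => G.chromaticNumber = (k : ℕ∞) + 1))
      atTop (nhds 1) := by
  have hk' : (2 : ℝ) ≤ k := by exact_mod_cast hk
  have hd0 : 0 ≤ d := le_trans (mul_nonneg (by linarith) (Real.log_nonneg (by linarith))) hd₁
  have h1 := tendsto_prob_not_colorable (q := k + 1) (by omega) hd0 (by simpa using hd₂)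
  simp only [erdosRenyiProb_chromaticNumber]
  simpa using (h1.const_sub 1).sub (tendsto_prob_colorable hk hd₁)
end

section
/- Let k ≥ 2 be an integer, let n be a positive multiple of k, and let m ≥ 0 be an integer. Let Z be the number of balanced proper k-colorings of the random multigraph G(n,m), and let D be the set of all k×k matrices L = (ℓ_ij) of nonnegative integers in which every row sum and every column sum equals n/k. Then E[Z²] = Σ_{L∈D} ( n! / Π_{i,j} ℓ_ij! ) · ( 1 − 2/k + Σ_{i,j} (ℓ_ij/n)² )^m. -/
open Finset Filter
open scoped Classical

/-- A proper `k`-coloring of the multigraph on `Fin n` whose `m` edges are given by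
`e : Fin m → Fin n × Fin n`: no edge is monochromatic. -/
def IsProperColoring {n m k : ℕ} (e : Fin m → Fin n × Fin n) (σ : Fin n → Fin k) : Prop :=
  ∀ i : Fin m, σ (e i).1 ≠ σ (e i).2

/-- A `k`-coloring of `n` vertices is balanced if every color class has size exactly `n/k`. -/
def IsBalanced (k n : ℕ) (σ : Fin n → Fin k) : Prop :=
  ∀ c : Fin k, (Finset.univ.filter (fun v => σ v = c)).card = n / k

/-- The number of balanced proper `k`-colorings of the multigraph with edge
configuration `e`. -/
noncomputable def numBalColorings (k n m : ℕ) (e : Fin m → Fin n × Fin n) : ℕ :=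
  (Finset.univ.filter
    (fun σ : Fin n → Fin k => IsBalanced k n σ ∧ IsProperColoring e σ)).card

/-- The multinomial coefficient counts the functions with prescribed fiber sizes. -/
theorem card_filter_fiber_card_eq_multinomial {ι : Type*} [Fintype ι] [DecidableEq ι] (n : ℕ) (c : ι → ℕ)
    (hc : ∑ i, c i = n) :
    (univ.filter (fun f : Fin n → ι => ∀ i, (univ.filter (fun a => f a = i)).card = c i)).card
      = Nat.multinomial univ c := by
  have key := (Fintype.sum_pow (fun i : ι => (MvPolynomial.X i : MvPolynomial ι ℕ)) n).symm.trans
    (Finset.sum_pow_eq_sum_piAntidiag univ (fun i : ι => (MvPolynomial.X i : MvPolynomial ι ℕ)) n)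
  have hmon : ∀ d : ι → ℕ, ∏ i, (MvPolynomial.X i : MvPolynomial ι ℕ) ^ d i =
      MvPolynomial.monomial (Finsupp.equivFunOnFinite.symm d) 1 := by
    intro d
    rw [MvPolynomial.monomial_eq, Finsupp.prod_fintype _ _ (by simp)]
    simp
  have hfun : ∀ f : Fin n → ι, ∏ a, (MvPolynomial.X (f a) : MvPolynomial ι ℕ) =
      MvPolynomial.monomial (Finsupp.equivFunOnFinite.symm
        (fun i => (univ.filter (fun a => f a = i)).card)) 1 := by
    intro f
    rw [← hmon, ← Finset.prod_fiberwise univ f]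
    refine Finset.prod_congr rfl fun i _ => ?_
    rw [← Finset.prod_const]
    refine Finset.prod_congr rfl fun a ha => ?_
    rw [(Finset.mem_filter.mp ha).2]
  have h := congrArg (MvPolynomial.coeff (Finsupp.equivFunOnFinite.symm c)) key
  simp only [hfun, hmon, MvPolynomial.coeff_sum, ← map_natCast (MvPolynomial.C (σ := ι) (R := ℕ)),
    MvPolynomial.coeff_C_mul, MvPolynomial.coeff_monomial, Equiv.apply_eq_iff_eq] at h
  simp only [mul_ite, mul_one, mul_zero, Nat.cast_id] at h
  rw [Finset.sum_ite_eq_of_mem' _ _ _ (by simp [hc])] at h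
  rw [Finset.card_filter, ← h]
  simp only [funext_iff]

/-- The number of pairs of points on which `f` agrees is the sum of the squared fiber sizes. -/
theorem sum_ite_eq_eq_sum_fiber_card_sq {α β : Type*} [Fintype α] [Fintype β] [DecidableEq β]
    (f : α → β) :
    ∑ p : α × α, (if f p.1 = f p.2 then (1 : ℝ) else 0) =
      ∑ b, ((univ.filter (fun a => f a = b)).card : ℝ) ^ 2 := by
  rw [Fintype.sum_prod_type, ← Finset.sum_fiberwise univ f]
  refine Finset.sum_congr rfl fun b _ => ?_
  rw [sq, ← nsmul_eq_mul, ← Finset.sum_const]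
  refine Finset.sum_congr rfl fun a ha => ?_
  rw [Finset.card_filter]
  push_cast
  refine Finset.sum_congr rfl fun x _ => ?_
  rw [(Finset.mem_filter.mp ha).2]
  simp only [eq_comm]

/-- The number of ordered pairs of vertices bichromatic in both coordinates of `φ`. -/
theorem card_filter_bichromatic {k n : ℕ} (hk : 0 < k) (hn : 0 < n) (hdvd : k ∣ n)
    (φ : Fin n → Fin k × Fin k)
    (h₁ : IsBalanced k n (fun v => (φ v).1)) (h₂ : IsBalanced k n (fun v => (φ v).2)) :
    ((univ.filter (fun p : Fin n × Fin n =>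
        (φ p.1).1 ≠ (φ p.2).1 ∧ (φ p.1).2 ≠ (φ p.2).2)).card : ℝ) =
      (n : ℝ) ^ 2 * (1 - 2 / (k : ℝ) +
        ∑ i, ∑ j, (((univ.filter (fun v => φ v = (i, j))).card : ℝ) / n) ^ 2) := by
  have e₁ := sum_ite_eq_eq_sum_fiber_card_sq (fun v => (φ v).1)
  have e₂ := sum_ite_eq_eq_sum_fiber_card_sq (fun v => (φ v).2)
  have e₃ := sum_ite_eq_eq_sum_fiber_card_sq φ
  have hb₁ : ∀ c, (univ.filter (fun v => (φ v).1 = c)).card = n / k := h₁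
  have hb₂ : ∀ c, (univ.filter (fun v => (φ v).2 = c)).card = n / k := h₂
  have hk' : (k : ℝ) ≠ 0 := by positivity
  have hn' : (n : ℝ) ≠ 0 := by positivity
  simp only [hb₁, sum_const, card_univ, Fintype.card_fin, nsmul_eq_mul, Nat.cast_div hdvd hk'] at e₁
  simp only [hb₂, sum_const, card_univ, Fintype.card_fin, nsmul_eq_mul, Nat.cast_div hdvd hk'] at e₂
  have hsplit : ((univ.filter (fun p : Fin n × Fin n =>
        (φ p.1).1 ≠ (φ p.2).1 ∧ (φ p.1).2 ≠ (φ p.2).2)).card : ℝ) =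
      ∑ p : Fin n × Fin n, (1 - (if (φ p.1).1 = (φ p.2).1 then (1 : ℝ) else 0)
        - (if (φ p.1).2 = (φ p.2).2 then (1 : ℝ) else 0)
        + (if φ p.1 = φ p.2 then (1 : ℝ) else 0)) := by
    rw [Finset.card_filter]
    push_cast
    refine Finset.sum_congr rfl fun p _ => ?_
    by_cases a : (φ p.1).1 = (φ p.2).1 <;> by_cases b : (φ p.1).2 = (φ p.2).2 <;>
      simp [a, b, Prod.ext_iff]
  rw [hsplit, sum_add_distrib, sum_sub_distrib, sum_sub_distrib, e₁, e₂, e₃]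
  simp only [Fintype.sum_prod_type, sum_const, card_univ, Fintype.card_prod, Fintype.card_fin,
    nsmul_eq_mul, div_pow, ← Finset.sum_div]
  push_cast
  field_simp
  ring

/-- The edge configurations properly colored by both coordinates of `φ`, counted edge by edge. -/
theorem card_filter_isProperColoring {k n m : ℕ} (φ : Fin n → Fin k × Fin k) :
    (univ.filter (fun e : Fin m → Fin n × Fin n =>
        IsProperColoring e (fun v => (φ v).1) ∧ IsProperColoring e (fun v => (φ v).2))).card =
      (univ.filter (fun p : Fin n × Fin n =>
        (φ p.1).1 ≠ (φ p.2).1 ∧ (φ p.1).2 ≠ (φ p.2).2)).card ^ m := by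
  have h := Fintype.card_piFinset_const (univ.filter (fun p : Fin n × Fin n =>
        (φ p.1).1 ≠ (φ p.2).1 ∧ (φ p.1).2 ≠ (φ p.2).2)) m
  rw [← h]
  congr 1
  ext e
  rw [mem_filter]
  simp only [mem_univ, true_and, Fintype.mem_piFinset, mem_filter, IsProperColoring, forall_and]

/-- The sum over all edge configurations of the squared number of balanced colorings counts
configurations together with pairs of colorings. -/
theorem sum_numBalColorings_sq (k n m : ℕ) :
    ∑ e : Fin m → Fin n × Fin n, (numBalColorings k n m e : ℝ) ^ 2 =
      ∑ φ ∈ univ.filter (fun φ : Fin n → Fin k × Fin k =>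
          IsBalanced k n (fun v => (φ v).1) ∧ IsBalanced k n (fun v => (φ v).2)),
        ((univ.filter (fun p : Fin n × Fin n =>
          (φ p.1).1 ≠ (φ p.2).1 ∧ (φ p.1).2 ≠ (φ p.2).2)).card : ℝ) ^ m := by
  have h : ∀ e : Fin m → Fin n × Fin n, (numBalColorings k n m e : ℝ) ^ 2 =
      ∑ φ ∈ univ.filter (fun φ : Fin n → Fin k × Fin k =>
          IsBalanced k n (fun v => (φ v).1) ∧ IsBalanced k n (fun v => (φ v).2)),
        if IsProperColoring e (fun v => (φ v).1) ∧ IsProperColoring e (fun v => (φ v).2)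
          then (1 : ℝ) else 0 := by
    intro e
    rw [sq, numBalColorings, ← Nat.cast_mul, ← Finset.card_product, ← Finset.sum_filter,
      Finset.sum_const, nsmul_one, Finset.filter_filter]
    congr 1
    refine (Finset.card_equiv (Equiv.arrowProdEquivProdArrow (Fin n) _ _) fun φ => ?_).symm
    simp [Equiv.arrowProdEquivProdArrow]
    tauto
  rw [Finset.sum_congr rfl fun e _ => h e, Finset.sum_comm]
  refine Finset.sum_congr rfl fun φ _ => ?_
  rw [← Nat.cast_pow, ← card_filter_isProperColoring, Finset.card_filter]
  push_cast
  rfl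

theorem sum_card_fiber_fst {α β γ : Type*} [Fintype α] [Fintype γ] [DecidableEq β]
    [DecidableEq γ] (φ : α → β × γ) (i : β) :
    ∑ j, (univ.filter (fun v => φ v = (i, j))).card = (univ.filter (fun v => (φ v).1 = i)).card := by
  rw [Finset.card_eq_sum_card_fiberwise (f := fun v => (φ v).2) (t := univ) (by simp)]
  simp [Finset.filter_filter, Prod.ext_iff]

theorem sum_card_fiber_snd {α β γ : Type*} [Fintype α] [Fintype β] [DecidableEq β]
    [DecidableEq γ] (φ : α → β × γ) (j : γ) :
    ∑ i, (univ.filter (fun v => φ v = (i, j))).card = (univ.filter (fun v => (φ v).2 = j)).card := by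
  rw [Finset.card_eq_sum_card_fiberwise (f := fun v => (φ v).1) (t := univ) (by simp)]
  simp [Finset.filter_filter, Prod.ext_iff, and_comm]

/-- The matrix whose `(i, j)` entry is the number of vertices receiving the color pair `(i, j)`. -/
def overlapMatrix {k n : ℕ} (φ : Fin n → Fin k × Fin k) : Matrix (Fin k) (Fin k) ℕ :=
  Matrix.of fun i j => (univ.filter (fun v => φ v = (i, j))).card

theorem overlapMatrix_apply {k n : ℕ} (φ : Fin n → Fin k × Fin k) (i j : Fin k) :
    overlapMatrix φ i j = (univ.filter (fun v => φ v = (i, j))).card := rfl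

/-- The second moment of the number `Z` of balanced proper `k`-colorings of the random
multigraph `G(n,m)` equals the sum, over all `k × k` matrices `L` of nonnegative integers
with all row and column sums equal to `n/k`, of
`(n!/∏ ℓ_{ij}!) ⬝ (1 - 2/k + ∑ (ℓ_{ij}/n)²)^m`. -/
theorem second_moment (k n m : ℕ) (hk : 2 ≤ k) (hn : 0 < n) (hdvd : k ∣ n) :
    (∑ e : Fin m → Fin n × Fin n, (numBalColorings k n m e : ℝ) ^ 2) / ((n : ℝ) ^ 2) ^ m =
      ∑ᶠ L : {L : Matrix (Fin k) (Fin k) ℕ //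
          (∀ i, ∑ j, L i j = n / k) ∧ (∀ j, ∑ i, L i j = n / k)},
        (n.factorial : ℝ) / (∏ i, ∏ j, ((L.1 i j).factorial : ℝ)) *
          (1 - 2 / (k : ℝ) + ∑ i, ∑ j, ((L.1 i j : ℝ) / n) ^ 2) ^ m := by
  have hfin : {L : Matrix (Fin k) (Fin k) ℕ |
      (∀ i, ∑ j, L i j = n / k) ∧ (∀ j, ∑ i, L i j = n / k)}.Finite := by
    refine (Set.finite_Iic (α := Fin k → Fin k → ℕ) fun _ _ => n / k).subset ?_
    rintro L ⟨hL, -⟩ i j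
    rw [← hL i]
    exact Finset.single_le_sum (f := fun j => L i j) (fun _ _ => Nat.zero_le _) (mem_univ j)
  let F : Matrix (Fin k) (Fin k) ℕ → ℝ := fun L =>
    (n.factorial : ℝ) / (∏ i, ∏ j, ((L i j).factorial : ℝ)) *
      (1 - 2 / (k : ℝ) + ∑ i, ∑ j, ((L i j : ℝ) / n) ^ 2) ^ m
  refine Eq.trans ?_ (finsum_set_coe_eq_finsum_mem (f := F) {L : Matrix (Fin k) (Fin k) ℕ |
      (∀ i, ∑ j, L i j = n / k) ∧ (∀ j, ∑ i, L i j = n / k)}).symm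
  rw [finsum_mem_eq_finite_toFinset_sum _ hfin, sum_numBalColorings_sq,
    ← Finset.sum_fiberwise_of_maps_to (t := hfin.toFinset)
      (g := overlapMatrix), Finset.sum_div]
  swap
  · intro φ hφ
    obtain ⟨h₁, h₂⟩ := (mem_filter.mp hφ).2
    rw [Set.Finite.mem_toFinset]
    exact ⟨fun i => (sum_card_fiber_fst φ i).trans (h₁ i),
      fun j => (sum_card_fiber_snd φ j).trans (h₂ j)⟩
  refine Finset.sum_congr rfl fun L hL => ?_
  obtain ⟨hr, hc⟩ := (Set.Finite.mem_toFinset _).mp hL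
  have hn' : (n : ℝ) ≠ 0 := by positivity
  have hterm : ∀ φ ∈ (univ.filter (fun φ : Fin n → Fin k × Fin k =>
        IsBalanced k n (fun v => (φ v).1) ∧ IsBalanced k n (fun v => (φ v).2))).filter
        (fun φ => overlapMatrix φ = L),
      ((univ.filter (fun p : Fin n × Fin n =>
          (φ p.1).1 ≠ (φ p.2).1 ∧ (φ p.1).2 ≠ (φ p.2).2)).card : ℝ) ^ m =
        ((n : ℝ) ^ 2) ^ m * (1 - 2 / (k : ℝ) + ∑ i, ∑ j, ((L i j : ℝ) / n) ^ 2) ^ m := by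
    intro φ hφ
    obtain ⟨hb, rfl⟩ := mem_filter.mp hφ
    obtain ⟨h₁, h₂⟩ := (mem_filter.mp hb).2
    rw [card_filter_bichromatic (by omega) hn hdvd φ h₁ h₂, mul_pow]
    rfl
  have hset : (univ.filter (fun φ : Fin n → Fin k × Fin k =>
        IsBalanced k n (fun v => (φ v).1) ∧ IsBalanced k n (fun v => (φ v).2))).filter
        (fun φ => overlapMatrix φ = L) =
      univ.filter (fun φ : Fin n → Fin k × Fin k =>
        ∀ p, (univ.filter (fun v => φ v = p)).card = L p.1 p.2) := by
    ext φ
    simp only [mem_filter, mem_univ, true_and]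
    constructor
    · rintro ⟨-, rfl⟩ p
      rfl
    · intro h
      refine ⟨⟨fun c => ?_, fun c => ?_⟩, Matrix.ext fun i j => h (i, j)⟩
      · rw [← sum_card_fiber_fst φ c, ← hr c]
        exact Finset.sum_congr rfl fun j _ => h (c, j)
      · rw [← sum_card_fiber_snd φ c, ← hc c]
        exact Finset.sum_congr rfl fun i _ => h (i, c)
  have htot : ∑ p : Fin k × Fin k, L p.1 p.2 = n := by
    rw [Fintype.sum_prod_type]
    simp [hr, Nat.mul_div_cancel' hdvd]
  have hcount : ((Nat.multinomial univ fun p : Fin k × Fin k => L p.1 p.2 : ℕ) : ℝ) =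
      (n.factorial : ℝ) / (∏ i, ∏ j, ((L i j).factorial : ℝ)) := by
    have hs := Nat.multinomial_spec univ fun p : Fin k × Fin k => L p.1 p.2
    rw [htot, Fintype.prod_prod_type] at hs
    rw [eq_div_iff (by positivity), ← hs]
    push_cast
    ring
  rw [Finset.sum_congr rfl hterm, Finset.sum_const, hset,
    card_filter_fiber_card_eq_multinomial n (fun p : Fin k × Fin k => L p.1 p.2) htot,
    nsmul_eq_mul, hcount]
  simp only [F]
  field_simp
end
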